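/- Let $k$ and $\ell$ be multiplicatively independent integers, each at least $2$, let $m, n \ge 1$ be integers, and let $a_1, \ldots, a_n, b_1, \ldots, b_m$ be nonzero rational numbers. Then there are at most $2^{-(n+m)} \cdot (8(n+m-1))^{10(n+m)^5 - (n+m)}$ tuples $(X_1, \ldots, X_n, Y_1, \ldots, Y_m)$ of rational numbers satisfying $a_1 X_1 + \cdots + a_n X_n + b_1 Y_1 + \cdots + b_m Y_m = 0$, in which each $X_i$ is an integer power of $k$, each $Y_j$ is an integer power of $\ell$, no nonempty subsum of $a_1 X_1 + \cdots + a_n X_n$ vanishes (i.e., $\sum_{i \in I} a_i X_i \neq 0$ for every nonempty $I \subseteq \{1, \ldots, n\}$), and no nonempty subsum of $b_1 Y_1 + \cdots + b_m Y_m$ vanishes. -/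

import Mathlib

/-- Two natural numbers `k, ℓ ≥ 2` are multiplicatively independent if
`k^a = ℓ^b` with integers `a, b` implies `a = b = 0`. -/
def MultIndep (k l : ℕ) : Prop :=
  ∀ a b : ℤ, (k : ℚ) ^ a = (l : ℚ) ^ b → a = 0 ∧ b = 0

section

open Polynomial

theorem signVariations_lt_card_support (f : ℚ[X]) (hf : f ≠ 0) :
    f.signVariations < f.support.card := by
  induction hn : f.support.card using Nat.strong_induction_on generalizing f with
  | _ n ih =>
    by_cases h0 : f.eraseLead = 0
    · have hcard : 0 < f.support.card := by
        rw [Finset.card_pos]; simpa using hf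
      have := eraseLead_add_monomial_natDegree_leadingCoeff f
      rw [h0, zero_add] at this
      rw [← this, signVariations_monomial]
      omega
    · have hc := card_support_eraseLead_add_one hf
      have h1 := ih _ (by omega) f.eraseLead h0 rfl
      have h2 := signVariations_le_eraseLead_succ (P := f)
      omega

/-- A polynomial with at most `T` monomials which vanishes at `1` to order `T` is zero. -/
theorem eq_zero_of_X_sub_one_pow_dvd {T : ℕ} {f : ℚ[X]} (hdvd : (X - C 1) ^ T ∣ f)
    (hcard : f.support.card ≤ T) : f = 0 := by
  by_contra hf
  have h1 : T ≤ f.rootMultiplicity 1 := (le_rootMultiplicity_iff hf).2 hdvd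
  have h2 := roots_countP_pos_le_signVariations f
  have h3 : f.rootMultiplicity 1 ≤ Multiset.countP (fun x => 0 < x) f.roots := by
    rw [← count_roots, Multiset.count]
    rw [Multiset.countP_eq_card_filter, Multiset.countP_eq_card_filter]
    refine Multiset.card_le_card (Multiset.monotone_filter_right _ fun x hx => ?_)
    exact hx ▸ one_pos
  have h4 := signVariations_lt_card_support f hf
  omega

/-- The operator `X d/dX - v`, which multiplies the coefficient of `X ^ u` by `u - v`. -/
noncomputable def eulerShift (v : ℚ) (f : ℚ[X]) : ℚ[X] := X * derivative f - C v * f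

theorem coeff_eulerShift (v : ℚ) (f : ℚ[X]) (u : ℕ) :
    (eulerShift v f).coeff u = (u - v) * f.coeff u := by
  unfold eulerShift
  rw [coeff_sub, coeff_C_mul]
  cases u with
  | zero => simp
  | succ u => rw [coeff_X_mul, coeff_derivative]; push_cast; ring

theorem dvd_eulerShift (v : ℚ) (f : ℚ[X]) (m : ℕ) (h : (X - C 1) ^ (m + 1) ∣ f) :
    (X - C 1) ^ m ∣ eulerShift v f := by
  obtain ⟨g, rfl⟩ := h
  unfold eulerShift
  refine dvd_sub ?_ ?_
  · rw [derivative_mul, derivative_pow]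
    refine Dvd.dvd.mul_left (dvd_add ?_ ?_) _
    · simp only [Nat.add_sub_cancel]
      exact Dvd.dvd.mul_right (Dvd.dvd.mul_right (Dvd.dvd.mul_left dvd_rfl _) _) _
    · exact Dvd.dvd.mul_right (pow_dvd_pow _ (Nat.le_succ m)) _
  · exact Dvd.dvd.mul_left (Dvd.dvd.mul_right (pow_dvd_pow _ (Nat.le_succ m)) _) _

/-- A polynomial of degree at most `L` whose coefficients vanish at all exponents `v i` and which
vanishes at `1` to order `L - #t`. -/
theorem exists_sparse {α : Type*} [DecidableEq α] (L : ℕ) (t : Finset α) (v : α → ℕ) :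
    ∃ f : ℚ[X], (∀ u, f.coeff u = (-1) ^ (L + u) * L.choose u * ∏ i ∈ t, ((u : ℚ) - v i)) ∧
      ∀ m, m + t.card ≤ L → (X - C 1) ^ m ∣ f := by
  induction t using Finset.induction_on with
  | empty =>
    refine ⟨(X - C 1) ^ L, fun u => ?_, fun m hm => pow_dvd_pow _ (by simpa using hm)⟩
    rw [sub_eq_add_neg, ← C_neg, coeff_X_add_C_pow]
    rcases le_or_gt u L with h | h
    · obtain ⟨d, rfl⟩ := Nat.exists_eq_add_of_le h
      have : u + d + u = d + 2 * u := by ring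
      simp [this, pow_add, pow_mul]
    · simp [Nat.choose_eq_zero_of_lt h]
  | insert i t hi ih =>
    obtain ⟨f, hf, hd⟩ := ih
    refine ⟨eulerShift (v i) f, fun u => ?_, fun m hm => ?_⟩
    · rw [coeff_eulerShift, hf, Finset.prod_insert hi]; ring
    · rw [Finset.card_insert_of_notMem hi] at hm
      exact dvd_eulerShift _ _ _ (hd _ (by omega))

theorem exists_prod_sub_eq_factorial_mul (s G u L : ℕ) (hu : u ≤ L) (hs : s + G ≤ L) :
    ∃ t : ℤ, ∏ v ∈ Finset.range G, ((u : ℤ) - (s + v : ℕ)) = G.factorial * t ∧ |t| ≤ 2 ^ L := by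
  by_cases h1 : u < s
  · obtain ⟨d, rfl⟩ := Nat.exists_eq_add_of_lt h1
    refine ⟨(-1) ^ G * (d + G).choose G, ?_, ?_⟩
    · have : ∏ v ∈ Finset.range G, ((u : ℤ) - (u + d + 1 + v : ℕ)) =
          ∏ v ∈ Finset.range G, ((-1 : ℤ) * ((d + 1 + v : ℕ) : ℤ)) := by
        refine Finset.prod_congr rfl fun v _ => ?_
        push_cast; ring
      rw [this, Finset.prod_mul_distrib, Finset.prod_const, Finset.card_range, ← Nat.cast_prod,
        ← Nat.ascFactorial_eq_prod_range, Nat.ascFactorial_eq_factorial_mul_choose]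
      push_cast; ring
    · rw [abs_mul, abs_pow, abs_neg, abs_one, one_pow, one_mul, Nat.abs_cast]
      calc (((d + G).choose G : ℕ) : ℤ) ≤ ((2 ^ (d + G) : ℕ) : ℤ) := by
            exact_mod_cast Nat.choose_le_two_pow _ _
        _ ≤ 2 ^ L := by
            push_cast
            exact pow_le_pow_right₀ (by norm_num) (by omega)
  by_cases h2 : u < s + G
  · refine ⟨0, ?_, by simp⟩
    rw [mul_zero]
    exact Finset.prod_eq_zero (i := u - s) (by simp; omega) (by
      have : s + (u - s) = u := by omega
      rw [this]; simp)
  · refine ⟨(u - s).choose G, ?_, ?_⟩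
    · have : ∏ v ∈ Finset.range G, ((u : ℤ) - (s + v : ℕ)) =
          ∏ v ∈ Finset.range G, (((u - s - v : ℕ) : ℤ)) := by
        refine Finset.prod_congr rfl fun v hv => ?_
        have := Finset.mem_range.1 hv
        omega
      rw [this, ← Nat.cast_prod, ← Nat.descFactorial_eq_prod_range,
        Nat.descFactorial_eq_factorial_mul_choose]
      push_cast; ring
    · rw [Nat.abs_cast]
      calc (((u - s).choose G : ℕ) : ℤ) ≤ ((2 ^ (u - s) : ℕ) : ℤ) := by
            exact_mod_cast Nat.choose_le_two_pow _ _
        _ ≤ 2 ^ L := by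
            push_cast
            exact pow_le_pow_right₀ (by norm_num) (by omega)

/-- Integral auxiliary polynomials of degree at most `q * B + r` whose exponents lie in the blocks
`[j * B, j * B + r]`, and which vanish at `1` to order `(q + 1) * r`. -/
theorem exists_auxiliary_family (q r B : ℕ) (hB : r + 1 ≤ B) :
    ∃ c : ℕ → ℕ → ℤ,
      (∀ i ≤ q, (X - C 1) ^ ((q + 1) * r) ∣
        ∑ u ∈ Finset.range (q * B + r + 1), monomial u ((c i u : ℤ) : ℚ)) ∧
      (∀ i ≤ q, ∀ u ≤ q * B + r, |c i u| ≤ 2 ^ ((2 * q + 1) * (q * B + r))) ∧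
      (∀ i j l, j ≤ q → r < l → l < B → j * B + l ≤ q * B + r → c i (j * B + l) = 0) ∧
      (∀ i j, i ≤ q → j ≤ q → (c i (j * B + r) = 0 ↔ j ≠ i)) := by
  obtain ⟨G, rfl⟩ := Nat.exists_eq_add_of_le hB
  set B := r + 1 + G with hBdef
  set L := q * B + r with hL
  have hstart : ∀ j u, j < q → u ≤ L → ∃ t : ℤ, ∏ v ∈ Finset.range G,
      ((u : ℤ) - (j * B + r + 1 + v : ℕ)) = G.factorial * t ∧ |t| ≤ 2 ^ L := by
    intro j u hj hu
    refine exists_prod_sub_eq_factorial_mul (j * B + r + 1) G u L hu ?_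
    have : (j + 1) * B ≤ q * B := Nat.mul_le_mul_right _ hj
    rw [hL, hBdef] at *
    nlinarith
  choose! t ht htb using hstart
  have hGne : (G.factorial : ℤ) ≠ 0 := by exact_mod_cast G.factorial_ne_zero
  let c : ℕ → ℕ → ℤ := fun i u => (-1) ^ (L + u) * L.choose u * (∏ j ∈ Finset.range q, t j u) *
    ∏ j ∈ (Finset.range (q + 1)).erase i, ((u : ℤ) - (j * B + r : ℕ))
  have hcd : ∀ i u, c i u = (-1) ^ (L + u) * L.choose u * (∏ j ∈ Finset.range q, t j u) *
    ∏ j ∈ (Finset.range (q + 1)).erase i, ((u : ℤ) - (j * B + r : ℕ)) := fun _ _ => rfl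
  have hchoose : ∀ u ≤ L, ((-1 : ℤ)) ^ (L + u) * L.choose u ≠ 0 := fun u hu =>
    mul_ne_zero (pow_ne_zero _ (by norm_num)) (by
      exact_mod_cast (Nat.choose_pos hu).ne')
  clear_value c
  refine ⟨c, fun i hi => ?_, fun i hi u hu => ?_, fun i j l hj hl hlB hle => ?_,
    fun i j hi hj => ?_⟩
  · obtain ⟨f, hf, hd⟩ := exists_sparse L
      ((Finset.range q ×ˢ Finset.range G).disjSum ((Finset.range (q + 1)).erase i))
      (Sum.elim (fun p => p.1 * B + r + 1 + p.2) (fun j => j * B + r))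
    have hfe : f = C ((G.factorial : ℚ) ^ q) *
        ∑ u ∈ Finset.range (L + 1), monomial u ((c i u : ℤ) : ℚ) := by
      ext u
      rw [coeff_C_mul, finsetSum_coeff, hf, Finset.prod_disjSum, Finset.prod_product]
      simp only [coeff_monomial, Finset.sum_ite_eq', Finset.mem_range, Sum.elim_inl, Sum.elim_inr]
      split_ifs with h
      · have h1 : ∏ x ∈ Finset.range q, ∏ y ∈ Finset.range G,
            ((u : ℚ) - ((x * B + r + 1 + y : ℕ) : ℚ)) =
            ((∏ x ∈ Finset.range q, (G.factorial * t x u : ℤ) : ℤ) : ℚ) := by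
          rw [Int.cast_prod]
          refine Finset.prod_congr rfl fun x hx => ?_
          rw [← ht x u (Finset.mem_range.1 hx) (by omega)]
          push_cast; rfl
        rw [h1, Finset.prod_mul_distrib, hcd]
        push_cast
        simp only [Finset.prod_const, Finset.card_range]
        ring
      · rw [Nat.choose_eq_zero_of_lt (by omega)]; simp
    have hdd := hd ((q + 1) * r) (by
      rw [Finset.card_disjSum, Finset.card_product, Finset.card_erase_of_mem (by simp; omega)]
      simp only [Finset.card_range]
      rw [hL, hBdef]
      have : q + 1 - 1 = q := by omega
      rw [this]; nlinarith)
    rw [hfe] at hdd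
    refine ((isUnit_C.2 (IsUnit.mk0 _ ?_)).dvd_mul_left).1 hdd
    exact pow_ne_zero _ (by exact_mod_cast G.factorial_ne_zero)
  · rw [hcd, abs_mul, abs_mul, abs_mul, abs_pow, abs_neg, abs_one, one_pow, one_mul,
      Finset.abs_prod, Finset.abs_prod, Nat.abs_cast]
    have h1 : ((L.choose u : ℕ) : ℤ) ≤ 2 ^ L := by exact_mod_cast Nat.choose_le_two_pow _ _
    have h2 : ∏ j ∈ Finset.range q, |t j u| ≤ (2 ^ L) ^ q := by
      calc _ ≤ ∏ j ∈ Finset.range q, (2 : ℤ) ^ L :=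
            Finset.prod_le_prod (fun _ _ => abs_nonneg _) fun j hj =>
              htb j u (Finset.mem_range.1 hj) hu
        _ = _ := by simp
    have h3 : ∏ j ∈ (Finset.range (q + 1)).erase i, |(u : ℤ) - (j * B + r : ℕ)| ≤ (2 ^ L) ^ q := by
      calc _ ≤ ∏ j ∈ (Finset.range (q + 1)).erase i, (2 : ℤ) ^ L := by
            refine Finset.prod_le_prod (fun _ _ => abs_nonneg _) fun j hj => ?_
            have hj' : j ≤ q := by
              have := Finset.mem_range.1 (Finset.mem_of_mem_erase hj); omega
            have h4 : j * B + r ≤ L := by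
              have := Nat.mul_le_mul_right B hj'; omega
            have h5 : (L : ℤ) ≤ 2 ^ L := by exact_mod_cast Nat.lt_two_pow_self.le
            refine le_trans ?_ h5
            rw [abs_le]; constructor <;> omega
        _ = _ := by
            rw [Finset.prod_const, Finset.card_erase_of_mem (by simp; omega)]; simp
    calc _ ≤ (2 : ℤ) ^ L * (2 ^ L) ^ q * (2 ^ L) ^ q := by gcongr
      _ = _ := by ring
  · have hjq : j < q := by
      by_contra h
      have : j = q := by omega
      subst this; omega
    have h0 : t j (j * B + l) = 0 := by
      have := ht j (j * B + l) hjq hle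
      rw [Finset.prod_eq_zero (i := l - (r + 1)) (by simp; omega)] at this
      · exact (mul_eq_zero.1 this.symm).resolve_left hGne
      · have : j * B + r + 1 + (l - (r + 1)) = j * B + l := by omega
        rw [this]; simp
    rw [hcd, Finset.prod_eq_zero (Finset.mem_range.2 hjq) h0]; simp
  · have hjL : j * B + r ≤ L := by
      have := Nat.mul_le_mul_right B hj; omega
    have hBpos : 0 < B := by omega
    have h2 : ∏ j' ∈ Finset.range q, t j' (j * B + r) ≠ 0 := by
      refine Finset.prod_ne_zero_iff.2 fun j' hj' h0 => ?_
      have := ht j' (j * B + r) (Finset.mem_range.1 hj') hjL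
      rw [h0, mul_zero, Finset.prod_eq_zero_iff] at this
      obtain ⟨v, hv, hv0⟩ := this
      have hv := Finset.mem_range.1 hv
      have he : j * B = j' * B + (1 + v) := by omega
      have h5 := congrArg (· % B) he
      simp only [Nat.mul_mod_left, Nat.mul_add_mod_of_lt (show 1 + v < B by omega)] at h5
      omega
    rw [hcd]
    rw [mul_eq_zero, or_iff_right (mul_ne_zero (hchoose _ hjL) h2), Finset.prod_eq_zero_iff]
    constructor
    · rintro ⟨j', hj', h0⟩ rfl
      have h6 : j * B = j' * B := by omega
      have := Nat.eq_of_mul_eq_mul_right hBpos h6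
      exact Finset.ne_of_mem_erase hj' this.symm
    · intro hne
      exact ⟨j, Finset.mem_erase.2 ⟨hne, Finset.mem_range.2 (by omega)⟩, by simp⟩

theorem sum_range_blocks {M : Type*} [AddCommMonoid M] (q r B : ℕ) (hB : r + 1 ≤ B) (f : ℕ → M)
    (hf : ∀ j l, r < l → l < B → j * B + l ≤ q * B + r → f (j * B + l) = 0) :
    ∑ u ∈ Finset.range (q * B + r + 1), f u =
      ∑ j ∈ Finset.range (q + 1), ∑ l ∈ Finset.range (r + 1), f (j * B + l) := by
  induction q with
  | zero => simp
  | succ q ih =>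
    have hle : (q + 1) * B = q * B + B := by ring
    rw [Finset.sum_range_succ _ (q + 1), ← ih fun j l h1 h2 h3 => hf j l h1 h2 (by omega)]
    have h1 : (q + 1) * B + r + 1 = q * B + r + 1 + (B - (r + 1)) + (r + 1) := by omega
    rw [h1, Finset.sum_range_add, Finset.sum_range_add, Finset.sum_eq_zero (s := Finset.range _)
      (f := fun x => f (q * B + r + 1 + x)), add_zero]
    · congr 1
      refine Finset.sum_congr rfl fun l _ => ?_
      congr 1; omega
    · intro x hx
      have hx := Finset.mem_range.1 hx
      have := hf q (r + 1 + x) (by omega) (by omega) (by omega)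
      rwa [show q * B + (r + 1 + x) = q * B + r + 1 + x by omega] at this

theorem card_support_sum_X_pow_mul_le {α : Type*} (s : Finset α) (n : α → ℕ) (H : α → ℚ[X]) :
    (∑ j ∈ s, X ^ n j * H j).support.card ≤ ∑ j ∈ s, (H j).support.card := by
  classical
  induction s using Finset.induction_on with
  | empty => simp
  | insert j s hj ih =>
    rw [Finset.sum_insert hj, Finset.sum_insert hj]
    refine (Finset.card_le_card support_add).trans ((Finset.card_union_le _ _).trans
      (add_le_add ?_ ih))
    have : (X ^ n j * H j).support ⊆ (H j).support.image (· + n j) := by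
      intro u hu
      rw [mem_support_iff, coeff_X_pow_mul'] at hu
      split_ifs at hu with h
      · exact Finset.mem_image.2 ⟨u - n j, mem_support_iff.2 hu, by omega⟩
      · exact absurd rfl hu
    exact (Finset.card_le_card this).trans Finset.card_image_le

/-- An integral auxiliary polynomial vanishing to order `(q + 1) * r` at `1` for which a prescribed
combination of values at `x` does not vanish. -/
theorem exists_auxiliary_coeffs (q r B : ℕ) (hB : r + 1 ≤ B) (x : ℚ) (hx0 : x ≠ 0)
    (hx1 : x ≠ 1) (y : ℕ → ℚ) (hy : ∃ j ≤ q, y j ≠ 0) :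
    ∃ c : ℕ → ℤ,
      ((X - C 1) ^ ((q + 1) * r) ∣
        ∑ u ∈ Finset.range (q * B + r + 1), monomial u ((c u : ℤ) : ℚ)) ∧
      (∀ u ≤ q * B + r, |c u| ≤ 2 ^ ((2 * q + 1) * (q * B + r))) ∧
      (∀ j l, r < l → l < B → j * B + l ≤ q * B + r → c (j * B + l) = 0) ∧
      ∑ j ∈ Finset.range (q + 1), ∑ l ∈ Finset.range (r + 1),
        (c (j * B + l) : ℚ) * x ^ (j * B + l) * y j ≠ 0 := by
  obtain ⟨c, hdvd, hbd, hgap, hdiag⟩ := exists_auxiliary_family q r B hB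
  have hgap' : ∀ i ≤ q, ∀ j l, r < l → l < B → j * B + l ≤ q * B + r → c i (j * B + l) = 0 := by
    intro i hi j l h1 h2 h3
    refine hgap i j l ?_ h1 h2 h3
    by_contra h
    have := Nat.mul_le_mul_right B (show q + 1 ≤ j by omega)
    have : (q + 1) * B = q * B + B := by ring
    omega
  suffices h : ∃ i ≤ q, ∑ j ∈ Finset.range (q + 1), ∑ l ∈ Finset.range (r + 1),
        (c i (j * B + l) : ℚ) * x ^ (j * B + l) * y j ≠ 0 by
    obtain ⟨i, hi, h⟩ := h
    exact ⟨c i, hdvd i hi, hbd i hi, hgap' i hi, h⟩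
  by_contra! hall
  let M : Matrix (Fin (q + 1)) (Fin (q + 1)) ℚ := fun i j =>
    ∑ l ∈ Finset.range (r + 1), (c i (j * B + l) : ℚ) * x ^ ((j : ℕ) * B + l)
  have hM : ∃ w, w ≠ 0 ∧ M.mulVec w = 0 := by
    obtain ⟨j, hj, hyj⟩ := hy
    refine ⟨fun j => y j, fun h => hyj (congrFun h ⟨j, by omega⟩), ?_⟩
    ext i
    have := hall i (by omega)
    rw [← Fin.sum_univ_eq_sum_range] at this
    simp only [M, Matrix.mulVec, dotProduct, Finset.sum_mul]
    simpa using this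
  rw [Matrix.exists_mulVec_eq_zero_iff, ← Matrix.exists_vecMul_eq_zero_iff] at hM
  obtain ⟨v, hv, hvM⟩ := hM
  let G : ℕ → ℚ[X] := fun j => ∑ i : Fin (q + 1), C (v i) *
    ∑ l ∈ Finset.range (r + 1), monomial l ((c i (j * B + l) : ℤ) : ℚ)
  let F : ℚ[X] := ∑ i : Fin (q + 1), C (v i) *
    ∑ u ∈ Finset.range (q * B + r + 1), monomial u ((c i u : ℤ) : ℚ)
  have hFdvd : (X - C 1) ^ ((q + 1) * r) ∣ F :=
    Finset.dvd_sum fun i _ => (hdvd i (by omega)).mul_left _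
  have hFG : F = ∑ j ∈ Finset.range (q + 1), X ^ (j * B) * G j := by
    simp only [F, G, Finset.mul_sum]
    rw [Finset.sum_comm]
    refine Eq.trans ?_ (Finset.sum_congr rfl fun j _ => Finset.sum_comm)
    rw [sum_range_blocks q r B hB]
    · refine Finset.sum_congr rfl fun j _ => Finset.sum_congr rfl fun l _ =>
        Finset.sum_congr rfl fun i _ => ?_
      rw [C_mul_monomial, C_mul_monomial, X_pow_mul_monomial, add_comm]
    · intro j l h1 h2 h3
      refine Finset.sum_eq_zero fun i _ => ?_
      rw [hgap' i (by omega) j l h1 h2 h3]; simp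
  have hroot : ∀ j ∈ Finset.range (q + 1), (X - C x) ∣ G j := by
    intro j hj
    rw [dvd_iff_isRoot, IsRoot.def]
    have h1 := congrFun hvM ⟨j, Finset.mem_range.1 hj⟩
    simp only [M, Matrix.vecMul, dotProduct, Pi.zero_apply] at h1
    have h2 : x ^ (j * B) * (G j).eval x = 0 := by
      rw [← h1]
      simp only [G, eval_finsetSum, eval_mul, eval_C, eval_monomial, Finset.mul_sum]
      refine Finset.sum_congr rfl fun i _ => Finset.sum_congr rfl fun l _ => ?_
      rw [pow_add]; ring
    exact (mul_eq_zero.1 h2).resolve_left (pow_ne_zero _ hx0)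
  choose! H hH using hroot
  have hGdeg : ∀ j, (G j).natDegree ≤ r := by
    intro j
    refine natDegree_sum_le_of_forall_le _ _ fun i _ => (natDegree_C_mul_le _ _).trans ?_
    refine natDegree_sum_le_of_forall_le _ _ fun l hl => (natDegree_monomial_le _).trans ?_
    have := Finset.mem_range.1 hl
    omega
  have hHcard : ∀ j ∈ Finset.range (q + 1), (H j).support.card ≤ r := by
    intro j hj
    by_cases h0 : H j = 0
    · simp [h0]
    have h1 := hGdeg j
    rw [hH j hj, natDegree_mul (X_sub_C_ne_zero x) h0, natDegree_X_sub_C] at h1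
    refine (card_supp_le_succ_natDegree _).trans ?_
    omega
  have hFH : F = (X - C x) * ∑ j ∈ Finset.range (q + 1), X ^ (j * B) * H j := by
    rw [hFG, Finset.mul_sum]
    refine Finset.sum_congr rfl fun j hj => ?_
    rw [hH j hj]; ring
  have hH0 : ∑ j ∈ Finset.range (q + 1), X ^ (j * B) * H j = 0 := by
    refine eq_zero_of_X_sub_one_pow_dvd (T := (q + 1) * r) ?_ ?_
    · rw [hFH] at hFdvd
      refine IsCoprime.dvd_of_dvd_mul_left (IsCoprime.pow_left ?_) hFdvd
      exact isCoprime_X_sub_C_of_isUnit_sub (IsUnit.mk0 _ (sub_ne_zero.2 hx1.symm))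
    · refine (card_support_sum_X_pow_mul_le _ _ _).trans
        ((Finset.sum_le_card_nsmul _ _ r hHcard).trans ?_)
      simp
  rw [hH0, mul_zero] at hFH
  refine hv (funext fun i => ?_)
  have h1 := congrArg (fun f => coeff f (i * B + r)) hFH
  have h2 : (i : ℕ) * B + r < q * B + r + 1 := by
    have := Nat.mul_le_mul_right B (show (i : ℕ) ≤ q by omega)
    omega
  simp only [F, finsetSum_coeff, coeff_C_mul, coeff_monomial, Finset.sum_ite_eq',
    Finset.mem_range, h2, if_true, coeff_zero] at h1
  rw [Finset.sum_eq_single i] at h1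
  · refine (mul_eq_zero.1 h1).resolve_right ?_
    intro h3
    have h4 : c i (i * B + r) = 0 := by exact_mod_cast h3
    exact (hdiag i i (by omega) (by omega)).1 h4 rfl
  · intro i' _ hne
    rw [(hdiag i' i (by omega) (by omega)).2 (fun h => hne (Fin.ext h.symm))]; simp
  · simp

/-- The logarithm of `|p * q|` for a rational number `p / q` in lowest terms. -/
noncomputable def logSize (x : ℚ) : ℝ := Real.log |(x.num : ℝ)| + Real.log x.den

theorem log_abs_int_nonneg (z : ℤ) : 0 ≤ Real.log |(z : ℝ)| := by
  by_cases h : z = 0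
  · simp [h]
  · exact Real.log_nonneg (by exact_mod_cast Int.one_le_abs h)

theorem log_den_nonneg (x : ℚ) : 0 ≤ Real.log x.den :=
  Real.log_nonneg (by exact_mod_cast x.pos)

theorem logSize_nonneg (x : ℚ) : 0 ≤ logSize x :=
  add_nonneg (log_abs_int_nonneg _) (log_den_nonneg _)

theorem logSize_div_le (A B : ℤ) (hA : A ≠ 0) (hB : B ≠ 0) :
    logSize ((A : ℚ) / B) ≤ Real.log |(A : ℝ)| + Real.log |(B : ℝ)| := by
  have h1 : ((A : ℚ) / B).num ∣ A := by
    rw [← Rat.divInt_eq_div]; exact Rat.num_dvd A hB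
  have h2 : (((A : ℚ) / B).den : ℤ) ∣ B := by
    rw [← Rat.divInt_eq_div]; exact Rat.den_dvd A B
  unfold logSize
  have h3 : |(((A : ℚ) / B).num : ℝ)| ≤ |(A : ℝ)| := by
    exact_mod_cast (Int.le_of_dvd (abs_pos.2 hA) ((abs_dvd_abs _ _).2 h1))
  have h4 : (((A : ℚ) / B).den : ℝ) ≤ |(B : ℝ)| := by
    exact_mod_cast (Int.le_of_dvd (abs_pos.2 hB) ((dvd_abs _ _).2 h2))
  have h5 : ((A : ℚ) / B).num ≠ 0 := by
    rw [Rat.num_ne_zero]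
    exact div_ne_zero (by exact_mod_cast hA) (by exact_mod_cast hB)
  gcongr

theorem logSize_mul_le {x y : ℚ} (hx : x ≠ 0) (hy : y ≠ 0) :
    logSize (x * y) ≤ logSize x + logSize y := by
  have hxn := Rat.num_ne_zero.2 hx
  have hyn := Rat.num_ne_zero.2 hy
  have h := logSize_div_le (x.num * y.num) (x.den * y.den) (mul_ne_zero hxn hyn)
    (by exact_mod_cast (mul_pos x.pos y.pos).ne')
  have h1 : ((x.num * y.num : ℤ) : ℚ) / ((x.den * y.den : ℤ) : ℚ) = x * y := by
    conv_rhs => rw [← Rat.num_div_den x, ← Rat.num_div_den y]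
    push_cast; ring
  rw [h1] at h
  refine h.trans (le_of_eq ?_)
  unfold logSize
  push_cast
  rw [abs_mul, abs_mul, Real.log_mul, Real.log_mul, Nat.abs_cast, Nat.abs_cast]
  · ring
  all_goals simp [hxn, hyn]

theorem logSize_inv (x : ℚ) : logSize x⁻¹ = logSize x := by
  by_cases h : x = 0
  · simp [h]
  unfold logSize
  have h1 : |((x⁻¹).num : ℝ)| = x.den := by
    rw [Rat.num_inv]; push_cast
    rw [abs_mul, Nat.abs_cast, ← Int.cast_abs, Int.abs_sign_of_ne_zero (Rat.num_ne_zero.2 h)]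
    simp
  have h2 : ((x⁻¹).den : ℝ) = |(x.num : ℝ)| := by
    rw [Rat.den_inv_of_ne_zero h]; simp
  rw [h1, h2, add_comm]

theorem logSize_div_le_add {x y : ℚ} (hx : x ≠ 0) (hy : y ≠ 0) :
    logSize (x / y) ≤ logSize x + logSize y := by
  rw [div_eq_mul_inv, ← logSize_inv y]
  exact logSize_mul_le hx (inv_ne_zero hy)

theorem logSize_neg (x : ℚ) : logSize (-x) = logSize x := by
  unfold logSize; simp

theorem den_le_exp_logSize (x : ℚ) : (x.den : ℝ) ≤ Real.exp (logSize x) := by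
  have h1 := log_abs_int_nonneg x.num
  rw [← Real.log_le_iff_le_exp (by exact_mod_cast x.pos)]
  unfold logSize; linarith

theorem exp_neg_logSize_le {x : ℚ} (hx : x ≠ 1) : Real.exp (-logSize x) ≤ |(x : ℝ) - 1| := by
  have h1 : |(x : ℝ) - 1| * x.den = |((x.num - x.den : ℤ) : ℝ)| := by
    have h : (x : ℝ) * x.den = x.num := by exact_mod_cast Rat.mul_den_eq_num x
    have h' : ((x : ℝ) - 1) * x.den = ((x.num - x.den : ℤ) : ℝ) := by push_cast; rw [← h]; ring
    rw [← h', abs_mul, Nat.abs_cast]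
  have h2 : (1 : ℝ) ≤ |((x.num - x.den : ℤ) : ℝ)| := by
    refine mod_cast Int.one_le_abs fun h => hx ?_
    rw [← Rat.num_div_den x, sub_eq_zero.1 h]
    simp
  have h3 := den_le_exp_logSize x
  have hd : (0 : ℝ) < x.den := by exact_mod_cast x.pos
  rw [Real.exp_neg, inv_le_iff_one_le_mul₀ (Real.exp_pos _)]
  calc (1 : ℝ) ≤ |(x : ℝ) - 1| * x.den := h1 ▸ h2
    _ ≤ _ := by gcongr

theorem abs_eval_le_of_X_sub_one_pow_dvd (T L : ℕ) (c : ℕ → ℤ) (M : ℤ) (x : ℚ)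
    (hdvd : (X - C 1) ^ T ∣ ∑ u ∈ Finset.range (L + 1), monomial u ((c u : ℤ) : ℚ))
    (hc : ∀ u ≤ L, |c u| ≤ M) (hx : |x - 1| ≤ 1) :
    |∑ u ∈ Finset.range (L + 1), (c u : ℚ) * x ^ u| ≤ M * 2 ^ (L + 1) * |x - 1| ^ T := by
  set f : ℚ[X] := ∑ u ∈ Finset.range (L + 1), monomial u ((c u : ℤ) : ℚ) with hf
  have hM : 0 ≤ M := (abs_nonneg _).trans (hc 0 (by omega))
  have h1 : ∑ u ∈ Finset.range (L + 1), (c u : ℚ) * x ^ u = f.eval x := by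
    rw [hf, eval_finsetSum]; simp
  have h2 : f.eval x = ∑ m ∈ Finset.range (L + 1), (taylor 1 f).coeff m * (x - 1) ^ m := by
    have h := taylor_eval 1 f (x - 1)
    rw [sub_add_cancel] at h
    rw [← h, eval_eq_sum_range' (n := L + 1)]
    rw [natDegree_taylor, Nat.lt_succ_iff]
    refine natDegree_sum_le_of_forall_le _ _ fun u hu => (natDegree_monomial_le _).trans ?_
    have := Finset.mem_range.1 hu; omega
  have h3 : ∀ m, (taylor 1 f).coeff m = ∑ u ∈ Finset.range (L + 1), (c u : ℚ) * u.choose m := by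
    intro m
    rw [taylor_coeff, hf, map_sum, eval_finsetSum]
    refine Finset.sum_congr rfl fun u _ => ?_
    rw [hasseDeriv_monomial, eval_monomial]; simp [mul_comm]
  have h4 : ∀ m < T, (taylor 1 f).coeff m = 0 := by
    intro m hm
    have h5 : X ^ T ∣ taylor 1 f := by
      obtain ⟨g, hg⟩ := hdvd
      rw [hg, taylor_mul, taylor_pow, map_sub, taylor_X, taylor_C, add_sub_cancel_right]
      exact dvd_mul_right _ _
    exact X_pow_dvd_iff.1 h5 m hm
  rw [h1, h2]
  have h6 : ∀ m ∈ Finset.range (L + 1), |(taylor 1 f).coeff m * (x - 1) ^ m| ≤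
      (∑ u ∈ Finset.range (L + 1), (M : ℚ) * u.choose m) * |x - 1| ^ T := by
    intro m _
    have hnn : (0 : ℚ) ≤ ∑ u ∈ Finset.range (L + 1), (M : ℚ) * u.choose m :=
      Finset.sum_nonneg fun u _ => mul_nonneg (by exact_mod_cast hM) (by positivity)
    by_cases hm : m < T
    · rw [h4 m hm, zero_mul, abs_zero]; positivity
    · rw [abs_mul, abs_pow, h3]
      refine mul_le_mul ?_ (pow_le_pow_of_le_one (abs_nonneg _) hx (by omega)) (by positivity) hnn
      refine (Finset.abs_sum_le_sum_abs _ _).trans (Finset.sum_le_sum fun u hu => ?_)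
      rw [abs_mul, Nat.abs_cast]
      gcongr
      exact_mod_cast hc u (by have := Finset.mem_range.1 hu; omega)
  refine (Finset.abs_sum_le_sum_abs _ _).trans ((Finset.sum_le_sum h6).trans ?_)
  rw [← Finset.sum_mul, Finset.sum_comm]
  gcongr
  calc ∑ u ∈ Finset.range (L + 1), ∑ m ∈ Finset.range (L + 1), (M : ℚ) * u.choose m
      = ∑ u ∈ Finset.range (L + 1), (M : ℚ) * 2 ^ u := by
        refine Finset.sum_congr rfl fun u hu => ?_
        have hu := Finset.mem_range.1 hu
        rw [← Finset.mul_sum, ← Nat.cast_sum]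
        congr 1
        have : ∑ m ∈ Finset.range (L + 1), u.choose m = 2 ^ u := by
          rw [← Nat.sum_range_choose u]
          symm
          refine Finset.sum_subset (Finset.range_subset_range.2 (by omega)) fun m _ hm => ?_
          exact Nat.choose_eq_zero_of_lt (by simpa using hm)
        rw [this]; push_cast; rfl
    _ ≤ M * 2 ^ (L + 1) := by
        rw [← Finset.mul_sum, geom_sum_eq (by norm_num)]
        have : (0 : ℚ) ≤ M := by exact_mod_cast hM
        gcongr
        norm_num

theorem abs_pow_sub_one_le {x : ℚ} (hx : |x - 1| ≤ 1) (t : ℕ) :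
    |x ^ t - 1| ≤ (2 ^ t - 1) * |x - 1| := by
  induction t with
  | zero => simp
  | succ t ih =>
    have h1 : x ^ (t + 1) - 1 = x * (x ^ t - 1) + (x - 1) := by ring
    have h2 : |x| ≤ 2 := by rw [abs_le] at *; constructor <;> linarith
    rw [h1]
    refine (abs_add_le _ _).trans ?_
    rw [abs_mul]
    have : |x| * |x ^ t - 1| ≤ 2 * ((2 ^ t - 1) * |x - 1|) := by gcongr
    rw [pow_succ]; linarith

theorem exists_int_pow_mul_den_pow (x : ℚ) {u L : ℕ} (h : u ≤ L) :
    ∃ z : ℤ, x ^ u * (x.den : ℚ) ^ L = z := by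
  obtain ⟨d, rfl⟩ := Nat.exists_eq_add_of_le h
  refine ⟨x.num ^ u * x.den ^ d, ?_⟩
  push_cast
  rw [← Rat.mul_den_eq_num x, pow_add]; ring

theorem abs_auxiliary_sum_le (q r B : ℕ) (hq : 1 ≤ q) (hB : r + 1 ≤ B) (c : ℕ → ℤ)
    (hdvd : (X - C 1) ^ ((q + 1) * r) ∣
        ∑ u ∈ Finset.range (q * B + r + 1), monomial u ((c u : ℤ) : ℚ))
    (hc : ∀ u ≤ q * B + r, |c u| ≤ 2 ^ ((2 * q + 1) * (q * B + r)))
    (hgap : ∀ j l, r < l → l < B → j * B + l ≤ q * B + r → c (j * B + l) = 0)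
    (x₁ x₂ : ℚ) (hx₁ : |x₁ - 1| ≤ 1) (hx₂ : |x₂ - 1| ≤ 1) :
    |∑ j ∈ Finset.range (q + 1), ∑ l ∈ Finset.range (r + 1),
        (c (j * B + l) : ℚ) * x₁ ^ (j * B + l) * x₂ ^ (q - j)| ≤
      2 ^ (14 * q ^ 2 * B) * (|x₁ - 1| ^ ((q + 1) * r) + |x₂ - 1|) := by
  set L := q * B + r with hL
  set M : ℤ := 2 ^ ((2 * q + 1) * L) with hM
  have hM0 : (0 : ℚ) ≤ M := by rw [hM]; positivity
  have h1 := abs_eval_le_of_X_sub_one_pow_dvd _ L c M x₁ hdvd hc hx₁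
  rw [hL, sum_range_blocks q r B hB _ fun j l h1 h2 h3 => by rw [hgap j l h1 h2 h3]; simp,
    ← hL] at h1
  have hsplit : ∑ j ∈ Finset.range (q + 1), ∑ l ∈ Finset.range (r + 1),
        (c (j * B + l) : ℚ) * x₁ ^ (j * B + l) * x₂ ^ (q - j) =
      ∑ j ∈ Finset.range (q + 1), ∑ l ∈ Finset.range (r + 1),
        (c (j * B + l) : ℚ) * x₁ ^ (j * B + l) +
      ∑ j ∈ Finset.range (q + 1), ∑ l ∈ Finset.range (r + 1),
        (c (j * B + l) : ℚ) * x₁ ^ (j * B + l) * (x₂ ^ (q - j) - 1) := by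
    rw [← Finset.sum_add_distrib]
    refine Finset.sum_congr rfl fun j _ => ?_
    rw [← Finset.sum_add_distrib]
    refine Finset.sum_congr rfl fun l _ => ?_
    ring
  have hx₁' : |x₁| ≤ 2 := by rw [abs_le] at *; constructor <;> linarith
  have h2 : |∑ j ∈ Finset.range (q + 1), ∑ l ∈ Finset.range (r + 1),
        (c (j * B + l) : ℚ) * x₁ ^ (j * B + l) * (x₂ ^ (q - j) - 1)| ≤
      (q + 1) * ((r + 1) * (M * 2 ^ L * (2 ^ q * |x₂ - 1|))) := by
    refine (Finset.abs_sum_le_sum_abs _ _).trans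
      ((Finset.sum_le_card_nsmul _ _ ((r + 1) * (M * 2 ^ L * (2 ^ q * |x₂ - 1|)))
        fun j hj => ?_).trans (by simp))
    refine (Finset.abs_sum_le_sum_abs _ _).trans
      ((Finset.sum_le_card_nsmul _ _ (M * 2 ^ L * (2 ^ q * |x₂ - 1|)) fun l hl => ?_).trans
        (by simp))
    have hj := Finset.mem_range.1 hj
    have hl := Finset.mem_range.1 hl
    have hu : j * B + l ≤ L := by
      have := Nat.mul_le_mul_right B (show j ≤ q by omega)
      omega
    rw [abs_mul, abs_mul, abs_pow]
    have h3 : |(c (j * B + l) : ℚ)| ≤ M := by exact_mod_cast hc _ hu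
    have h4 : |x₁| ^ (j * B + l) ≤ 2 ^ L :=
      (pow_le_pow_left₀ (abs_nonneg _) hx₁' _).trans (pow_le_pow_right₀ (by norm_num) hu)
    have h5 : |x₂ ^ (q - j) - 1| ≤ 2 ^ q * |x₂ - 1| := by
      refine (abs_pow_sub_one_le hx₂ _).trans ?_
      gcongr
      have : (2 : ℚ) ^ (q - j) ≤ 2 ^ q := pow_le_pow_right₀ (by norm_num) (by omega)
      linarith
    gcongr
  have hqr : ((q : ℚ) + 1) * (r + 1) ≤ 2 ^ q * 2 ^ r := by
    have h6 : ∀ n : ℕ, (n : ℚ) + 1 ≤ 2 ^ n := fun n => by exact_mod_cast Nat.lt_two_pow_self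
    exact mul_le_mul (h6 q) (h6 r) (by positivity) (by positivity)
  have hexp1 : (2 : ℚ) ^ ((2 * q + 1) * L + (L + 1)) ≤ 2 ^ (14 * q ^ 2 * B) := by
    refine pow_le_pow_right₀ (by norm_num) ?_
    rw [hL]
    nlinarith [Nat.mul_le_mul hq (le_refl B), Nat.mul_le_mul hq hq,
      Nat.mul_le_mul_left (q * B) hq, Nat.mul_le_mul_left q hB]
  have hexp2 : (2 : ℚ) ^ ((2 * q + 1) * L + (L + (2 * q + r))) ≤ 2 ^ (14 * q ^ 2 * B) := by
    refine pow_le_pow_right₀ (by norm_num) ?_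
    rw [hL]
    nlinarith [Nat.mul_le_mul hq (le_refl B), Nat.mul_le_mul hq hq,
      Nat.mul_le_mul_left (q * B) hq, Nat.mul_le_mul_left q hB]
  rw [hsplit]
  refine (abs_add_le _ _).trans ((add_le_add h1 h2).trans ?_)
  rw [mul_add]
  refine add_le_add ?_ ?_
  · refine mul_le_mul_of_nonneg_right (le_trans (le_of_eq ?_) hexp1) (by positivity)
    rw [hM, pow_add]; push_cast; ring
  · calc (q + 1) * ((r + 1) * (M * 2 ^ L * (2 ^ q * |x₂ - 1|)))
        = ((q + 1) * (r + 1)) * (M * 2 ^ L * (2 ^ q * |x₂ - 1|)) := by ring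
      _ ≤ (2 ^ q * 2 ^ r) * (M * 2 ^ L * (2 ^ q * |x₂ - 1|)) := by gcongr
      _ = 2 ^ ((2 * q + 1) * L + (L + (2 * q + r))) * |x₂ - 1| := by
        rw [hM]; push_cast; ring
      _ ≤ _ := by gcongr

theorem exists_int_auxiliary_sum (q r B : ℕ) (c : ℕ → ℤ) (γ₁ γ₂ g₁ g₂ : ℚ)
    (hg₂ : g₂ ≠ 0) :
    ∃ z : ℤ, (∑ j ∈ Finset.range (q + 1), ∑ l ∈ Finset.range (r + 1),
        (c (j * B + l) : ℚ) * (γ₁ * g₁) ^ (j * B + l) * (γ₂ * g₂) ^ (q - j)) *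
        ((γ₁.den : ℚ) ^ (q * B + r) * (γ₂.den : ℚ) ^ q * ((g₁ ^ B / g₂).den : ℚ) ^ q *
          (g₁.den : ℚ) ^ r) = g₂ ^ q * z := by
  have h : ∀ j ∈ Finset.range (q + 1), ∀ l ∈ Finset.range (r + 1), ∃ z : ℤ,
      (c (j * B + l) : ℚ) * (γ₁ * g₁) ^ (j * B + l) * (γ₂ * g₂) ^ (q - j) *
        ((γ₁.den : ℚ) ^ (q * B + r) * (γ₂.den : ℚ) ^ q * ((g₁ ^ B / g₂).den : ℚ) ^ q *
          (g₁.den : ℚ) ^ r) = g₂ ^ q * z := by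
    intro j hj l hl
    have hj := Finset.mem_range.1 hj
    have hl := Finset.mem_range.1 hl
    have hu : j * B + l ≤ q * B + r := by
      have := Nat.mul_le_mul_right B (show j ≤ q by omega)
      omega
    obtain ⟨z₁, h₁⟩ := exists_int_pow_mul_den_pow γ₁ hu
    obtain ⟨z₂, h₂⟩ := exists_int_pow_mul_den_pow γ₂ (show q - j ≤ q by omega)
    obtain ⟨z₃, h₃⟩ := exists_int_pow_mul_den_pow (g₁ ^ B / g₂) (show j ≤ q by omega)
    obtain ⟨z₄, h₄⟩ := exists_int_pow_mul_den_pow g₁ (show l ≤ r by omega)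
    refine ⟨c (j * B + l) * z₁ * z₂ * z₃ * z₄, ?_⟩
    have h5 : g₁ ^ (j * B + l) * g₂ ^ (q - j) = g₂ ^ q * ((g₁ ^ B / g₂) ^ j * g₁ ^ l) := by
      obtain ⟨d, rfl⟩ := Nat.exists_eq_add_of_le (show j ≤ q by omega)
      rw [div_pow, Nat.add_sub_cancel_left, pow_add, pow_add, mul_comm j B, pow_mul]
      field_simp
    push_cast
    rw [← h₁, ← h₂, ← h₃, ← h₄, mul_pow, mul_pow]
    linear_combination (c (j * B + l) : ℚ) * γ₁ ^ (j * B + l) * γ₂ ^ (q - j) *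
      (γ₁.den : ℚ) ^ (q * B + r) * (γ₂.den : ℚ) ^ q * ((g₁ ^ B / g₂).den : ℚ) ^ q *
          (g₁.den : ℚ) ^ r * h5
  choose! z hz using h
  refine ⟨∑ j ∈ Finset.range (q + 1), ∑ l ∈ Finset.range (r + 1), z j l, ?_⟩
  push_cast
  simp only [Finset.sum_mul, Finset.mul_sum]
  exact Finset.sum_congr rfl fun j hj => Finset.sum_congr rfl fun l hl => hz j hj l hl

/-- Two rational numbers which are simultaneously close to `1` and have nearly proportional
logarithmic sizes cannot both be extremely close to `1`. -/
theorem min_le_of_close_to_one (q r B : ℕ) (hq : 1 ≤ q) (hB : r + 1 ≤ B)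
    (γ₁ γ₂ g₁ g₂ : ℚ) (hγ₁ : γ₁ ≠ 0) (hγ₂ : γ₂ ≠ 0) (hg₁ : g₁ ≠ 0) (hg₂ : g₂ ≠ 0)
    (hne : γ₁ * g₁ ≠ 1) (P₁ P₂ : ℝ) (hP₁ : 0 ≤ P₁) (hP₂ : 0 ≤ P₂)
    (h₁ : |((γ₁ * g₁ : ℚ) : ℝ) - 1| ≤ Real.exp (-P₁))
    (h₂ : |((γ₂ * g₂ : ℚ) : ℝ) - 1| ≤ Real.exp (-P₂)) :
    min (((q + 1) * r : ℕ) * P₁) P₂ ≤ 15 * q ^ 2 * B + (q * B + r) * logSize γ₁ +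
      q * logSize γ₂ + q * logSize (g₁ ^ B / g₂) + r * logSize g₁ +
      q * |(Real.log |(g₂ : ℝ)|)| := by
  obtain ⟨c, hdvd, hc, hgap, hΦ⟩ := exists_auxiliary_coeffs q r B hB (γ₁ * g₁)
    (mul_ne_zero hγ₁ hg₁) hne (fun j => (γ₂ * g₂) ^ (q - j))
    ⟨0, by omega, pow_ne_zero _ (mul_ne_zero hγ₂ hg₂)⟩
  have hle1 : ∀ x : ℚ, ∀ P : ℝ, 0 ≤ P → |(x : ℝ) - 1| ≤ Real.exp (-P) → |x - 1| ≤ 1 := by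
    intro x P hP h
    have : Real.exp (-P) ≤ 1 := Real.exp_le_one_iff.2 (by linarith)
    exact_mod_cast h.trans this
  have hup := abs_auxiliary_sum_le q r B hq hB c hdvd hc hgap _ _ (hle1 _ _ hP₁ h₁)
    (hle1 _ _ hP₂ h₂)
  obtain ⟨z, hz⟩ := exists_int_auxiliary_sum q r B c γ₁ γ₂ g₁ g₂ hg₂
  set Φ := ∑ j ∈ Finset.range (q + 1), ∑ l ∈ Finset.range (r + 1),
        (c (j * B + l) : ℚ) * (γ₁ * g₁) ^ (j * B + l) * (γ₂ * g₂) ^ (q - j)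
  set Q := (γ₁.den : ℚ) ^ (q * B + r) * (γ₂.den : ℚ) ^ q * ((g₁ ^ B / g₂).den : ℚ) ^ q *
          (g₁.den : ℚ) ^ r with hQ
  set W := (q * B + r : ℝ) * logSize γ₁ + q * logSize γ₂ + q * logSize (g₁ ^ B / g₂) +
    r * logSize g₁ with hW
  set μ := min (((q + 1) * r : ℕ) * P₁) P₂ with hμ
  have hQ0 : 0 < Q := by
    have : ∀ x : ℚ, (0 : ℚ) < x.den := fun x => by exact_mod_cast x.pos
    have h1 := this γ₁
    have h2 := this γ₂
    have h3 := this (g₁ ^ B / g₂)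
    have h4 := this g₁
    rw [hQ]; positivity
  have hQW : (Q : ℝ) ≤ Real.exp W := by
    rw [hQ, hW, Real.exp_add, Real.exp_add, Real.exp_add]
    push_cast
    have hexp : ∀ (x : ℚ) (n : ℕ), ((x.den : ℝ)) ^ n ≤ Real.exp (n * logSize x) := by
      intro x n
      rw [Real.exp_nat_mul]
      exact pow_le_pow_left₀ (by positivity) (den_le_exp_logSize x) n
    have e1 := hexp γ₁ (q * B + r)
    push_cast at e1
    exact mul_le_mul (mul_le_mul (mul_le_mul e1 (hexp _ _) (by positivity) (by positivity))
      (hexp _ _) (by positivity) (by positivity)) (hexp _ _) (by positivity) (by positivity)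
  have hlow : Real.exp (-(q * |(Real.log |(g₂ : ℝ)|)|)) ≤ |(Φ : ℝ)| * Real.exp W := by
    have hz0 : z ≠ 0 := by
      rintro rfl
      rw [Int.cast_zero, mul_zero] at hz
      exact (mul_ne_zero hΦ hQ0.ne') hz
    have h3 : |(g₂ : ℝ)| ^ q ≤ |(Φ : ℝ)| * Q := by
      have h4 : (Φ : ℝ) * Q = g₂ ^ q * z := by exact_mod_cast hz
      have h5 : |(Φ : ℝ)| * Q = |(g₂ : ℝ)| ^ q * |(z : ℝ)| := by
        rw [← abs_pow, ← abs_mul, ← h4, abs_mul, abs_of_pos (a := (Q : ℝ)) (by exact_mod_cast hQ0)]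
      rw [h5]
      exact le_mul_of_one_le_right (by positivity) (by exact_mod_cast Int.one_le_abs hz0)
    have h6 : Real.exp (-(q * |(Real.log |(g₂ : ℝ)|)|)) ≤ |(g₂ : ℝ)| ^ q := by
      have hpos : 0 < |(g₂ : ℝ)| := abs_pos.2 (by exact_mod_cast hg₂)
      rw [← Real.le_log_iff_exp_le (by positivity), Real.log_pow]
      have := neg_abs_le (Real.log |(g₂ : ℝ)|)
      have h7 : (0 : ℝ) ≤ q := by positivity
      nlinarith
    exact h6.trans (h3.trans (by gcongr))
  have hup' : |(Φ : ℝ)| ≤ 2 ^ (14 * q ^ 2 * B) * (2 * Real.exp (-μ)) := by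
    have h3 : |(Φ : ℝ)| ≤ 2 ^ (14 * q ^ 2 * B) *
        (|((γ₁ * g₁ : ℚ) : ℝ) - 1| ^ ((q + 1) * r) + |((γ₂ * g₂ : ℚ) : ℝ) - 1|) := by
      exact_mod_cast hup
    refine h3.trans ?_
    have h4 : |((γ₁ * g₁ : ℚ) : ℝ) - 1| ^ ((q + 1) * r) ≤ Real.exp (-μ) := by
      refine (pow_le_pow_left₀ (abs_nonneg _) h₁ _).trans ?_
      rw [← Real.exp_nat_mul, Real.exp_le_exp]
      have := min_le_left (((q + 1) * r : ℕ) * P₁) P₂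
      linarith
    have h5 : |((γ₂ * g₂ : ℚ) : ℝ) - 1| ≤ Real.exp (-μ) := by
      refine h₂.trans (Real.exp_le_exp.2 ?_)
      have := min_le_right (((q + 1) * r : ℕ) * P₁) P₂
      linarith
    gcongr
    linarith
  have h2e : (2 : ℝ) ^ (14 * q ^ 2 * B) * 2 ≤ Real.exp (15 * q ^ 2 * B) := by
    rw [← pow_succ]
    have h3 : (2 : ℝ) ≤ Real.exp 1 := by have := Real.add_one_le_exp (1 : ℝ); linarith
    refine (pow_le_pow_left₀ (by norm_num) h3 _).trans ?_
    rw [← Real.exp_nat_mul, Real.exp_le_exp]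
    have h5 : 1 ≤ q ^ 2 * B := Nat.mul_pos (pow_pos hq 2) (by omega)
    have h6 : (1 : ℝ) ≤ q ^ 2 * B := by exact_mod_cast h5
    push_cast
    linarith
  have hfin : Real.exp (-(q * |(Real.log |(g₂ : ℝ)|)|)) ≤
      Real.exp (15 * q ^ 2 * B + -μ + W) := by
    rw [Real.exp_add, Real.exp_add]
    refine hlow.trans ?_
    gcongr
    refine hup'.trans ?_
    rw [← mul_assoc]
    gcongr
  rw [Real.exp_le_exp] at hfin
  linarith

end

theorem padicValNat_num_eq_zero_or_den (p : ℕ) (hp : p.Prime) (x : ℚ) :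
    padicValInt p x.num = 0 ∨ padicValNat p x.den = 0 := by
  by_cases h : p ∣ x.num.natAbs
  · refine Or.inr (padicValNat.eq_zero_of_not_dvd fun h' => ?_)
    have := Nat.dvd_gcd h h'
    rw [x.reduced] at this
    exact hp.one_lt.ne' (Nat.dvd_one.1 this)
  · exact Or.inl (padicValNat.eq_zero_of_not_dvd h)

theorem log_eq_sum_padicValNat (n : ℕ) (S : Finset ℕ) (hS : ∀ p ∈ S, p.Prime)
    (h : ∀ p, p.Prime → p ∉ S → padicValNat p n = 0) :
    Real.log n = ∑ p ∈ S, padicValNat p n * Real.log p := by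
  rw [Real.log_nat_eq_sum_factorization, Finsupp.sum]
  rw [Finset.sum_subset (s₂ := S)]
  · exact Finset.sum_congr rfl fun p hp => by rw [Nat.factorization_def n (hS p hp)]
  · intro p hp
    by_contra hpS
    have hpp := Nat.prime_of_mem_primeFactors hp
    rw [Finsupp.mem_support_iff, Nat.factorization_def n hpp] at hp
    exact hp (h p hpp hpS)
  · intro p _ hp
    rw [Finsupp.notMem_support_iff.1 hp]; simp

theorem logSize_eq_sum (x : ℚ) (S : Finset ℕ) (hS : ∀ p ∈ S, p.Prime)
    (h : ∀ p, p.Prime → p ∉ S → padicValRat p x = 0) :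
    logSize x = ∑ p ∈ S, |(padicValRat p x : ℝ)| * Real.log p := by
  have hz : ∀ p, p.Prime → p ∉ S → padicValNat p x.num.natAbs = 0 ∧ padicValNat p x.den = 0 := by
    intro p hp hpS
    have h1 := h p hp hpS
    rw [padicValRat_def] at h1
    have h2 := padicValNat_num_eq_zero_or_den p hp x
    unfold padicValInt at h1 h2
    omega
  have h3 : |(x.num : ℝ)| = (x.num.natAbs : ℕ) := by rw [Nat.cast_natAbs]; simp
  unfold logSize
  rw [h3, log_eq_sum_padicValNat _ S hS fun p hp hpS => (hz p hp hpS).1,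
    log_eq_sum_padicValNat _ S hS fun p hp hpS => (hz p hp hpS).2, ← Finset.sum_add_distrib]
  refine Finset.sum_congr rfl fun p hp => ?_
  rw [← add_mul, padicValRat_def]
  congr 1
  have h2 := padicValNat_num_eq_zero_or_den p (hS p hp) x
  unfold padicValInt at *
  rcases h2 with h2 | h2 <;> rw [h2] <;> simp

/-- The limit of `logSize (k ^ e * l ^ (-f)) / |f|` as `e * log k - f * log l` stays bounded. -/
noncomputable def sizeConst (k l : ℕ) : ℝ :=
  ∑ p ∈ (k * l).primeFactors,
    |padicValNat p k * (Real.log l / Real.log k) - padicValNat p l| * Real.log p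

theorem abs_logSize_sub_le {k l : ℕ} (hk : 2 ≤ k) (hl : 2 ≤ l) (e f : ℤ) :
    |logSize ((k : ℚ) ^ e * (l : ℚ) ^ (-f)) - sizeConst k l * abs (f : ℝ)| ≤
      |e * Real.log k - f * Real.log l| := by
  have hk0 : (k : ℚ) ≠ 0 := by positivity
  have hl0 : (l : ℚ) ≠ 0 := by positivity
  have hK : 0 < Real.log k := Real.log_pos (by exact_mod_cast (show 1 < k by omega))
  have hval : ∀ p, p.Prime → padicValRat p ((k : ℚ) ^ e * (l : ℚ) ^ (-f)) =
      e * padicValNat p k - f * padicValNat p l := by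
    intro p hp
    have : Fact p.Prime := ⟨hp⟩
    rw [padicValRat.mul (zpow_ne_zero _ hk0) (zpow_ne_zero _ hl0), padicValRat.zpow,
      padicValRat.zpow, padicValRat.of_nat, padicValRat.of_nat]
    ring
  have hvan : ∀ p, p.Prime → p ∉ (k * l).primeFactors →
      padicValNat p k = 0 ∧ padicValNat p l = 0 := by
    intro p hp hpS
    have h : ¬ p ∣ k * l := fun h => hpS (Nat.mem_primeFactors.2 ⟨hp, h, by positivity⟩)
    exact ⟨padicValNat.eq_zero_of_not_dvd fun h' => h (h'.mul_right l),
      padicValNat.eq_zero_of_not_dvd fun h' => h (h'.mul_left k)⟩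
  have hsum : Real.log k = ∑ p ∈ (k * l).primeFactors, padicValNat p k * Real.log p :=
    log_eq_sum_padicValNat k _ (fun p hp => Nat.prime_of_mem_primeFactors hp)
      fun p hp hpS => (hvan p hp hpS).1
  rw [logSize_eq_sum _ (k * l).primeFactors (fun p hp => Nat.prime_of_mem_primeFactors hp)
    (fun p hp hpS => by rw [hval p hp, (hvan p hp hpS).1, (hvan p hp hpS).2]; simp),
    sizeConst, Finset.sum_mul, ← Finset.sum_sub_distrib]
  refine (Finset.abs_sum_le_sum_abs _ _).trans ?_
  calc _ ≤ ∑ p ∈ (k * l).primeFactors,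
        |e - f * Real.log l / Real.log k| * (padicValNat p k * Real.log p) := by
        refine Finset.sum_le_sum fun p hp => ?_
        rw [hval p (Nat.prime_of_mem_primeFactors hp), Int.cast_sub, Int.cast_mul, Int.cast_mul,
          Int.cast_natCast, Int.cast_natCast]
        have hlogp := Real.log_natCast_nonneg p
        rw [mul_right_comm, ← sub_mul, abs_mul, abs_of_nonneg hlogp, ← mul_assoc]
        refine mul_le_mul_of_nonneg_right ?_ hlogp
        rw [← abs_mul, ← Nat.abs_cast (padicValNat p k), ← abs_mul, Nat.abs_cast]
        refine (abs_abs_sub_abs_le_abs_sub _ _).trans (le_of_eq (congrArg _ ?_))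
        ring
    _ = |e - f * Real.log l / Real.log k| * Real.log k := by rw [← Finset.mul_sum, ← hsum]
    _ = |e * Real.log k - f * Real.log l| := by
        rw [← abs_of_pos hK, ← abs_mul, abs_of_pos hK]
        congr 1
        field_simp

theorem abs_log_zpow_mul_zpow {k l : ℕ} (hk : 2 ≤ k) (hl : 2 ≤ l) (e f : ℤ) :
    Real.log |(((k : ℚ) ^ e * (l : ℚ) ^ (-f) : ℚ) : ℝ)| = e * Real.log k - f * Real.log l := by
  have hk0 : (0 : ℝ) < k := by positivity
  have hl0 : (0 : ℝ) < l := by positivity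
  push_cast
  rw [abs_of_pos (by positivity), Real.log_mul (by positivity) (by positivity), Real.log_zpow,
    Real.log_zpow]
  push_cast; ring

/-- A number `γ * k ^ e * l ^ (-f)` close to `1`, where `γ` and the ratio of the two powers are
small compared with the powers themselves. -/
structure IsApprox (k l : ℕ) (c ρ V : ℝ) (γ : ℚ) (e f : ℤ) : Prop where
  ne_zero : γ ≠ 0
  ne_one : γ * ((k : ℚ) ^ e * (l : ℚ) ^ (-f)) ≠ 1
  close : |((γ * ((k : ℚ) ^ e * (l : ℚ) ^ (-f)) : ℚ) : ℝ) - 1| ≤ Real.exp (-(c * V / 2))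
  logSize_le : logSize γ ≤ 8 * (ρ * (c * V))
  abs_log_le : |e * Real.log k - f * Real.log l| ≤ 9 * (ρ * (c * V))
  le_size : c * V / 8 ≤ sizeConst k l * |(f : ℝ)|
  size_le : sizeConst k l * |(f : ℝ)| ≤ 9 * V

theorem logSize_zpow_le {k l : ℕ} (hk : 2 ≤ k) (hl : 2 ≤ l) (e f : ℤ) :
    logSize ((k : ℚ) ^ e * (l : ℚ) ^ (-f)) ≤
      sizeConst k l * |(f : ℝ)| + |e * Real.log k - f * Real.log l| := by
  have := (abs_le.1 (abs_logSize_sub_le hk hl e f)).2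
  linarith

theorem sizeConst_nonneg (k l : ℕ) : 0 ≤ sizeConst k l :=
  Finset.sum_nonneg fun p _ => mul_nonneg (abs_nonneg _) (Real.log_natCast_nonneg p)

theorem abs_floor_mul_sub_le {f₁ f₂ : ℤ} (hf₁ : f₁ ≠ 0) (hf : 0 ≤ f₁ * f₂) :
    |((⌊|(f₂ : ℝ)| / |(f₁ : ℝ)|⌋₊ * f₁ - f₂ : ℤ) : ℝ)| ≤ |(f₁ : ℝ)| := by
  have h1 : (0 : ℝ) < |(f₁ : ℝ)| := abs_pos.2 (by exact_mod_cast hf₁)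
  set B := ⌊|(f₂ : ℝ)| / |(f₁ : ℝ)|⌋₊
  have h2 : (B : ℝ) * |(f₁ : ℝ)| ≤ |(f₂ : ℝ)| := by
    rw [← le_div_iff₀ h1]; exact Nat.floor_le (by positivity)
  have h3 : |(f₂ : ℝ)| < (B + 1) * |(f₁ : ℝ)| := by
    rw [← div_lt_iff₀ h1]; exact Nat.lt_floor_add_one _
  push_cast
  have h4 : (0 : ℝ) ≤ f₁ * f₂ := by exact_mod_cast hf
  rcases lt_or_gt_of_ne hf₁ with h | h
  · have h5 : (f₁ : ℝ) < 0 := by exact_mod_cast h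
    have h6 : (f₂ : ℝ) ≤ 0 := by nlinarith
    rw [abs_of_neg h5, abs_of_nonpos h6] at *
    rw [abs_le]; constructor <;> nlinarith
  · have h5 : (0 : ℝ) < f₁ := by exact_mod_cast h
    have h6 : (0 : ℝ) ≤ f₂ := by nlinarith
    rw [abs_of_pos h5, abs_of_nonneg h6] at *
    rw [abs_le]; constructor <;> nlinarith

theorem auxiliary_size_lt {c ρ F B q r : ℝ} (hc : 0 < c) (hF : 0 < F) (hB : 0 ≤ B) (hq : 0 ≤ q)
    (hρc : ρ ≤ c ^ 2 / 2 ^ 25) (hqc : q * c ≤ 73) (hr : c * B / 144 - 1 < r)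
    (hcB : 2 ^ 15 ≤ c ^ 2 * B) (hcF : 2 ^ 26 ≤ c ^ 3 * F) (hcB1 : 2 ^ 15 ≤ c * B) :
    15 * q ^ 2 * B + 2 * (q * B) * (64 * (ρ * F)) + q * (128 * (ρ * (B * F))) +
      q * (F + 216 * (ρ * (B * F))) + r * (2 * F) + q * (144 * (ρ * (B * F))) < 4 * (r * F) := by
  have hBp : 0 < B := by
    rcases hB.lt_or_eq with h | h
    · exact h
    · rw [← h] at hcB; norm_num at hcB
  have hr2 : c * B / 288 * F ≤ r * F := by
    gcongr
    linarith
  have t1 : 15 * q ^ 2 * B < c * B * F / 432 := by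
    have h4 : (q * c) ^ 2 ≤ 73 ^ 2 := pow_le_pow_left₀ (by positivity) hqc 2
    have h5 : 15 * q ^ 2 * c ^ 2 < c * F / 432 * c ^ 2 := by linarith
    have h6 := lt_of_mul_lt_mul_right h5 (by positivity)
    calc 15 * q ^ 2 * B < c * F / 432 * B := by gcongr
      _ = _ := by ring
  have h4 : 0 ≤ B * F := by positivity
  have t2 : 616 * (q * (ρ * (B * F))) ≤ c * B * F / 432 := by
    have h3 : q * ρ ≤ c * (73 / 2 ^ 25) := by
      calc q * ρ ≤ q * (c ^ 2 / 2 ^ 25) := by gcongr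
        _ = c * ((q * c) / 2 ^ 25) := by ring
        _ ≤ _ := by gcongr
    calc 616 * (q * (ρ * (B * F))) = 616 * (q * ρ) * (B * F) := by ring
      _ ≤ 616 * (c * (73 / 2 ^ 25)) * (B * F) := by gcongr
      _ ≤ _ := by nlinarith [mul_nonneg hc.le h4]
  have t3 : q * F ≤ c * B * F / 432 := by
    have h3 : q * c ≤ c * B / 432 * c := by linarith
    have h5 := le_of_mul_le_mul_right h3 hc
    calc q * F ≤ c * B / 432 * F := by gcongr
      _ = _ := by ring
  linarith

set_option maxHeartbeats 1000000 in
theorem IsApprox.lt_of_mul_nonneg {k l : ℕ} (hk : 2 ≤ k) (hl : 2 ≤ l) {c ρ V₁ V₂ : ℝ} {γ₁ γ₂ : ℚ}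
    {e₁ f₁ e₂ f₂ : ℤ} (hc : 0 < c) (hc1 : c ≤ 1) (hρ : 0 ≤ ρ) (hρc : ρ ≤ c ^ 2 / 2 ^ 25)
    (h₁ : IsApprox k l c ρ V₁ γ₁ e₁ f₁) (h₂ : IsApprox k l c ρ V₂ γ₂ e₂ f₂)
    (hf : 0 ≤ f₁ * f₂) (hV₁ : 2 ^ 29 / c ^ 4 ≤ V₁) : V₂ < 2 ^ 23 / c ^ 3 * V₁ := by
  by_contra! hV₂
  have hV₁0 : 0 < V₁ := lt_of_lt_of_le (by positivity) hV₁
  have hV₂0 : 0 < V₂ := lt_of_lt_of_le (by positivity) hV₂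
  set κ := sizeConst k l with hκ
  have hκ0 : 0 ≤ κ := sizeConst_nonneg k l
  set F₁ := κ * |(f₁ : ℝ)| with hF₁
  set F₂ := κ * |(f₂ : ℝ)| with hF₂
  have hF₁l : c * V₁ / 8 ≤ F₁ := h₁.le_size
  have hF₁u : F₁ ≤ 9 * V₁ := h₁.size_le
  have hF₂l : c * V₂ / 8 ≤ F₂ := h₂.le_size
  have hF₂u : F₂ ≤ 9 * V₂ := h₂.size_le
  have hF₁0 : 0 < F₁ := lt_of_lt_of_le (by positivity) hF₁l
  have hκp : 0 < κ := by
    rcases hκ0.lt_or_eq with h | h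
    · exact h
    · rw [hF₁, ← h, zero_mul] at hF₁0; exact absurd hF₁0 (lt_irrefl _)
  have hf₁ : f₁ ≠ 0 := by
    rintro rfl
    simp [hF₁] at hF₁0
  have hf₁p : (0 : ℝ) < |(f₁ : ℝ)| := abs_pos.2 (by exact_mod_cast hf₁)
  set B := ⌊|(f₂ : ℝ)| / |(f₁ : ℝ)|⌋₊ with hBdef
  have hBF : |(f₂ : ℝ)| / |(f₁ : ℝ)| = F₂ / F₁ := by rw [hF₁, hF₂]; field_simp
  have hBle : (B : ℝ) * F₁ ≤ F₂ := by
    rw [← le_div_iff₀ hF₁0, ← hBF]; exact Nat.floor_le (by positivity)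
  have hBlt : F₂ < (B + 1) * F₁ := by
    rw [← div_lt_iff₀ hF₁0, ← hBF]; exact Nat.lt_floor_add_one _
  have hc2 : c ^ 2 ≤ 1 := pow_le_one₀ hc.le hc1
  have hBbig : 2 ^ 15 / c ^ 2 ≤ (B : ℝ) := by
    have h3 : c * (2 ^ 23 / c ^ 3 * V₁) / 8 < (B + 1) * (9 * V₁) := by
      calc c * (2 ^ 23 / c ^ 3 * V₁) / 8 ≤ c * V₂ / 8 := by gcongr
        _ ≤ F₂ := hF₂l
        _ < (B + 1) * F₁ := hBlt
        _ ≤ _ := by gcongr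
    have h4 : c * (2 ^ 23 / c ^ 3 * V₁) / 8 = (32 * (2 ^ 15 / c ^ 2)) * V₁ := by
      field_simp; norm_num
    have h5 : 32 * (2 ^ 15 / c ^ 2) < (B + 1) * 9 := by
      rw [h4] at h3
      nlinarith
    have h6 : (1 : ℝ) ≤ 1 / c ^ 2 := by rw [le_div_iff₀ (by positivity)]; linarith
    have h7 : (2 : ℝ) ^ 15 / c ^ 2 = 2 ^ 15 * (1 / c ^ 2) := by ring
    rw [h7] at h5 ⊢
    linarith
  have hcB : 2 ^ 15 ≤ c ^ 2 * B := by
    rw [div_le_iff₀ (by positivity)] at hBbig; linarith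
  have hcc : c ^ 2 ≤ c := by nlinarith
  have hB1 : (2 : ℝ) ^ 15 ≤ c * B := hcB.trans (by gcongr)
  have hB2 : (2 : ℝ) ^ 15 ≤ B := hB1.trans (mul_le_of_le_one_left (by positivity) hc1)
  set q := ⌈72 / c⌉₊ with hq
  have hql : 72 / c ≤ q := Nat.le_ceil _
  have hqu : (q : ℝ) ≤ 73 / c := by
    have := Nat.ceil_lt_add_one (show 0 ≤ 72 / c by positivity)
    have h1 : 1 ≤ 1 / c := by rw [le_div_iff₀ hc]; linarith
    have h2 : 73 / c = 72 / c + 1 / c := by ring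
    linarith
  have hqc : 72 ≤ q * c := by rwa [div_le_iff₀ hc] at hql
  have hqc' : q * c ≤ 73 := by rwa [le_div_iff₀ hc] at hqu
  have hq1 : 1 ≤ q := Nat.one_le_iff_ne_zero.2 fun h => by rw [h] at hqc; norm_num at hqc
  set r := ⌊c * B / 144⌋₊ with hr
  have hru : (r : ℝ) ≤ c * B / 144 := Nat.floor_le (by positivity)
  have hrl : c * B / 144 - 1 < r := by
    have := Nat.lt_floor_add_one (c * B / 144); linarith
  have hcBB : c * B ≤ B := mul_le_of_le_one_left (by positivity) hc1
  have hrB : r + 1 ≤ B := by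
    have : (r : ℝ) + 1 ≤ B := by linarith
    exact_mod_cast this
  have hk0 : (k : ℚ) ≠ 0 := by positivity
  have hl0 : (l : ℚ) ≠ 0 := by positivity
  have main := min_le_of_close_to_one q r B hq1 hrB γ₁ γ₂ ((k : ℚ) ^ e₁ * (l : ℚ) ^ (-f₁))
    ((k : ℚ) ^ e₂ * (l : ℚ) ^ (-f₂)) h₁.ne_zero h₂.ne_zero
    (mul_ne_zero (zpow_ne_zero _ hk0) (zpow_ne_zero _ hl0))
    (mul_ne_zero (zpow_ne_zero _ hk0) (zpow_ne_zero _ hl0)) h₁.ne_one (c * V₁ / 2) (c * V₂ / 2)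
    (by positivity) (by positivity) h₁.close h₂.close
  rw [abs_log_zpow_mul_zpow hk hl] at main
  have hquot : ((k : ℚ) ^ e₁ * (l : ℚ) ^ (-f₁)) ^ B / ((k : ℚ) ^ e₂ * (l : ℚ) ^ (-f₂)) =
      (k : ℚ) ^ (B * e₁ - e₂) * (l : ℚ) ^ (-(B * f₁ - f₂)) := by
    rw [mul_pow, ← zpow_natCast, ← zpow_natCast, ← zpow_mul, ← zpow_mul, mul_div_mul_comm,
      ← zpow_sub₀ hk0, ← zpow_sub₀ hl0]
    congr 2 <;> ring
  rw [hquot] at main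
  have hV₁F : c * V₁ ≤ 8 * F₁ := by linarith
  have hV₂F : c * V₂ ≤ 16 * (B * F₁) := by
    have h3 : F₁ ≤ B * F₁ := le_mul_of_one_le_left hF₁0.le (by linarith)
    linarith
  have hLγ₁ : logSize γ₁ ≤ 64 * (ρ * F₁) := h₁.logSize_le.trans (by
    have := mul_le_mul_of_nonneg_left hV₁F hρ; linarith)
  have hLγ₂ : logSize γ₂ ≤ 128 * (ρ * (B * F₁)) := h₂.logSize_le.trans (by
    have := mul_le_mul_of_nonneg_left hV₂F hρ; linarith)
  have hψ₁ : |e₁ * Real.log k - f₁ * Real.log l| ≤ 72 * (ρ * F₁) :=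
    h₁.abs_log_le.trans (by have := mul_le_mul_of_nonneg_left hV₁F hρ; linarith)
  have hψ₂ : |e₂ * Real.log k - f₂ * Real.log l| ≤ 144 * (ρ * (B * F₁)) :=
    h₂.abs_log_le.trans (by have := mul_le_mul_of_nonneg_left hV₂F hρ; linarith)
  have hρ1 : 72 * ρ ≤ 1 := by
    have : c ^ 2 / 2 ^ 25 ≤ 1 / 2 ^ 25 := by gcongr
    linarith
  have hLg₁ : logSize ((k : ℚ) ^ e₁ * (l : ℚ) ^ (-f₁)) ≤ 2 * F₁ := by
    refine (logSize_zpow_le hk hl e₁ f₁).trans ?_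
    have := mul_le_mul_of_nonneg_right hρ1 hF₁0.le
    linarith
  have hLw : logSize ((k : ℚ) ^ (B * e₁ - e₂) * (l : ℚ) ^ (-(B * f₁ - f₂))) ≤
      F₁ + 216 * (ρ * (B * F₁)) := by
    refine (logSize_zpow_le hk hl _ _).trans (add_le_add ?_ ?_)
    · exact mul_le_mul_of_nonneg_left (abs_floor_mul_sub_le hf₁ hf) hκ0
    · have h3 : (((B : ℤ) * e₁ - e₂ : ℤ) : ℝ) * Real.log k - ((B * f₁ - f₂ : ℤ) : ℝ) * Real.log l =
          B * (e₁ * Real.log k - f₁ * Real.log l) - (e₂ * Real.log k - f₂ * Real.log l) := by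
        push_cast; ring
      rw [h3]
      refine (abs_sub _ _).trans ?_
      rw [abs_mul, Nat.abs_cast]
      have : (B : ℝ) * |e₁ * Real.log k - f₁ * Real.log l| ≤ B * (72 * (ρ * F₁)) := by gcongr
      linarith
  have hρF : 0 ≤ ρ * F₁ := by positivity
  have hrqB : (q * B + r : ℝ) ≤ 2 * (q * B) := by
    have h3 : (r : ℝ) ≤ B := by linarith
    have h4 : (B : ℝ) ≤ q * B := le_mul_of_one_le_left (by positivity) (by exact_mod_cast hq1)
    linarith
  have hrhs : 15 * (q : ℝ) ^ 2 * B + (q * B + r) * logSize γ₁ + q * logSize γ₂ +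
      q * logSize ((k : ℚ) ^ (B * e₁ - e₂) * (l : ℚ) ^ (-(B * f₁ - f₂))) +
      r * logSize ((k : ℚ) ^ e₁ * (l : ℚ) ^ (-f₁)) +
      q * |e₂ * Real.log k - f₂ * Real.log l| ≤
      15 * (q : ℝ) ^ 2 * B + 2 * (q * B) * (64 * (ρ * F₁)) + q * (128 * (ρ * (B * F₁))) +
      q * (F₁ + 216 * (ρ * (B * F₁))) + r * (2 * F₁) + q * (144 * (ρ * (B * F₁))) := by
    have := logSize_nonneg γ₁
    gcongr
  have hlhs : 4 * (r * F₁) ≤ min (((q + 1) * r : ℕ) * (c * V₁ / 2)) (c * V₂ / 2) := by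
    refine le_min ?_ ?_
    · push_cast
      have h3 : 72 * F₁ ≤ q * c * (9 * V₁) := by
        calc 72 * F₁ ≤ q * c * F₁ := by gcongr
          _ ≤ _ := by gcongr
      have h4 : (0 : ℝ) ≤ r := by positivity
      have h5 : 4 * F₁ ≤ (q + 1) * (c * V₁ / 2) := by
        have := mul_pos hc hV₁0
        linarith
      calc 4 * (r * F₁) = r * (4 * F₁) := by ring
        _ ≤ r * ((q + 1) * (c * V₁ / 2)) := by gcongr
        _ = _ := by ring
    · have h3 : r * F₁ ≤ c * B / 144 * F₁ := by gcongr
      have h4 : c * (B * F₁) ≤ c * (9 * V₂) :=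
        mul_le_mul_of_nonneg_left (hBle.trans hF₂u) hc.le
      have := mul_pos hc hV₂0
      linarith
  have hF₁c : 2 ^ 26 ≤ c ^ 3 * F₁ := by
    have h4 : 2 ^ 29 ≤ V₁ * c ^ 4 := by rwa [div_le_iff₀ (by positivity)] at hV₁
    have h5 : c ^ 3 * (c * V₁ / 8) ≤ c ^ 3 * F₁ := by gcongr
    linarith
  exact absurd (hlhs.trans (main.trans hrhs)) (not_le.2 (auxiliary_size_lt hc hF₁0
    (by positivity) (by positivity) hρc hqc' hrl hcB hF₁c hB1))

theorem IsApprox.eq_of_close {k l : ℕ} (hk : 2 ≤ k) (hl : 2 ≤ l) {c ρ V₀ V₁ V₂ : ℝ} {γ₁ γ₂ : ℚ}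
    {e₁ f₁ e₂ f₂ : ℤ} (hc : 0 < c) (hρ : 0 ≤ ρ) (hρ' : ρ ≤ 1 / 2 ^ 10)
    (h₁ : IsApprox k l c ρ V₁ γ₁ e₁ f₁) (h₂ : IsApprox k l c ρ V₂ γ₂ e₂ f₂)
    (hV₁ : V₀ ≤ V₁) (hV₁' : V₁ ≤ 2 * V₀) (hV₂ : V₀ ≤ V₂) (hV₂' : V₂ ≤ 2 * V₀)
    (hcV : 8 ≤ c * V₀) (hf : sizeConst k l * |(f₁ : ℝ) - f₂| ≤ c * V₀ / 8) :
    γ₁ * ((k : ℚ) ^ e₁ * (l : ℚ) ^ (-f₁)) = γ₂ * ((k : ℚ) ^ e₂ * (l : ℚ) ^ (-f₂)) := by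
  by_contra hne
  have hk0 : (k : ℚ) ≠ 0 := by positivity
  have hl0 : (l : ℚ) ≠ 0 := by positivity
  have hg : ∀ e f : ℤ, (k : ℚ) ^ e * (l : ℚ) ^ (-f) ≠ 0 := fun e f =>
    mul_ne_zero (zpow_ne_zero _ hk0) (zpow_ne_zero _ hl0)
  set x₁ := γ₁ * ((k : ℚ) ^ e₁ * (l : ℚ) ^ (-f₁)) with hx₁
  set x₂ := γ₂ * ((k : ℚ) ^ e₂ * (l : ℚ) ^ (-f₂)) with hx₂
  have hx₂0 : x₂ ≠ 0 := mul_ne_zero h₂.ne_zero (hg _ _)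
  have hquot : x₁ / x₂ = (γ₁ / γ₂) * ((k : ℚ) ^ (e₁ - e₂) * (l : ℚ) ^ (-(f₁ - f₂))) := by
    rw [hx₁, hx₂, mul_div_mul_comm, mul_div_mul_comm, ← zpow_sub₀ hk0, ← zpow_sub₀ hl0]
    congr 3; ring
  set E := Real.exp (-(c * V₀ / 2)) with hE
  have hclose : ∀ {V : ℝ} {x : ℚ}, V₀ ≤ V → |(x : ℝ) - 1| ≤ Real.exp (-(c * V / 2)) →
      |(x : ℝ) - 1| ≤ E := fun hV h => h.trans (Real.exp_le_exp.2 (by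
        have := mul_le_mul_of_nonneg_left hV hc.le; linarith))
  have hc₁ := hclose hV₁ h₁.close
  have hc₂ := hclose hV₂ h₂.close
  have hE2 : E ≤ 1 / 2 := by
    have h3 : E ≤ Real.exp (-1) := Real.exp_le_exp.2 (by linarith)
    have h4 := Real.exp_neg_one_lt_half
    linarith
  have hx₂l : (1 : ℝ) / 2 ≤ x₂ := by
    have := (abs_le.1 (hc₂.trans hE2)).1; linarith
  have h5 : |((x₁ / x₂ : ℚ) : ℝ) - 1| ≤ 4 * E := by
    have h6 : ((x₁ / x₂ : ℚ) : ℝ) - 1 = ((x₁ - 1) - (x₂ - 1)) / x₂ := by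
      push_cast
      have : (x₂ : ℝ) ≠ 0 := by linarith
      field_simp; ring
    rw [h6, abs_div, div_le_iff₀ (by rw [abs_pos]; linarith), abs_of_pos (a := (x₂ : ℝ))
      (by linarith)]
    refine (abs_sub _ _).trans ?_
    have : 0 < E := Real.exp_pos _
    nlinarith
  have h6 := exp_neg_logSize_le (x := x₁ / x₂) fun h => hne ((div_eq_one_iff_eq hx₂0).1 h)
  have h7 : Real.exp (-logSize (x₁ / x₂)) ≤ Real.exp (2 + -(c * V₀ / 2)) := by
    rw [Real.exp_add]
    refine (h6.trans h5).trans ?_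
    gcongr
    have : (2 : ℝ) ≤ Real.exp 1 := by have := Real.add_one_le_exp (1 : ℝ); linarith
    have h8 : Real.exp 2 = Real.exp 1 * Real.exp 1 := by rw [← Real.exp_add]; norm_num
    nlinarith
  rw [Real.exp_le_exp] at h7
  have hρc : ∀ {V : ℝ}, V ≤ 2 * V₀ → ρ * (c * V) ≤ c * V₀ / 2 ^ 9 := by
    intro V hV
    calc ρ * (c * V) ≤ ρ * (c * (2 * V₀)) := by gcongr
      _ ≤ 1 / 2 ^ 10 * (c * (2 * V₀)) := by gcongr; linarith
      _ = _ := by ring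
  have r₁ := hρc hV₁'
  have r₂ := hρc hV₂'
  have h8 : logSize (γ₁ / γ₂) ≤ 16 * (c * V₀ / 2 ^ 9) := by
    have := logSize_div_le_add h₁.ne_zero h₂.ne_zero
    linarith [h₁.logSize_le, h₂.logSize_le]
  have h9 : logSize ((k : ℚ) ^ (e₁ - e₂) * (l : ℚ) ^ (-(f₁ - f₂))) ≤
      c * V₀ / 8 + 18 * (c * V₀ / 2 ^ 9) := by
    refine (logSize_zpow_le hk hl _ _).trans (add_le_add (by push_cast; exact hf) ?_)
    have h3 : ((e₁ - e₂ : ℤ) : ℝ) * Real.log k - ((f₁ - f₂ : ℤ) : ℝ) * Real.log l =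
        (e₁ * Real.log k - f₁ * Real.log l) - (e₂ * Real.log k - f₂ * Real.log l) := by
      push_cast; ring
    rw [h3]
    refine (abs_sub _ _).trans ?_
    linarith [h₁.abs_log_le, h₂.abs_log_le]
  have h10 := logSize_mul_le (div_ne_zero h₁.ne_zero h₂.ne_zero) (hg (e₁ - e₂) (f₁ - f₂))
  rw [← hquot] at h10
  linarith

/-- The base of the `i`-th power: `k` or `l` according to the colour of `i`. -/
def powBase {ι : Type*} (k l : ℕ) (col : ι → Bool) (i : ι) : ℕ := if col i then k else l

/-- The `i`-th power determined by the exponents `E`. -/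
def powVal {ι : Type*} (k l : ℕ) (col : ι → Bool) (E : ι → ℤ) (i : ι) : ℚ :=
  (powBase k l col i : ℚ) ^ E i

/-- The logarithm of the `i`-th power. -/
noncomputable def logVal {ι : Type*} (k l : ℕ) (col : ι → Bool) (E : ι → ℤ) (i : ι) : ℝ :=
  E i * Real.log (powBase k l col i)

/-- Exponents supported on `s` which give a zero of the linear form `a` on `s` without vanishing
proper nonempty subsums. -/
def nondegSol {ι : Type*} (k l : ℕ) (col : ι → Bool) (a : ι → ℚ) (s : Finset ι) : Set (ι → ℤ) :=
  {E | (∀ i ∉ s, E i = 0) ∧ ∑ i ∈ s, a i * powVal k l col E i = 0 ∧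
    ∀ t ⊂ s, t.Nonempty → ∑ i ∈ t, a i * powVal k l col E i ≠ 0}

/-- `V` is the largest ratio of two of the powers, on the logarithmic scale. -/
def IsSpread {ι : Type*} (k l : ℕ) (col : ι → Bool) (s : Finset ι) (E : ι → ℤ) (V : ℝ) : Prop :=
  (∀ i ∈ s, ∀ j ∈ s, logVal k l col E i - logVal k l col E j ≤ V) ∧
    ∃ i ∈ s, ∃ j ∈ s, logVal k l col E i - logVal k l col E j = V

section

variable {ι : Type*} {k l : ℕ} {col : ι → Bool}

theorem exists_isSpread {s : Finset ι} (hs : s.Nonempty) (E : ι → ℤ) :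
    ∃ V, IsSpread k l col s E V := by
  obtain ⟨p, hp, hmax⟩ := Finset.exists_max_image (s ×ˢ s)
    (fun p => logVal k l col E p.1 - logVal k l col E p.2) (hs.product hs)
  rw [Finset.mem_product] at hp
  exact ⟨_, fun i hi j hj => hmax (i, j) (Finset.mem_product.2 ⟨hi, hj⟩), p.1, hp.1, p.2, hp.2, rfl⟩

theorem IsSpread.nonneg {s : Finset ι} {E : ι → ℤ} {V : ℝ} (h : IsSpread k l col s E V) :
    0 ≤ V := by
  obtain ⟨i, hi, -⟩ := h.2
  simpa using h.1 i hi i hi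

theorem two_le_powBase (hk : 2 ≤ k) (hl : 2 ≤ l) (i : ι) : 2 ≤ powBase k l col i := by
  unfold powBase; split_ifs <;> assumption

theorem powBase_of_true {i : ι} (h : col i = true) : powBase k l col i = k := by
  simp [powBase, h]

theorem powBase_of_false {i : ι} (h : col i = false) : powBase k l col i = l := by
  simp [powBase, h]

theorem powVal_pos (hk : 2 ≤ k) (hl : 2 ≤ l) (E : ι → ℤ) (i : ι) : 0 < powVal k l col E i := by
  have := two_le_powBase (col := col) hk hl i
  unfold powVal; positivity

theorem exp_logVal (hk : 2 ≤ k) (hl : 2 ≤ l) (E : ι → ℤ) (i : ι) :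
    Real.exp (logVal k l col E i) = (powVal k l col E i : ℝ) := by
  have := two_le_powBase (col := col) hk hl i
  have h : (0 : ℝ) < powBase k l col i := by positivity
  unfold powVal logVal
  push_cast
  rw [← Real.log_zpow, Real.exp_log (by positivity)]

/-- A monochromatic subsum with integral coefficients is an integral multiple of its smallest
power. -/
theorem exists_int_sum_eq (hk : 2 ≤ k) (hl : 2 ≤ l) (z : ι → ℤ) (E : ι → ℤ) {I : Finset ι}
    (hI : I.Nonempty) (hcol : ∀ i ∈ I, ∀ j ∈ I, col i = col j) :
    ∃ i₀ ∈ I, ∃ A : ℤ, ∑ i ∈ I, (z i : ℚ) * powVal k l col E i = A * powVal k l col E i₀ ∧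
      ∀ S w : ℝ, (∀ i ∈ I, logVal k l col E i - logVal k l col E i₀ ≤ S) →
        (∀ i ∈ I, |(z i : ℝ)| ≤ Real.exp w) → |(A : ℝ)| ≤ I.card * Real.exp (w + S) := by
  obtain ⟨i₀, hi₀, hmin⟩ := Finset.exists_min_image I E hI
  have hb : ∀ i ∈ I, powBase k l col i = powBase k l col i₀ := by
    intro i hi; unfold powBase; rw [hcol i hi i₀ hi₀]
  have hb2 := two_le_powBase (col := col) hk hl i₀
  have hb0 : (powBase k l col i₀ : ℚ) ≠ 0 := by positivity
  have hb0' : (0 : ℝ) < powBase k l col i₀ := by positivity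
  have hsplit : ∀ i ∈ I, powVal k l col E i =
      ((powBase k l col i₀ ^ (E i - E i₀).toNat : ℕ) : ℚ) * powVal k l col E i₀ := by
    intro i hi
    unfold powVal
    rw [hb i hi, Nat.cast_pow, ← zpow_natCast, Int.toNat_of_nonneg (by have := hmin i hi; omega),
      ← zpow_add₀ hb0]
    congr 1; ring
  refine ⟨i₀, hi₀, ∑ i ∈ I, z i * (powBase k l col i₀ ^ (E i - E i₀).toNat : ℕ), ?_, ?_⟩
  · rw [Int.cast_sum, Finset.sum_mul]
    refine Finset.sum_congr rfl fun i hi => ?_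
    rw [hsplit i hi]; push_cast; ring
  · intro S w hS hw
    rw [Int.cast_sum]
    refine (Finset.abs_sum_le_sum_abs _ _).trans ?_
    refine (Finset.sum_le_card_nsmul _ _ (Real.exp (w + S)) fun i hi => ?_).trans (by simp)
    rw [Int.cast_mul, abs_mul, Real.exp_add]
    refine mul_le_mul (hw i hi) ?_ (abs_nonneg _) (Real.exp_pos _).le
    refine le_trans (le_of_eq ?_) (Real.exp_le_exp.2 (hS i hi))
    rw [Real.exp_sub, exp_logVal hk hl, exp_logVal hk hl, hsplit i hi]
    have h0 : ((powVal k l col E i₀ : ℚ) : ℝ) ≠ 0 := by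
      exact_mod_cast (powVal_pos hk hl E i₀).ne'
    push_cast
    rw [mul_div_cancel_right₀ _ h0, abs_of_pos (by positivity)]

theorem logSize_intCast_le {A : ℤ} (hA : A ≠ 0) {n : ℕ} {x : ℝ} (hn : 0 < n)
    (h : |(A : ℝ)| ≤ n * Real.exp x) : logSize A ≤ Real.log n + x := by
  have hn' : (0 : ℝ) < n := by exact_mod_cast hn
  unfold logSize
  simp only [Rat.num_intCast, Rat.den_intCast, Nat.cast_one, Real.log_one, add_zero]
  have hA' : 0 < |(A : ℝ)| := abs_pos.2 (by exact_mod_cast hA)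
  refine (Real.log_le_log hA' h).trans (le_of_eq ?_)
  rw [Real.log_mul hn'.ne' (Real.exp_pos _).ne', Real.log_exp]

theorem sizeConst_le (hk : 2 ≤ k) (hl : 2 ≤ l) : sizeConst k l ≤ 2 * Real.log l := by
  have h := abs_logSize_sub_le hk hl 0 (-1)
  have hl0 : (0 : ℝ) < Real.log l := Real.log_pos (by exact_mod_cast (show 1 < l by omega))
  have h1 : logSize ((l : ℚ)) = Real.log l := by unfold logSize; simp
  simp [h1, abs_of_pos hl0] at h
  have := (abs_le.1 h).1
  linarith

theorem zpow_mul_zpow_eq {i j : ι} (hi : col i = true) (hj : col j = false) (E : ι → ℤ) :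
    (k : ℚ) ^ E i * (l : ℚ) ^ (-E j) = powVal k l col E i / powVal k l col E j := by
  rw [powVal, powVal, powBase_of_true hi, powBase_of_false hj, zpow_neg, div_eq_mul_inv]

theorem exists_color_split {s : Finset ι} {a : ι → ℚ} {E : ι → ℤ} {I : Finset ι}
    (hE : E ∈ nondegSol k l col a s) (hIs : I ⊆ s) {i j : ι} (hi : i ∈ I) (hj : j ∈ I)
    (hci : col i = true) (hcj : col j = false) :
    ∑ i ∈ I with col i = true, a i * powVal k l col E i ≠ 0 ∧
      ∑ i ∈ I with col i = false, a i * powVal k l col E i ≠ 0 := by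
  refine ⟨hE.2.2 _ ⟨(Finset.filter_subset _ _).trans hIs, fun h => ?_⟩
      ⟨i, Finset.mem_filter.2 ⟨hi, hci⟩⟩,
    hE.2.2 _ ⟨(Finset.filter_subset _ _).trans hIs, fun h => ?_⟩
      ⟨j, Finset.mem_filter.2 ⟨hj, hcj⟩⟩⟩
  · have := (Finset.mem_filter.1 (h (hIs hj))).2
    rw [hcj] at this; cases this
  · have := (Finset.mem_filter.1 (h (hIs hi))).2
    rw [hci] at this; cases this

theorem size_le_of_mem_nondegSol (hk : 2 ≤ k) (hl : 2 ≤ l) {s : Finset ι} {z : ι → ℤ}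
    {E : ι → ℤ} (hE : E ∈ nondegSol k l col (fun i => z i) s) {w V : ℝ}
    (hw : ∀ i ∈ s, |(z i : ℝ)| ≤ Real.exp w)
    (hV : ∀ i ∈ s, ∀ j ∈ s, logVal k l col E i - logVal k l col E j ≤ V)
    {i j : ι} (hi : i ∈ s) (hj : j ∈ s) (hci : col i = true) (hcj : col j = false) :
    sizeConst k l * |(E j : ℝ)| ≤ 5 * V + 2 * (Real.log s.card + w) := by
  obtain ⟨hA0, hB0⟩ := exists_color_split hE subset_rfl hi hj hci hcj
  obtain ⟨i₀, hi₀, A, hA, hAb⟩ := exists_int_sum_eq (col := col) hk hl z E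
    (I := {i ∈ s | col i = true}) ⟨i, by simp [hi, hci]⟩ (by
      intro i hi j hj
      rw [(Finset.mem_filter.1 hi).2, (Finset.mem_filter.1 hj).2])
  obtain ⟨j₀, hj₀, B, hB, hBb⟩ := exists_int_sum_eq (col := col) hk hl z E
    (I := {i ∈ s | col i = false}) ⟨j, by simp [hj, hcj]⟩ (by
      intro i hi j hj
      rw [(Finset.mem_filter.1 hi).2, (Finset.mem_filter.1 hj).2])
  rw [Finset.mem_filter] at hi₀ hj₀
  have hA1 : A ≠ 0 := by
    rintro rfl
    rw [hA] at hA0; simp at hA0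
  have hB1 : B ≠ 0 := by
    rintro rfl
    rw [hB] at hB0; simp at hB0
  have hcard : 0 < s.card := Finset.card_pos.2 ⟨i, hi⟩
  have hbound : ∀ b : Bool, (({i ∈ s | col i = b}.card : ℕ) : ℝ) * Real.exp (w + V) ≤
      s.card * Real.exp (w + V) := fun b => by
    gcongr; exact Finset.filter_subset _ _
  have hLA := logSize_intCast_le hA1 hcard ((hAb V w
    (fun i hi => hV i (Finset.mem_filter.1 hi).1 i₀ hi₀.1)
    (fun i hi => hw i (Finset.mem_filter.1 hi).1)).trans (hbound true))
  have hLB := logSize_intCast_le hB1 hcard ((hBb V w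
    (fun i hi => hV i (Finset.mem_filter.1 hi).1 j₀ hj₀.1)
    (fun i hi => hw i (Finset.mem_filter.1 hi).1)).trans (hbound false))
  have hsum : (A : ℚ) * powVal k l col E i₀ + B * powVal k l col E j₀ = 0 := by
    rw [← hA, ← hB, ← hE.2.1, ← Finset.sum_filter_add_sum_filter_not s (fun i => col i = true)]
    simp
  have hq : powVal k l col E i₀ / powVal k l col E j₀ = -((B : ℚ) / A) := by
    have h1 := (powVal_pos (col := col) hk hl E j₀).ne'
    have h2 : (A : ℚ) ≠ 0 := by exact_mod_cast hA1
    field_simp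
    linear_combination hsum
  have h1 := abs_logSize_sub_le hk hl (E i₀) (E j₀)
  rw [zpow_mul_zpow_eq hi₀.2 hj₀.2, hq, logSize_neg] at h1
  have h2 := logSize_div_le_add (x := (B : ℚ)) (y := (A : ℚ)) (by exact_mod_cast hB1)
    (by exact_mod_cast hA1)
  have h3 : |(E i₀ : ℝ) * Real.log k - E j₀ * Real.log l| ≤ V := by
    have h4 := hV i₀ hi₀.1 j₀ hj₀.1
    have h5 := hV j₀ hj₀.1 i₀ hi₀.1
    unfold logVal at h4 h5
    rw [powBase_of_true hi₀.2, powBase_of_false hj₀.2] at h4 h5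
    rw [abs_le]; constructor <;> linarith
  have h6 := (abs_le.1 h1).1
  have h7 : |(E j : ℝ)| ≤ |(E j₀ : ℝ)| + |(E j : ℝ) - E j₀| := by
    have := abs_add_le (E j₀ : ℝ) (E j - E j₀)
    rwa [add_sub_cancel] at this
  have hl0 : (0 : ℝ) < Real.log l := Real.log_pos (by exact_mod_cast (show 1 < l by omega))
  have h8 : Real.log l * |(E j : ℝ) - E j₀| ≤ V := by
    rw [show Real.log l * |(E j : ℝ) - E j₀| = |Real.log l * ((E j : ℝ) - E j₀)| by
      rw [abs_mul, abs_of_pos hl0]]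
    have h4 := hV j hj j₀ hj₀.1
    have h5 := hV j₀ hj₀.1 j hj
    unfold logVal at h4 h5
    rw [powBase_of_false hcj, powBase_of_false hj₀.2] at h4 h5
    rw [abs_le]; constructor <;> linarith
  have h9 : sizeConst k l * |(E j : ℝ) - E j₀| ≤ 2 * V :=
    (mul_le_mul_of_nonneg_right (sizeConst_le hk hl) (abs_nonneg _)).trans (by linarith)
  have h10 := mul_le_mul_of_nonneg_left h7 (sizeConst_nonneg k l)
  linarith

theorem exists_empty_interval {s : Finset ι} {u : ι → ℝ} {i₁ : ι} (hi₁ : i₁ ∈ s) (hu : u i₁ ≤ 0)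
    {c : ℕ → ℝ} (hc : Antitone c) (hpos : ∀ t, 0 ≤ c t) :
    ∃ t < s.card, ∀ i ∈ s, u i ≤ c (t + 1) ∨ c t < u i := by
  classical
  have : Nonempty ι := ⟨i₁⟩
  by_contra! h
  choose! f hfs hf hf' using h
  have hinj : Set.InjOn f (Finset.range s.card : Set ℕ) := by
    intro p hp q hq hpq
    simp only [Finset.coe_range, Set.mem_Iio] at hp hq
    by_contra hne
    rcases lt_or_gt_of_ne hne with h | h
    · have h1 := hc (show p + 1 ≤ q from h)
      have h2 := hf p hp
      have h3 := hf' q hq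
      rw [hpq] at h2
      linarith
    · have h1 := hc (show q + 1 ≤ p from h)
      have h2 := hf q hq
      have h3 := hf' p hp
      rw [hpq] at h3
      linarith
  have hmaps : ∀ t ∈ Finset.range s.card, f t ∈ s.erase i₁ := by
    intro t ht
    rw [Finset.mem_range] at ht
    refine Finset.mem_erase.2 ⟨fun h => ?_, hfs t ht⟩
    have := hf t ht
    rw [h] at this
    linarith [hpos (t + 1)]
  have := Finset.card_le_card_of_injOn f hmaps hinj
  rw [Finset.card_range, Finset.card_erase_of_mem hi₁] at this
  have := Finset.card_pos.2 ⟨i₁, hi₁⟩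
  omega

theorem abs_sum_le_exp (hk : 2 ≤ k) (hl : 2 ≤ l) {J : Finset ι} {z : ι → ℤ} {E : ι → ℤ} {D X : ℝ}
    (hw : ∀ i ∈ J, |(z i : ℝ)| ≤ Real.exp D) (hN : Real.log J.card ≤ D)
    (hX : ∀ i ∈ J, logVal k l col E i ≤ X) :
    |((∑ i ∈ J, (z i : ℚ) * powVal k l col E i : ℚ) : ℝ)| ≤ Real.exp (2 * D + X) := by
  rw [Rat.cast_sum]
  refine (Finset.abs_sum_le_sum_abs _ _).trans ?_
  refine (Finset.sum_le_card_nsmul _ _ (Real.exp (D + X)) fun i hi => ?_).trans ?_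
  · rw [Rat.cast_mul, abs_mul, Real.exp_add, Rat.cast_intCast, ← exp_logVal hk hl, Real.abs_exp]
    exact mul_le_mul (hw i hi) (Real.exp_le_exp.2 (hX i hi)) (Real.exp_pos _).le
      (Real.exp_pos _).le
  · rw [nsmul_eq_mul, show 2 * D + X = D + (D + X) by ring, Real.exp_add D (D + X)]
    refine mul_le_mul_of_nonneg_right ?_ (Real.exp_pos _).le
    rcases Nat.eq_zero_or_pos J.card with h | h
    · rw [h]; simpa using (Real.exp_pos _).le
    · exact (Real.log_le_iff_le_exp (by exact_mod_cast h)).1 hN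

/-- A solution of large spread has a gap between its powers; the part above the gap yields an
approximation of `1` by `k ^ e * l ^ (-f)` up to a factor of small height. -/
theorem exists_isApprox (hk : 2 ≤ k) (hl : 2 ≤ l) {s : Finset ι} {z : ι → ℤ} {E : ι → ℤ}
    (hE : E ∈ nondegSol k l col (fun i => z i) s) {c : ℕ → ℝ} (hc0 : ∀ t, 0 < c t) (hc1 : c 0 = 1)
    (hc : ∀ t, c (t + 1) ≤ c t / 2 ^ 10) {D V : ℝ} (hD : 0 < D)
    (hw : ∀ i ∈ s, |(z i : ℝ)| ≤ Real.exp D) (hN : Real.log s.card ≤ D)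
    (hV : IsSpread k l col s E V) (hDV : D ≤ c s.card * V) :
    ∃ t < s.card, ∃ I ⊆ s, ∃ i₀ ∈ I, ∃ j₀ ∈ I, col i₀ = true ∧ col j₀ = false ∧ I ≠ s ∧
      ∃ γ : ℚ, IsApprox k l (c t) (c (t + 1) / c t) V γ (E i₀) (E j₀) ∧
        ∑ i ∈ I with col i = true, (z i : ℚ) * powVal k l col E i +
          γ * ((k : ℚ) ^ E i₀ * (l : ℚ) ^ (-E j₀)) *
            ∑ i ∈ I with col i = false, (z i : ℚ) * powVal k l col E i = 0 := by
  classical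
  have hanti : Antitone c := antitone_nat_of_succ_le fun t => (hc t).trans
    (div_le_self (hc0 t).le (by norm_num))
  have hV0 : 0 < V := by
    by_contra h
    have := mul_nonpos_of_nonneg_of_nonpos (hc0 s.card).le (not_lt.1 h)
    linarith
  obtain ⟨i₁, hi₁, j₁, hj₁, hij⟩ := hV.2
  set X := logVal k l col E i₁ with hX
  have htop : ∀ i ∈ s, logVal k l col E i ≤ X := fun i hi => by
    have := hV.1 i hi j₁ hj₁; linarith
  obtain ⟨t, ht, hgap⟩ := exists_empty_interval (u := fun i => X - logVal k l col E i) hi₁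
    (by simp [hX]) (c := fun t => c t * V)
    (fun p q h => mul_le_mul_of_nonneg_right (hanti h) hV0.le)
    (fun t => mul_nonneg (hc0 t).le hV0.le)
  set S := c (t + 1) * V with hS
  set S' := c t * V with hS'
  have hSS' : S ≤ S' / 2 ^ 10 := by
    have := mul_le_mul_of_nonneg_right (hc t) hV0.le
    rw [hS, hS']; linarith
  have hDS : D ≤ S := hDV.trans (mul_le_mul_of_nonneg_right (hanti ht) hV0.le)
  have hS'V : S' ≤ V := by
    have := hanti (Nat.zero_le t)
    rw [hc1] at this
    have := mul_le_mul_of_nonneg_right this hV0.le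
    linarith
  set I := {i ∈ s | X - logVal k l col E i ≤ S} with hI
  have hIs : I ⊆ s := Finset.filter_subset _ _
  have hiI : i₁ ∈ I := Finset.mem_filter.2 ⟨hi₁, by simp only [hX]; linarith⟩
  have hjI : j₁ ∉ I := fun h => by
    have := (Finset.mem_filter.1 h).2
    linarith
  have hIne : I ≠ s := fun h => hjI (h ▸ hj₁)
  have hIlt : I ⊂ s := lt_of_le_of_ne hIs hIne
  set R := ∑ i ∈ s \ I, (z i : ℚ) * powVal k l col E i with hR
  have hcard : 0 < s.card := Finset.card_pos.2 ⟨i₁, hi₁⟩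
  have hsum : ∑ i ∈ I, (z i : ℚ) * powVal k l col E i + R = 0 := by
    rw [hR, add_comm, Finset.sum_sdiff hIs]; exact hE.2.1
  have hRle : |(R : ℝ)| ≤ Real.exp (2 * D + (X - S')) := by
    refine abs_sum_le_exp hk hl (fun i hi => hw i (Finset.mem_sdiff.1 hi).1) ?_ ?_
    · refine le_trans ?_ hN
      refine Real.log_le_log ?_ (by exact_mod_cast Finset.card_le_card Finset.sdiff_subset)
      exact_mod_cast Finset.card_pos.2 ⟨j₁, Finset.mem_sdiff.2 ⟨hj₁, hjI⟩⟩
    · intro i hi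
      rw [Finset.mem_sdiff] at hi
      rcases hgap i hi.1 with h | h
      · exact absurd (Finset.mem_filter.2 ⟨hi.1, h⟩) hi.2
      · linarith
  have hlow : ∀ p ∈ I, X - S ≤ logVal k l col E p := fun p hp => by
    have := (Finset.mem_filter.1 hp).2
    linarith
  have hmulti : ∃ p ∈ I, ∃ q ∈ I, col p ≠ col q := by
    by_contra! hmono
    obtain ⟨i₀, hi₀, A, hA, -⟩ := exists_int_sum_eq (col := col) hk hl z E ⟨i₁, hiI⟩ hmono
    have hA0 : A ≠ 0 := by
      rintro rfl
      exact hE.2.2 I hIlt ⟨i₁, hiI⟩ (by rw [hA]; simp)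
    have h1 : (R : ℝ) = -(A * Real.exp (logVal k l col E i₀)) := by
      rw [exp_logVal hk hl]
      have : R = -(A * powVal k l col E i₀) := by rw [← hA]; linarith
      rw [this]; push_cast; ring
    have h2 : Real.exp (X - S) ≤ |(R : ℝ)| := by
      rw [h1, abs_neg, abs_mul, Real.abs_exp]
      have h3 : (1 : ℝ) ≤ |(A : ℝ)| := by exact_mod_cast Int.one_le_abs hA0
      have h4 := Real.exp_le_exp.2 (hlow i₀ hi₀)
      nlinarith [Real.exp_pos (logVal k l col E i₀)]
    have := Real.exp_le_exp.1 (h2.trans hRle)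
    linarith
  obtain ⟨p, hp, q, hq, hcp, hcq⟩ : ∃ p ∈ I, ∃ q ∈ I, col p = true ∧ col q = false := by
    obtain ⟨p, hp, q, hq, hpq⟩ := hmulti
    cases h : col p
    · exact ⟨q, hq, p, hp, by rw [h] at hpq; simpa using hpq.symm, h⟩
    · exact ⟨p, hp, q, hq, h, by rw [h] at hpq; simpa using hpq.symm⟩
  obtain ⟨hA0, hB0⟩ := exists_color_split hE hIs hp hq hcp hcq
  obtain ⟨i₀, hi₀, A, hA, hAb⟩ := exists_int_sum_eq (col := col) hk hl z E
    (I := {i ∈ I | col i = true}) ⟨p, by simp [hp, hcp]⟩ (by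
      intro i hi j hj
      rw [(Finset.mem_filter.1 hi).2, (Finset.mem_filter.1 hj).2])
  obtain ⟨j₀, hj₀, B, hB, hBb⟩ := exists_int_sum_eq (col := col) hk hl z E
    (I := {i ∈ I | col i = false}) ⟨q, by simp [hq, hcq]⟩ (by
      intro i hi j hj
      rw [(Finset.mem_filter.1 hi).2, (Finset.mem_filter.1 hj).2])
  rw [Finset.mem_filter] at hi₀ hj₀
  have hA1 : A ≠ 0 := by
    rintro rfl
    rw [hA] at hA0; simp at hA0
  have hB1 : B ≠ 0 := by
    rintro rfl
    rw [hB] at hB0; simp at hB0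
  have hdiff : ∀ p ∈ I, ∀ q ∈ I, logVal k l col E p - logVal k l col E q ≤ S := fun p hp q hq => by
    have h1 := hlow q hq
    have h2 := htop p (hIs hp)
    linarith
  have hbound : ∀ b : Bool, (({i ∈ I | col i = b}.card : ℕ) : ℝ) * Real.exp (D + S) ≤
      s.card * Real.exp (D + S) := fun b => by
    gcongr; exact (Finset.filter_subset _ _).trans hIs
  have hLA := logSize_intCast_le hA1 hcard ((hAb S D
    (fun i hi => hdiff i (Finset.mem_filter.1 hi).1 i₀ hi₀.1)
    (fun i hi => hw i (hIs (Finset.mem_filter.1 hi).1))).trans (hbound true))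
  have hLB := logSize_intCast_le hB1 hcard ((hBb S D
    (fun i hi => hdiff i (Finset.mem_filter.1 hi).1 j₀ hj₀.1)
    (fun i hi => hw i (hIs (Finset.mem_filter.1 hi).1))).trans (hbound false))
  have hA2 : (A : ℚ) ≠ 0 := by exact_mod_cast hA1
  have hB2 : (B : ℚ) ≠ 0 := by exact_mod_cast hB1
  have hvi := (powVal_pos (col := col) hk hl E i₀).ne'
  have hvj := (powVal_pos (col := col) hk hl E j₀).ne'
  have hABR : (A : ℚ) * powVal k l col E i₀ + B * powVal k l col E j₀ + R = 0 := by
    rw [← hA, ← hB, ← hsum, ← Finset.sum_filter_add_sum_filter_not I (fun i => col i = true)]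
    simp
  have hR0 : R ≠ 0 := hE.2.2 _ (Finset.sdiff_ssubset hIs ⟨i₁, hiI⟩)
    ⟨j₁, Finset.mem_sdiff.2 ⟨hj₁, hjI⟩⟩
  have hg := zpow_mul_zpow_eq (k := k) (l := l) hi₀.2 hj₀.2 E
  have hx : -((A : ℚ) / B) * ((k : ℚ) ^ E i₀ * (l : ℚ) ^ (-E j₀)) - 1 =
      R / (B * powVal k l col E j₀) := by
    rw [hg, eq_div_iff (mul_ne_zero hB2 hvj)]
    field_simp
    linear_combination -hABR
  have hx1 : -((A : ℚ) / B) * ((k : ℚ) ^ E i₀ * (l : ℚ) ^ (-E j₀)) ≠ 1 := by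
    rw [← sub_ne_zero, hx]
    exact div_ne_zero hR0 (mul_ne_zero hB2 hvj)
  have hclose : |((-((A : ℚ) / B) * ((k : ℚ) ^ E i₀ * (l : ℚ) ^ (-E j₀)) : ℚ) : ℝ) - 1| ≤
      Real.exp (-(S' / 2)) := by
    have h1 : ((-((A : ℚ) / B) * ((k : ℚ) ^ E i₀ * (l : ℚ) ^ (-E j₀)) : ℚ) : ℝ) - 1 =
        R / (B * Real.exp (logVal k l col E j₀)) := by
      rw [exp_logVal hk hl]
      have := congrArg (fun x : ℚ => (x : ℝ)) hx
      push_cast at this ⊢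
      exact this
    rw [h1, abs_div, abs_mul, Real.abs_exp]
    have h3 : (1 : ℝ) ≤ |(B : ℝ)| := by exact_mod_cast Int.one_le_abs hB1
    have h4 := Real.exp_le_exp.2 (hlow j₀ hj₀.1)
    rw [div_le_iff₀ (by positivity)]
    have h5 : Real.exp (2 * D + (X - S')) ≤ Real.exp (-(S' / 2)) * Real.exp (X - S) := by
      rw [← Real.exp_add, Real.exp_le_exp]
      linarith
    refine hRle.trans (h5.trans (mul_le_mul_of_nonneg_left ?_ (Real.exp_pos _).le))
    nlinarith [Real.exp_pos (logVal k l col E j₀)]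
  have hψ : |(E i₀ : ℝ) * Real.log k - E j₀ * Real.log l| ≤ S := by
    have h4 := hdiff i₀ hi₀.1 j₀ hj₀.1
    have h5 := hdiff j₀ hj₀.1 i₀ hi₀.1
    unfold logVal at h4 h5
    rw [powBase_of_true hi₀.2, powBase_of_false hj₀.2] at h4 h5
    rw [abs_le]; constructor <;> linarith
  have hLγ : logSize (-((A : ℚ) / B)) ≤ 6 * S := by
    rw [logSize_neg]
    have := logSize_div_le_add hA2 hB2
    linarith
  have hSeq : c (t + 1) / c t * S' = S := by
    rw [hS, hS', ← mul_assoc, div_mul_cancel₀ _ (hc0 t).ne']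
  have hS0 : 0 < S := hD.trans_le hDS
  refine ⟨t, ht, I, hIs, i₀, hi₀.1, j₀, hj₀.1, hi₀.2, hj₀.2, hIne, -((A : ℚ) / B),
    ⟨neg_ne_zero.2 (div_ne_zero hA2 hB2), hx1, hclose, ?_, ?_, ?_, ?_⟩, ?_⟩
  · rw [← hS', hSeq]; linarith
  · rw [← hS', hSeq]; linarith
  · have h1 := Real.exp_le_exp.1 ((exp_neg_logSize_le hx1).trans hclose)
    have h2 := logSize_mul_le (neg_ne_zero.2 (div_ne_zero hA2 hB2)) (hg ▸ div_ne_zero hvi hvj :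
      (k : ℚ) ^ E i₀ * (l : ℚ) ^ (-E j₀) ≠ 0)
    have h3 := (abs_le.1 (abs_logSize_sub_le hk hl (E i₀) (E j₀))).2
    rw [← hS']
    linarith
  · have := size_le_of_mem_nondegSol hk hl hE hw hV.1 (hIs hi₀.1) (hIs hj₀.1) hi₀.2 hj₀.2
    linarith
  · rw [hA, hB, hg]
    field_simp
    ring

end

/-- The points `powVal E` for `E ∈ A` lie on at most `n` hyperplanes, each of which is given by an
equation in which some, but not all, of the coordinates in `s` occur. -/
def HasCover {ι : Type*} (k l : ℕ) (col : ι → Bool) (s : Finset ι) (A : Set (ι → ℤ)) (n : ℕ) :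
    Prop :=
  ∃ H : Finset (ι → ℚ), H.card ≤ n ∧ ∀ E ∈ A, ∃ d ∈ H, (∃ i ∈ s, d i ≠ 0) ∧ (∃ i ∈ s, d i = 0) ∧
    ∑ i ∈ s, d i * powVal k l col E i = 0

section

variable {ι : Type*} {k l : ℕ} {col : ι → Bool} {s : Finset ι}

theorem HasCover.mono {A B : Set (ι → ℤ)} {n m : ℕ} (h : HasCover k l col s B n) (hAB : A ⊆ B)
    (hnm : n ≤ m) : HasCover k l col s A m := by
  obtain ⟨H, hH, hH'⟩ := h
  exact ⟨H, hH.trans hnm, fun E hE => hH' E (hAB hE)⟩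

theorem HasCover.union {A B : Set (ι → ℤ)} {n m : ℕ} (hA : HasCover k l col s A n)
    (hB : HasCover k l col s B m) : HasCover k l col s (A ∪ B) (n + m) := by
  classical
  obtain ⟨H, hH, hH'⟩ := hA
  obtain ⟨J, hJ, hJ'⟩ := hB
  refine ⟨H ∪ J, (Finset.card_union_le _ _).trans (add_le_add hH hJ), ?_⟩
  rintro E (hE | hE)
  · obtain ⟨d, hd, h⟩ := hH' E hE
    exact ⟨d, Finset.mem_union_left _ hd, h⟩
  · obtain ⟨d, hd, h⟩ := hJ' E hE
    exact ⟨d, Finset.mem_union_right _ hd, h⟩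

theorem hasCover_empty : HasCover k l col s ∅ 0 := ⟨∅, le_rfl, fun _ h => h.elim⟩

theorem HasCover.biUnion {β : Type*} (T : Finset β) {A : Set (ι → ℤ)} {B : β → Set (ι → ℤ)} {n : ℕ}
    (hA : ∀ E ∈ A, ∃ b ∈ T, E ∈ B b) (hB : ∀ b ∈ T, HasCover k l col s (B b) n) :
    HasCover k l col s A (T.card * n) := by
  classical
  suffices h : ∀ T : Finset β, (∀ b ∈ T, HasCover k l col s (B b) n) →
      HasCover k l col s (⋃ b ∈ T, B b) (T.card * n) from
    (h T hB).mono (fun E hE => by simpa using hA E hE) le_rfl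
  intro T
  induction T using Finset.induction_on with
  | empty => intro _; exact hasCover_empty.mono (by simp) (by simp)
  | insert b T hb ih =>
    intro h
    rw [Finset.card_insert_of_notMem hb, add_mul, one_mul, add_comm]
    exact ((h b (Finset.mem_insert_self _ _)).union
      (ih fun c hc => h c (Finset.mem_insert_of_mem hc))).mono (by simp) le_rfl

/-- A set covered by finitely many pieces, in each of which any two points lie on a common
hyperplane determined by the first. -/
theorem HasCover.of_forall {A : Set (ι → ℤ)}
    (h : ∀ E ∈ A, ∃ d : ι → ℚ, (∃ i ∈ s, d i ≠ 0) ∧ (∃ i ∈ s, d i = 0) ∧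
      ∀ F ∈ A, ∑ i ∈ s, d i * powVal k l col F i = 0) : HasCover k l col s A 1 := by
  rcases A.eq_empty_or_nonempty with rfl | ⟨E, hE⟩
  · exact hasCover_empty.mono (by simp) (by simp)
  · obtain ⟨d, h1, h2, h3⟩ := h E hE
    exact ⟨{d}, by simp, fun F hF => ⟨d, by simp, h1, h2, h3 F hF⟩⟩

/-- The elements of `A` with spread in the interval `[L, U]`. -/
def spreadIn (k l : ℕ) (col : ι → Bool) (s : Finset ι) (A : Set (ι → ℤ)) (L U : ℝ) : Set (ι → ℤ) :=
  {E | E ∈ A ∧ ∃ V, IsSpread k l col s E V ∧ L ≤ V ∧ V ≤ U}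

theorem HasCover.spreadIn_two_pow {A : Set (ι → ℤ)} {M : ℕ}
    (h : ∀ V₀, HasCover k l col s (spreadIn k l col s A V₀ (2 * V₀)) M) (L : ℝ) (n : ℕ) :
    HasCover k l col s (spreadIn k l col s A L (2 ^ n * L)) ((n + 1) * M) := by
  induction n with
  | zero =>
    refine (h L).mono ?_ (by simp)
    rintro E ⟨hE, V, hV, h1, h2⟩
    exact ⟨hE, V, hV, h1, by linarith [hV.nonneg]⟩
  | succ n ih =>
    rw [add_mul _ 1, one_mul]
    refine (ih.union (h (2 ^ n * L))).mono ?_ le_rfl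
    rintro E ⟨hE, V, hV, h1, h2⟩
    rcases le_total V (2 ^ n * L) with h3 | h3
    · exact Or.inl ⟨hE, V, hV, h1, h3⟩
    · exact Or.inr ⟨hE, V, hV, h3, by rw [pow_succ] at h2; linarith⟩

theorem hasCover_spreadIn_two_mul (hk : 2 ≤ k) (hl : 2 ≤ l) {z : ι → ℤ} (hz : ∀ i ∈ s, z i ≠ 0)
    {D : ℝ} (hD : 8 ≤ D) (hw : ∀ i ∈ s, |(z i : ℝ)| ≤ Real.exp D) (hN : Real.log s.card ≤ D)
    (V₀ : ℝ) (hV₀ : 2 ^ (10 * s.card) * D ≤ V₀) :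
    HasCover k l col s (spreadIn k l col s (nondegSol k l col (fun i => z i) s) V₀ (2 * V₀))
      (s.card * 2 ^ s.card * 2 ^ (10 * s.card + 10)) := by
  classical
  set N := s.card with hNdef
  have hV₀0 : 0 < V₀ := lt_of_lt_of_le (by positivity) hV₀
  have hc : ∀ t : ℕ, (0 : ℝ) < (1 / 2) ^ (10 * t) := fun t => by positivity
  set c : ℕ → ℝ := fun t => (1 / 2) ^ (10 * t) with hcdef
  have hcs : ∀ t, c (t + 1) = c t / 2 ^ 10 := fun t => by
    simp only [hcdef, mul_add, pow_add]; norm_num; ring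
  have hcanti : Antitone c := antitone_nat_of_succ_le fun t => by
    rw [hcs]; exact div_le_self (hc t).le (by norm_num)
  have hcN : c N * 2 ^ (10 * N) = 1 := by
    simp only [hcdef]; rw [← mul_pow]; norm_num
  have hcD : D ≤ c N * V₀ := by
    have := mul_le_mul_of_nonneg_left hV₀ (hc N).le
    rwa [← mul_assoc, show (1 / 2 : ℝ) ^ (10 * N) * 2 ^ (10 * N) = 1 from hcN, one_mul] at this
  set K : ℤ := 2 ^ (10 * N + 8) with hK
  let T : Finset (ℕ × Finset ι × ℤ) := Finset.range N ×ˢ s.powerset ×ˢ Finset.Icc (-K) K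
  have hT : T.card ≤ N * 2 ^ N * 2 ^ (10 * N + 10) := by
    simp only [T, Finset.card_product, Finset.card_range, Finset.card_powerset, Int.card_Icc]
    rw [mul_assoc]
    refine Nat.mul_le_mul_left _ (Nat.mul_le_mul_left _ ?_)
    have h1 : (1 : ℤ) ≤ 2 ^ (10 * N + 8) := one_le_pow₀ (by norm_num)
    have h2 : ((2 ^ (10 * N + 10) : ℕ) : ℤ) = 4 * K := by
      rw [hK]; push_cast; ring
    rw [Int.toNat_le, h2]
    rw [← hK] at h1
    linarith
  let B : ℕ × Finset ι × ℤ → Set (ι → ℤ) := fun b =>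
    {E | b.2.1 ⊆ s ∧ b.2.1 ≠ s ∧ ∃ V, V₀ ≤ V ∧ V ≤ 2 * V₀ ∧ ∃ i₀ ∈ b.2.1, ∃ j₀ ∈ b.2.1,
      col i₀ = true ∧ col j₀ = false ∧
      ⌊sizeConst k l * E j₀ / (c b.1 * V₀ / 8)⌋ = b.2.2 ∧ ∃ γ : ℚ,
      IsApprox k l (c b.1) (c (b.1 + 1) / c b.1) V γ (E i₀) (E j₀) ∧
        ∑ i ∈ b.2.1 with col i = true, (z i : ℚ) * powVal k l col E i +
          γ * ((k : ℚ) ^ E i₀ * (l : ℚ) ^ (-E j₀)) *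
            ∑ i ∈ b.2.1 with col i = false, (z i : ℚ) * powVal k l col E i = 0}
  refine (HasCover.biUnion (B := B) (n := 1) T ?_ ?_).mono subset_rfl (by simpa using hT)
  · rintro E ⟨hE, V, hV, hVl, hVu⟩
    obtain ⟨t, ht, I, hI, i₀, hi₀, j₀, hj₀, hci, hcj, hIs, γ, hγ, hsum⟩ := exists_isApprox hk hl hE
      (c := c) hc (by simp [hcdef]) (fun t => (hcs t).le) (by linarith) hw hN hV
      (hcD.trans (mul_le_mul_of_nonneg_left hVl (hc N).le))
    refine ⟨(t, I, ⌊sizeConst k l * E j₀ / (c t * V₀ / 8)⌋), ?_,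
      hI, hIs, V, hVl, hVu, i₀, hi₀, j₀, hj₀, hci, hcj, rfl, γ, hγ, hsum⟩
    simp only [T, Finset.mem_product, Finset.mem_range, Finset.mem_powerset, Finset.mem_Icc]
    refine ⟨ht, hI, ?_⟩
    have hct : 0 < c t * V₀ / 8 := by have := mul_pos (hc t) hV₀0; linarith
    have habs : |sizeConst k l * E j₀ / (c t * V₀ / 8)| ≤ K := by
      rw [abs_div, abs_of_pos hct, div_le_iff₀ hct, abs_mul,
        abs_of_nonneg (sizeConst_nonneg k l)]
      refine hγ.size_le.trans ?_
      have h1 := mul_le_mul_of_nonneg_right (hcanti ht.le) hV₀0.le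
      have h2 : (K : ℝ) = 2 ^ 8 * 2 ^ (10 * N) := by rw [hK]; push_cast; ring
      have h3 : V₀ = 2 ^ (10 * N) * (c N * V₀) := by
        rw [← mul_assoc, mul_comm (2 ^ (10 * N)) (c N), hcN, one_mul]
      have h4 : (2 : ℝ) ^ (10 * N) * (c N * V₀) ≤ 2 ^ (10 * N) * (c t * V₀) := by gcongr
      rw [h2]
      nlinarith
    rw [abs_le] at habs
    refine ⟨Int.le_floor.2 (by push_cast; linarith), ?_⟩
    have := (Int.floor_le (sizeConst k l * E j₀ / (c t * V₀ / 8))).trans habs.2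
    exact_mod_cast this
  · rintro ⟨t, I, m⟩ hb
    simp only [T, Finset.mem_product, Finset.mem_range, Finset.mem_powerset] at hb
    refine HasCover.of_forall ?_
    rintro E ⟨hI, hIs, V, hVl, hVu, i₀, hi₀, j₀, hj₀, hci, hcj, hm, γ, hγ, hsum⟩
    simp only at hI hIs hi₀ hj₀ hm hγ hsum
    set x := γ * ((k : ℚ) ^ E i₀ * (l : ℚ) ^ (-E j₀)) with hx
    obtain ⟨p, hp, hpI⟩ : ∃ p ∈ s, p ∉ I := by
      by_contra! h
      exact hIs (Finset.Subset.antisymm hI h)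
    refine ⟨fun i => if i ∈ I then (if col i = true then (z i : ℚ) else x * z i) else 0,
      ⟨i₀, hI hi₀, by simp [hi₀, hci, hz i₀ (hI hi₀)]⟩, ⟨p, hp, by simp [hpI]⟩, ?_⟩
    rintro F ⟨-, -, V', hVl', hVu', i₁, hi₁, j₁, hj₁, hci', hcj', hm', γ', hγ', hsum'⟩
    simp only at hi₁ hj₁ hm' hγ' hsum'
    have hct : 0 < c t * V₀ / 8 := by have := mul_pos (hc t) hV₀0; linarith
    have hxx : x = γ' * ((k : ℚ) ^ F i₁ * (l : ℚ) ^ (-F j₁)) := by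
      refine IsApprox.eq_of_close hk hl (hc t) (by have := hc t; have := hc (t + 1); positivity)
        ?_ hγ hγ' hVl hVu hVl' hVu' ?_ ?_
      · rw [hcs, div_right_comm, div_self (hc t).ne']
      · have := mul_le_mul_of_nonneg_right (hcanti hb.1.le) hV₀0.le
        linarith
      · have := Int.abs_sub_lt_one_of_floor_eq_floor (hm.trans hm'.symm)
        rw [← sub_div, abs_div, abs_of_pos hct, div_lt_one hct, ← mul_sub, abs_mul,
          abs_of_nonneg (sizeConst_nonneg k l)] at this
        exact this.le
    rw [← hxx] at hsum'
    simp only [ite_mul, zero_mul, ← Finset.sum_filter, Finset.filter_mem_eq_inter,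
      Finset.inter_eq_right.2 hI]
    rw [← hsum', ← Finset.sum_filter_add_sum_filter_not I (fun i => col i = true)]
    congr 1
    · exact Finset.sum_congr rfl fun i hi => by rw [if_pos (Finset.mem_filter.1 hi).2]
    · rw [Finset.mul_sum]
      simp only [Bool.not_eq_true]
      exact Finset.sum_congr rfl fun i hi => by
        rw [if_neg (by simp [(Finset.mem_filter.1 hi).2]), mul_assoc]

theorem IsSpread.unique {E : ι → ℤ} {V V' : ℝ} (h : IsSpread k l col s E V)
    (h' : IsSpread k l col s E V') : V = V' := by
  obtain ⟨i, hi, j, hj, hij⟩ := h.2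
  obtain ⟨i', hi', j', hj', hij'⟩ := h'.2
  exact le_antisymm (hij ▸ h'.1 i hi j hj) (hij' ▸ h.1 i' hi' j' hj')

/-- The solutions with the spread at least `L`. -/
def spreadGe (k l : ℕ) (col : ι → Bool) (s : Finset ι) (z : ι → ℤ) (L : ℝ) : Set (ι → ℤ) :=
  {E | E ∈ nondegSol k l col (fun i => z i) s ∧ ∃ V, IsSpread k l col s E V ∧ L ≤ V}

theorem hasCover_spreadIn_spreadGe (hk : 2 ≤ k) (hl : 2 ≤ l) {z : ι → ℤ} (hz : ∀ i ∈ s, z i ≠ 0)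
    {D : ℝ} (hD : 8 ≤ D) (hw : ∀ i ∈ s, |(z i : ℝ)| ≤ Real.exp D) (hN : Real.log s.card ≤ D)
    (L : ℝ) (n : ℕ) :
    HasCover k l col s (spreadIn k l col s
      (spreadGe k l col s z (2 ^ (10 * s.card + 1) * D)) L (2 ^ n * L))
      ((n + 1) * (s.card * 2 ^ s.card * 2 ^ (10 * s.card + 10))) := by
  refine HasCover.spreadIn_two_pow (fun V₀ => ?_) L n
  rcases le_or_gt (2 ^ (10 * s.card) * D) V₀ with h | h
  · exact (hasCover_spreadIn_two_mul hk hl hz hD hw hN V₀ h).mono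
      (fun E hE => ⟨hE.1.1, hE.2⟩) le_rfl
  · refine hasCover_empty.mono ?_ (Nat.zero_le _)
    rintro E ⟨⟨hE, V, hV, h1⟩, V', hV', h2, h3⟩
    rw [hV.unique hV', pow_succ] at h1
    exact absurd h1 (by push Not; linarith)

theorem hasCover_spreadGe_three_pow (hk : 2 ≤ k) (hl : 2 ≤ l) {z : ι → ℤ} (hz : ∀ i ∈ s, z i ≠ 0)
    {D : ℝ} (hD : 8 ≤ D) (hw : ∀ i ∈ s, |(z i : ℝ)| ≤ Real.exp D) (hN : Real.log s.card ≤ D)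
    (hs : s.Nonempty) :
    HasCover k l col s (spreadGe k l col s z (2 ^ (60 * 3 ^ s.card) * D))
      (s.card * 2 *
        ((84 * 3 ^ s.card + 1) * (s.card * 2 ^ s.card * 2 ^ (10 * s.card + 10)))) := by
  classical
  set N := s.card with hNdef
  have hN1 : 1 ≤ N := Finset.card_pos.2 hs
  set c : ℕ → ℝ := fun t => (1 / 2) ^ (14 * (3 ^ t - 1)) with hcdef
  have hc : ∀ t, 0 < c t := fun t => by simp only [hcdef]; positivity
  have hc1 : ∀ t, c t ≤ 1 := fun t => pow_le_one₀ (by norm_num) (by norm_num)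
  have hcs : ∀ t, c (t + 1) = c t ^ 3 / 2 ^ 28 := fun t => by
    simp only [hcdef]
    have : 14 * (3 ^ (t + 1) - 1) = 14 * (3 ^ t - 1) * 3 + 28 := by
      have := Nat.one_le_pow t 3 (by norm_num)
      rw [pow_succ]; omega
    rw [this, pow_add, pow_mul _ (14 * (3 ^ t - 1)) 3]; norm_num; ring
  have hcinv : ∀ t, c t * 2 ^ (14 * (3 ^ t - 1)) = 1 := fun t => by
    simp only [hcdef]; rw [← mul_pow]; norm_num
  have hle : ∀ t < N, 3 * 3 ^ t ≤ 3 ^ N := fun t ht => by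
    rw [← pow_succ']; exact Nat.pow_le_pow_right (by norm_num) ht
  have hanti : ∀ t, c (t + 1) ≤ c t / 2 ^ 10 := fun t => by
    rw [hcs]
    have h1 := hc t
    have h2 := pow_le_of_le_one (hc t).le (hc1 t) (show 3 ≠ 0 by norm_num)
    linarith
  let T : Finset (ℕ × Bool) := Finset.range N ×ˢ Finset.univ
  let B : ℕ × Bool → Set (ι → ℤ) := fun b =>
    {E | E ∈ nondegSol k l col (fun i => z i) s ∧ ∃ V, IsSpread k l col s E V ∧
      2 ^ (60 * 3 ^ N) * D ≤ V ∧ ∃ (γ : ℚ) (e f : ℤ),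
        IsApprox k l (c b.1) (c (b.1 + 1) / c b.1) V γ e f ∧ (if b.2 then 0 ≤ f else f ≤ 0)}
  have hT : T.card = N * 2 := by simp [T]
  rw [← hT]
  have hlow : (2 : ℝ) ^ (10 * N + 1) * D ≤ 2 ^ (60 * 3 ^ N) * D := by
    refine mul_le_mul_of_nonneg_right (pow_le_pow_right₀ (by norm_num) ?_) (by linarith)
    have := (Nat.lt_pow_self (show 1 < 3 by norm_num) (n := N)).le
    omega
  refine HasCover.biUnion (B := B) T ?_ ?_
  · rintro E ⟨hE, V, hV, hVl⟩
    have hDV : D ≤ c N * V := by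
      have h2 : (2 : ℝ) ^ (14 * (3 ^ N - 1)) * D ≤ V := by
        refine le_trans (mul_le_mul_of_nonneg_right ?_ (by linarith)) hVl
        exact pow_le_pow_right₀ (by norm_num) (by omega)
      have h3 := mul_le_mul_of_nonneg_left h2 (hc N).le
      rwa [← mul_assoc, hcinv, one_mul] at h3
    obtain ⟨t, ht, I, hI, i₀, hi₀, j₀, hj₀, hci, hcj, hIs, γ, hγ, hsum⟩ := exists_isApprox hk hl hE
      (c := c) hc (by simp [hcdef]) hanti (by linarith) hw hN hV hDV
    rcases le_total 0 (E j₀) with h | h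
    · exact ⟨(t, true), by simpa [T] using ht, hE, V, hV, hVl, γ, _, _, hγ, by simpa using h⟩
    · exact ⟨(t, false), by simpa [T] using ht, hE, V, hV, hVl, γ, _, _, hγ, by simpa using h⟩
  · rintro ⟨t, b⟩ hb
    simp only [T, Finset.mem_product, Finset.mem_range, Finset.mem_univ, and_true] at hb
    rcases (B (t, b)).eq_empty_or_nonempty with he | ⟨E₁, hE₁, V₁, hV₁, hVl₁, γ₁, e₁, f₁, h₁, hf₁⟩
    · rw [he]; exact hasCover_empty.mono subset_rfl (Nat.zero_le _)
    have hK : (2 : ℝ) ^ 23 / c t ^ 3 ≤ 2 ^ (42 * 3 ^ N) := by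
      have h1 : c t ^ 3 * 2 ^ (14 * (3 ^ t - 1) * 3) = 1 := by
        rw [pow_mul _ (14 * (3 ^ t - 1)) 3, ← mul_pow, hcinv, one_pow]
      rw [div_le_iff₀ (pow_pos (hc t) 3)]
      calc (2 : ℝ) ^ 23 = c t ^ 3 * 2 ^ (14 * (3 ^ t - 1) * 3 + 23) := by
            rw [pow_add, ← mul_assoc, h1, one_mul]
        _ ≤ c t ^ 3 * 2 ^ (42 * 3 ^ N) := by
            refine mul_le_mul_of_nonneg_left (pow_le_pow_right₀ (by norm_num) ?_)
              (pow_pos (hc t) 3).le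
            have := hle t hb
            have := Nat.one_le_pow t 3 (by norm_num)
            omega
        _ = _ := mul_comm _ _
    have hbig : ∀ V, 2 ^ (60 * 3 ^ N) * D ≤ V → 2 ^ 29 / c t ^ 4 ≤ V := fun V hV => by
      have h1 : c t ^ 4 * 2 ^ (14 * (3 ^ t - 1) * 4) = 1 := by
        rw [pow_mul _ (14 * (3 ^ t - 1)) 4, ← mul_pow, hcinv, one_pow]
      refine le_trans ?_ hV
      rw [div_le_iff₀ (pow_pos (hc t) 4)]
      calc (2 : ℝ) ^ 29 = c t ^ 4 * 2 ^ (14 * (3 ^ t - 1) * 4 + 29) := by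
            rw [pow_add, ← mul_assoc, h1, one_mul]
        _ ≤ c t ^ 4 * 2 ^ (60 * 3 ^ N) := by
            refine mul_le_mul_of_nonneg_left (pow_le_pow_right₀ (by norm_num) ?_)
              (pow_pos (hc t) 4).le
            have := hle t hb
            have := Nat.one_le_pow t 3 (by norm_num)
            omega
        _ = 2 ^ (60 * 3 ^ N) * c t ^ 4 := mul_comm _ _
        _ ≤ 2 ^ (60 * 3 ^ N) * D * c t ^ 4 := by
            refine mul_le_mul_of_nonneg_right ?_ (pow_pos (hc t) 4).le
            exact le_mul_of_one_le_right (by positivity) (by linarith)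
    have hρ : c (t + 1) / c t ≤ c t ^ 2 / 2 ^ 25 := by
      have h1 := hc t
      rw [div_le_iff₀ h1, hcs]
      have h2 := pow_pos h1 3
      have h3 : c t ^ 2 / 2 ^ 25 * c t = c t ^ 3 / 2 ^ 25 := by ring
      rw [h3]; linarith
    have hρ0 : 0 ≤ c (t + 1) / c t := (div_pos (hc _) (hc _)).le
    set K : ℝ := 2 ^ (42 * 3 ^ N) with hKdef
    have hK0 : 0 < K := by positivity
    have hV₁0 : 0 < V₁ := lt_of_lt_of_le (by positivity) hVl₁
    have hcov := hasCover_spreadIn_spreadGe (col := col) hk hl hz hD hw hN (V₁ / K) (84 * 3 ^ N)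
    refine hcov.mono ?_ le_rfl
    rintro E₂ ⟨hE₂, V₂, hV₂, hVl₂, γ₂, e₂, f₂, h₂, hf₂⟩
    have hV₂0 : 0 < V₂ := lt_of_lt_of_le (by positivity) hVl₂
    have hff : 0 ≤ f₁ * f₂ := by
      simp only at hf₁ hf₂
      split_ifs at hf₁ hf₂
      · exact mul_nonneg hf₁ hf₂
      · exact mul_nonneg_of_nonpos_of_nonpos hf₁ hf₂
    have h12 := IsApprox.lt_of_mul_nonneg hk hl (hc t) (hc1 t) hρ0 hρ h₁ h₂ hff (hbig _ hVl₁)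
    have h21 := IsApprox.lt_of_mul_nonneg hk hl (hc t) (hc1 t) hρ0 hρ h₂ h₁
      (by rwa [mul_comm]) (hbig _ hVl₂)
    refine ⟨⟨hE₂, V₂, hV₂, hlow.trans hVl₂⟩, V₂, hV₂, ?_, ?_⟩
    · rw [div_le_iff₀ hK0, mul_comm]
      exact h21.le.trans (mul_le_mul_of_nonneg_right hK hV₂0.le)
    · have : (2 : ℝ) ^ (84 * 3 ^ N) * (V₁ / K) = K * V₁ := by
        rw [show 84 * 3 ^ N = 42 * 3 ^ N + 42 * 3 ^ N by ring, pow_add, ← hKdef]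
        field_simp
      rw [this]
      exact h12.le.trans (mul_le_mul_of_nonneg_right hK hV₁0.le)

theorem hasCover_spreadGe (hk : 2 ≤ k) (hl : 2 ≤ l) {z : ι → ℤ} (hz : ∀ i ∈ s, z i ≠ 0)
    {D : ℝ} (hD : 8 ≤ D) (hw : ∀ i ∈ s, |(z i : ℝ)| ≤ Real.exp D) (hN : Real.log s.card ≤ D)
    (hs : 3 ≤ s.card) :
    HasCover k l col s (spreadGe k l col s z (2 ^ (10 * s.card + 1) * D))
      (2 ^ (16 * s.card ^ 2)) := by
  have h1 := hasCover_spreadGe_three_pow (col := col) hk hl hz hD hw hN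
    (Finset.card_pos.1 (by omega))
  have h2 := hasCover_spreadIn_spreadGe (col := col) hk hl hz hD hw hN
    (2 ^ (10 * s.card + 1) * D) (60 * 3 ^ s.card)
  refine (h1.union h2).mono ?_ ?_
  · rintro E ⟨hE, V, hV, hVl⟩
    rcases le_total (2 ^ (60 * 3 ^ s.card) * D) V with h | h
    · exact Or.inl ⟨hE, V, hV, h⟩
    · refine Or.inr ⟨⟨hE, V, hV, hVl⟩, V, hV, hVl, h.trans ?_⟩
      refine mul_le_mul_of_nonneg_left ?_ (by positivity)
      exact le_mul_of_one_le_left (by linarith) (one_le_pow₀ (by norm_num))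
  · set N := s.card
    have h3 : 3 ^ N ≤ 2 ^ (2 * N) := by
      rw [pow_mul]; exact Nat.pow_le_pow_left (by norm_num) _
    have h4 : N ≤ 2 ^ N := Nat.lt_two_pow_self.le
    have h5 : 1 ≤ 3 ^ N := Nat.one_le_pow _ _ (by norm_num)
    calc N * 2 * ((84 * 3 ^ N + 1) * (N * 2 ^ N * 2 ^ (10 * N + 10))) +
          (60 * 3 ^ N + 1) * (N * 2 ^ N * 2 ^ (10 * N + 10))
        = (N * 2 * (84 * 3 ^ N + 1) + (60 * 3 ^ N + 1)) * (N * 2 ^ N * 2 ^ (10 * N + 10)) := by ring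
      _ ≤ (2 ^ 8 * 2 ^ N * 2 ^ (2 * N)) * (2 ^ N * 2 ^ N * 2 ^ (10 * N + 10)) := by
          refine Nat.mul_le_mul ?_ ?_
          · calc N * 2 * (84 * 3 ^ N + 1) + (60 * 3 ^ N + 1)
                ≤ N * 2 * (85 * 3 ^ N) + N * (61 * 3 ^ N) := by
                  refine add_le_add (Nat.mul_le_mul_left _ (by omega)) ?_
                  calc 60 * 3 ^ N + 1 ≤ 1 * (61 * 3 ^ N) := by omega
                    _ ≤ _ := Nat.mul_le_mul_right _ (by omega)
              _ = 231 * N * 3 ^ N := by ring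
              _ ≤ 2 ^ 8 * 2 ^ N * 2 ^ (2 * N) := by gcongr; norm_num
          · gcongr
      _ = 2 ^ (15 * N + 18) := by
          rw [← pow_add, ← pow_add, ← pow_add, ← pow_add, ← pow_add]; ring_nf
      _ ≤ 2 ^ (16 * N ^ 2) := Nat.pow_le_pow_right (by norm_num) (by nlinarith)

theorem exists_powVal_eq_natCast_mul (hk : 2 ≤ k) (hl : 2 ≤ l) (E : ι → ℤ) {i j : ι}
    (hij : col i = col j) (hE : E j ≤ E i) :
    ∃ n : ℕ, powVal k l col E i = n * powVal k l col E j := by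
  have hb : powBase k l col i = powBase k l col j := by unfold powBase; rw [hij]
  have hb2 := two_le_powBase (col := col) hk hl j
  have hb0 : (powBase k l col j : ℚ) ≠ 0 := by positivity
  refine ⟨powBase k l col j ^ (E i - E j).toNat, ?_⟩
  unfold powVal
  rw [hb, Nat.cast_pow, ← zpow_natCast, Int.toNat_of_nonneg (by omega), ← zpow_add₀ hb0]
  congr 1; ring

/-- Powers which are close to each other, with small exponents, are proportional to small
integers. -/
theorem exists_int_proportional (hk : 2 ≤ k) (hl : 2 ≤ l) {E : ι → ℤ} {η : ℝ}
    (hE : ∀ i ∈ s, ∀ j ∈ s, logVal k l col E i - logVal k l col E j ≤ η) {i j : ι}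
    (hi : i ∈ s) (hj : j ∈ s) (hci : col i = true) (hcj : col j = false)
    (hsize : sizeConst k l * |(E j : ℝ)| ≤ η) :
    ∃ r : ℚ, 0 < r ∧ ∃ y : ι → ℤ, ∀ p ∈ s, r * powVal k l col E p = y p ∧ 0 < y p ∧
      (y p : ℝ) ≤ Real.exp (5 * η) := by
  obtain ⟨i₀, hi₀, hmini⟩ := Finset.exists_min_image {p ∈ s | col p = true} E
    ⟨i, Finset.mem_filter.2 ⟨hi, hci⟩⟩
  obtain ⟨j₀, hj₀, hminj⟩ := Finset.exists_min_image {p ∈ s | col p = false} E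
    ⟨j, Finset.mem_filter.2 ⟨hj, hcj⟩⟩
  rw [Finset.mem_filter] at hi₀ hj₀
  have hvi := powVal_pos (col := col) hk hl E i₀
  have hvj := powVal_pos (col := col) hk hl E j₀
  have hψ : |(E i₀ : ℝ) * Real.log k - E j₀ * Real.log l| ≤ η := by
    have h4 := hE i₀ hi₀.1 j₀ hj₀.1
    have h5 := hE j₀ hj₀.1 i₀ hi₀.1
    unfold logVal at h4 h5
    rw [powBase_of_true hi₀.2, powBase_of_false hj₀.2] at h4 h5
    rw [abs_le]; constructor <;> linarith
  have hl0 : (0 : ℝ) < Real.log l := Real.log_pos (by exact_mod_cast (show 1 < l by omega))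
  have hd : Real.log l * |(E j₀ : ℝ) - E j| ≤ η := by
    rw [show Real.log l * |(E j₀ : ℝ) - E j| = |Real.log l * ((E j₀ : ℝ) - E j)| by
      rw [abs_mul, abs_of_pos hl0]]
    have h4 := hE j hj j₀ hj₀.1
    have h5 := hE j₀ hj₀.1 j hj
    unfold logVal at h4 h5
    rw [powBase_of_false hcj, powBase_of_false hj₀.2] at h4 h5
    rw [abs_le]; constructor <;> linarith
  have hκ : sizeConst k l * |(E j₀ : ℝ)| ≤ 3 * η := by
    have h1 : |(E j₀ : ℝ)| ≤ |(E j : ℝ)| + |(E j₀ : ℝ) - E j| := by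
      have := abs_add_le (E j : ℝ) (E j₀ - E j)
      rwa [add_sub_cancel] at this
    have h2 := mul_le_mul_of_nonneg_left h1 (sizeConst_nonneg k l)
    have h3 := mul_le_mul_of_nonneg_right (sizeConst_le hk hl) (abs_nonneg ((E j₀ : ℝ) - E j))
    linarith
  set g := powVal k l col E i₀ / powVal k l col E j₀ with hgdef
  have hg0 : 0 < g := div_pos hvi hvj
  have hLg : logSize g ≤ 4 * η := by
    have h1 := (abs_le.1 (abs_logSize_sub_le hk hl (E i₀) (E j₀))).2
    rw [zpow_mul_zpow_eq hi₀.2 hj₀.2] at h1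
    linarith
  have hnum : 0 < g.num := Rat.num_pos.2 hg0
  have hnum' : (1 : ℝ) ≤ g.num := by exact_mod_cast hnum
  have hden' : (1 : ℝ) ≤ g.den := by exact_mod_cast g.den_pos
  have hnle : (g.num : ℝ) ≤ Real.exp (4 * η) := by
    rw [← Real.log_le_iff_le_exp (by linarith)]
    unfold logSize at hLg
    rw [abs_of_pos (by linarith)] at hLg
    linarith [Real.log_nonneg hden']
  have hdle : (g.den : ℝ) ≤ Real.exp (4 * η) := by
    rw [← Real.log_le_iff_le_exp (by linarith)]
    unfold logSize at hLg
    rw [abs_of_pos (by linarith)] at hLg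
    linarith [Real.log_nonneg hnum']
  have key : ∀ p ∈ s, ∀ q ∈ s, col p = col q → E q ≤ E p → ∀ m : ℤ, 0 < m →
      (m : ℝ) ≤ Real.exp (4 * η) → ∃ y : ℤ,
        (m : ℚ) / powVal k l col E q * powVal k l col E p = y ∧ 0 < y ∧
          (y : ℝ) ≤ Real.exp (5 * η) := by
    intro p hp q hq hpq hqp m hm hmle
    obtain ⟨n, hn⟩ := exists_powVal_eq_natCast_mul hk hl E hpq hqp
    have hvp := powVal_pos (col := col) hk hl E p
    have hvq := powVal_pos (col := col) hk hl E q
    have hn0 : 0 < n := by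
      rcases Nat.eq_zero_or_pos n with rfl | h
      · simp [hvp.ne'] at hn
      · exact h
    refine ⟨m * n, ?_, by positivity, ?_⟩
    · rw [hn]; push_cast; field_simp
    · have h1 : (n : ℝ) = Real.exp (logVal k l col E p - logVal k l col E q) := by
        rw [Real.exp_sub, exp_logVal hk hl, exp_logVal hk hl,
          eq_div_iff (by exact_mod_cast hvq.ne'),
          hn]
        push_cast; ring
      rw [show 5 * η = 4 * η + η by ring, Real.exp_add]
      push_cast
      rw [h1]
      exact mul_le_mul hmle (Real.exp_le_exp.2 (hE p hp q hq)) (Real.exp_pos _).le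
        (Real.exp_pos _).le
  have hr : (g.num : ℚ) / powVal k l col E i₀ = (g.den : ℚ) / powVal k l col E j₀ := by
    rw [div_eq_div_iff hvi.ne' hvj.ne']
    have h1 : (g.num : ℚ) = g * g.den := (Rat.mul_den_eq_num g).symm
    rw [h1, hgdef]; field_simp
  have hex : ∀ p : ι, ∃ y : ℤ, p ∈ s → (g.num : ℚ) / powVal k l col E i₀ * powVal k l col E p = y ∧
      0 < y ∧ (y : ℝ) ≤ Real.exp (5 * η) := by
    intro p
    by_cases hp : p ∈ s
    · cases hcp : col p
      · obtain ⟨y, hy⟩ := key p hp j₀ hj₀.1 (by rw [hcp, hj₀.2])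
          (hminj p (Finset.mem_filter.2 ⟨hp, hcp⟩)) g.den (by exact_mod_cast g.den_pos)
          (by exact_mod_cast hdle)
        refine ⟨y, fun _ => ?_⟩
        rw [hr]; exact_mod_cast hy
      · obtain ⟨y, hy⟩ := key p hp i₀ hi₀.1 (by rw [hcp, hi₀.2])
          (hmini p (Finset.mem_filter.2 ⟨hp, hcp⟩)) g.num hnum hnle
        exact ⟨y, fun _ => hy⟩
    · exact ⟨0, fun h => absurd h hp⟩
  choose y hy using hex
  exact ⟨_, div_pos (by exact_mod_cast hnum) hvi, y, hy⟩

end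

/-- Integral vectors orthogonal to `b` either satisfy a second linear equation not involving the
coordinate `p`, or `b` is proportional to a small integral vector. -/
theorem exists_hyperplane_or_proportional {ι : Type*} {s : Finset ι} {p : ι} (hp : p ∈ s)
    {b : ι → ℚ} (hb : b p ≠ 0) {X : ℤ} {Y : Set (ι → ℤ)} (hY : ∀ y ∈ Y, ∀ i ∈ s, |y i| ≤ X)
    (hYb : ∀ y ∈ Y, ∑ i ∈ s, b i * y i = 0) :
    (∃ d : ι → ℚ, d p = 0 ∧ (∃ i ∈ s, d i ≠ 0) ∧ ∀ y ∈ Y, ∑ i ∈ s, d i * y i = 0) ∨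
      ∃ r : ℚ, r ≠ 0 ∧ ∃ w : ι → ℤ, ∀ i ∈ s, r * b i = w i ∧
        |w i| ≤ (s.card - 1).factorial * X ^ (s.card - 1) := by
  classical
  set s' := s.erase p with hs'
  have hcard : Fintype.card s' = s.card - 1 := by
    rw [Fintype.card_coe, Finset.card_erase_of_mem hp]
  have hsub : ∀ i : s', (i : ι) ∈ s := fun i => Finset.mem_of_mem_erase i.2
  let u : (ι → ℤ) → (s' → ℚ) := fun y i => y i
  rcases lt_or_eq_of_le (le_top : Submodule.span ℚ (u '' Y) ≤ ⊤) with hlt | htop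
  · obtain ⟨f, hf, hfle⟩ := Submodule.exists_le_ker_of_lt_top _ hlt
    set d : ι → ℚ := fun i => if h : i ∈ s' then f (Pi.single ⟨i, h⟩ 1) else 0 with hd
    have hdp : d p = 0 := by simp [hd, hs']
    have hfd : ∀ v : s' → ℚ, f v = ∑ i : s', d i * v i := by
      intro v
      rw [LinearMap.pi_apply_eq_sum_univ f v]
      refine Finset.sum_congr rfl fun i _ => ?_
      have : (fun j => if i = j then (1 : ℚ) else 0) = Pi.single i 1 := by
        ext j; simp [Pi.single_apply, eq_comm]
      rw [this, smul_eq_mul, mul_comm]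
      simp [hd]
    refine Or.inl ⟨d, hdp, ?_, fun y hy => ?_⟩
    · by_contra! h
      refine hf (LinearMap.ext fun v => ?_)
      rw [hfd]
      exact Finset.sum_eq_zero fun i _ => by rw [h i (hsub i), zero_mul]
    · have h1 : f (u y) = 0 := hfle (Submodule.subset_span ⟨y, hy, rfl⟩)
      rw [hfd, Finset.sum_coe_sort s' (fun i => d i * (y i : ℚ))] at h1
      rw [← Finset.add_sum_erase s _ hp, hdp, zero_mul, zero_add]
      exact h1
  · obtain ⟨g, hg, -, hli⟩ := Submodule.exists_fun_fin_finrank_span_eq ℚ (u '' Y)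
    have hdim : Module.finrank ℚ (Submodule.span ℚ (u '' Y)) = Fintype.card s' := by
      rw [htop, finrank_top, Module.finrank_fintype_fun_eq_card]
    let e : s' ≃ Fin (Module.finrank ℚ (Submodule.span ℚ (u '' Y))) :=
      Fintype.equivFinOfCardEq hdim.symm
    choose F hFY hF using fun j : s' => hg (e j)
    let M : Matrix s' s' ℤ := Matrix.of fun j i => F j i
    have hMrow : (M.map (fun x : ℤ => (x : ℚ))).row = g ∘ e := by
      ext j i
      simp [M, Matrix.row, ← hF j, u]
    have hdet : M.det ≠ 0 := by
      intro h
      have h1 : IsUnit (M.map (fun x : ℤ => (x : ℚ))) := by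
        rw [← Matrix.linearIndependent_rows_iff_isUnit, hMrow]
        exact hli.comp _ e.injective
      rw [Matrix.isUnit_iff_isUnit_det, ← Int.cast_det, h] at h1
      simp at h1
    have hvec : (M.map (fun x : ℤ => (x : ℚ))).mulVec (fun i : s' => b i) =
        fun j => -(b p) * (F j p : ℚ) := by
      ext j
      have h1 := hYb _ (hFY j)
      rw [← Finset.add_sum_erase s _ hp, ← hs', ← Finset.sum_coe_sort s'] at h1
      simp only [Matrix.mulVec, dotProduct, Matrix.map_apply, M, Matrix.of_apply]
      rw [eq_comm, neg_mul, neg_eq_iff_add_eq_zero, ← h1]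
      congr 1
      exact Finset.sum_congr rfl fun i _ => mul_comm _ _
    have hcr : ∀ i : s', (M.det : ℚ) / b p * b i = ((-M.cramer (fun j => F j p) i : ℤ) : ℚ) := by
      intro i
      have h1 := congrArg ((M.map (fun x : ℤ => (x : ℚ))).adjugate.mulVec) hvec
      rw [Matrix.mulVec_mulVec, Matrix.adjugate_mul, Matrix.smul_mulVec, Matrix.one_mulVec,
        ← Int.cast_det] at h1
      have h2 : (fun j => -(b p) * (F j p : ℚ)) = (-(b p)) • fun j : s' => (F j p : ℚ) := rfl
      rw [h2, Matrix.mulVec_smul, ← Matrix.cramer_eq_adjugate_mulVec] at h1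
      have h3 := congrFun h1 i
      simp only [Pi.smul_apply, smul_eq_mul, Matrix.cramer_apply] at h3
      have h4 : ((M.map (fun x : ℤ => (x : ℚ))).updateCol i fun j : s' => (F j p : ℚ)) =
          (M.updateCol i fun j => F j p).map (fun x : ℤ => (x : ℚ)) := by
        rw [Matrix.map_updateCol]; rfl
      rw [h4, ← Int.cast_det] at h3
      rw [Matrix.cramer_apply, div_mul_eq_mul_div, h3]
      push_cast
      field_simp
    have hbound : ∀ A : Matrix s' s' ℤ, (∀ i j, |A i j| ≤ X) →
        |A.det| ≤ (s.card - 1).factorial * X ^ (s.card - 1) := by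
      intro A hA
      have := Matrix.det_le (abv := AbsoluteValue.abs) (A := A) hA
      rw [hcard, nsmul_eq_mul] at this
      exact this
    refine Or.inr ⟨M.det / b p, div_ne_zero (by exact_mod_cast hdet) hb,
      fun i => if h : i ∈ s' then -M.cramer (fun j => F j p) ⟨i, h⟩ else M.det, fun i hi => ?_⟩
    by_cases h : i ∈ s'
    · simp only [h, dite_true]
      refine ⟨hcr ⟨i, h⟩, ?_⟩
      rw [abs_neg, Matrix.cramer_apply]
      refine hbound _ fun j q => ?_
      rw [Matrix.updateCol_apply]
      split_ifs
      · exact hY _ (hFY j) p hp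
      · exact hY _ (hFY j) q (hsub q)
    · have hip : i = p := by
        by_contra hne
        exact h (Finset.mem_erase.2 ⟨hne, hi⟩)
      simp only [h, dite_false]
      refine ⟨by rw [hip, div_mul_cancel₀ _ hb], hbound _ fun j q => hY _ (hFY j) q (hsub q)⟩

section

variable {ι : Type*} {k l : ℕ} {col : ι → Bool} {s : Finset ι}

theorem logVal_sub (E F : ι → ℤ) (i : ι) :
    logVal k l col (E - F) i = logVal k l col E i - logVal k l col F i := by
  simp only [logVal, Pi.sub_apply]; push_cast; ring

theorem powVal_sub (hk : 2 ≤ k) (hl : 2 ≤ l) (E F : ι → ℤ) (i : ι) :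
    powVal k l col (E - F) i = powVal k l col E i / powVal k l col F i := by
  have := two_le_powBase (col := col) hk hl i
  simp only [powVal, Pi.sub_apply]
  rw [zpow_sub₀ (by positivity)]

/-- The exponents in `B` differ only slightly from each other. -/
def IsClose (k l : ℕ) (col : ι → Bool) (s : Finset ι) (j : ι) (η : ℝ) (B : Set (ι → ℤ)) : Prop :=
  ∀ E ∈ B, ∀ F ∈ B, (∀ p ∈ s, ∀ q ∈ s, logVal k l col (F - E) p - logVal k l col (F - E) q ≤ η) ∧
    sizeConst k l * |((F - E) j : ℝ)| ≤ η

theorem IsClose.hasCover_of_lt_log_two (hk : 2 ≤ k) (hl : 2 ≤ l) {B : Set (ι → ℤ)} {i j : ι} {η : ℝ}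
    (hB : IsClose k l col s j η B) (hi : i ∈ s) (hj : j ∈ s) (hci : col i = true)
    (hcj : col j = false) (hs : 3 ≤ s.card) (hη : 5 * η < Real.log 2) :
    HasCover k l col s B 1 := by
  classical
  have hij : i ≠ j := by rintro rfl; rw [hci] at hcj; cases hcj
  obtain ⟨p, hp, hpi, hpj⟩ : ∃ p ∈ s, p ≠ i ∧ p ≠ j := by
    by_contra! h
    have h1 : s ⊆ {i, j} := fun p hp => by
      by_cases hpi : p = i
      · simp [hpi]
      · simp [h p hp hpi]
    have := (Finset.card_le_card h1).trans Finset.card_le_two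
    omega
  refine HasCover.of_forall fun E hE => ?_
  have hvi := powVal_pos (col := col) hk hl E i
  have hvj := powVal_pos (col := col) hk hl E j
  refine ⟨fun q => if q = i then (powVal k l col E i)⁻¹ else
    if q = j then -(powVal k l col E j)⁻¹ else 0, ⟨i, hi, by simp [hvi.ne']⟩,
    ⟨p, hp, by simp [hpi, hpj]⟩, fun F hF => ?_⟩
  obtain ⟨r, hr, y, hy⟩ := exists_int_proportional hk hl (hB E hE F hF).1 hi hj hci hcj
    (by exact_mod_cast (hB E hE F hF).2)
  have hy1 : ∀ q ∈ s, y q = 1 := fun q hq => by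
    obtain ⟨-, h1, h2⟩ := hy q hq
    have h3 : (y q : ℝ) < 2 := h2.trans_lt (by
      rwa [← Real.lt_log_iff_exp_lt (by norm_num)])
    have h4 : y q < 2 := by exact_mod_cast h3
    omega
  have h1 := (hy i hi).1
  have h2 := (hy j hj).1
  rw [hy1 i hi, powVal_sub hk hl] at h1
  rw [hy1 j hj, powVal_sub hk hl] at h2
  have h3 : powVal k l col F i / powVal k l col E i = powVal k l col F j / powVal k l col E j :=
    mul_left_cancel₀ hr.ne' (h1.trans h2.symm)
  have h4 : ∀ q ∈ s, (if q = i then (powVal k l col E i)⁻¹ else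
      if q = j then -(powVal k l col E j)⁻¹ else 0) * powVal k l col F q =
      (if q = i then powVal k l col F i / powVal k l col E i else 0) -
        (if q = j then powVal k l col F j / powVal k l col E j else 0) := by
    intro q hq
    by_cases hqi : q = i
    · subst hqi; simp [hij]; field_simp
    · by_cases hqj : q = j
      · subst hqj; simp [hqi]; field_simp
      · simp [hqi, hqj]
  rw [Finset.sum_congr rfl h4, Finset.sum_sub_distrib]
  simp [hi, hj, h3]

theorem IsClose.hasCover_of_minimal (hk : 2 ≤ k) (hl : 2 ≤ l) {z : ι → ℤ} (hz : ∀ i ∈ s, z i ≠ 0)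
    {B : Set (ι → ℤ)} {i j : ι} {η W : ℝ}
    (hB : IsClose k l col s j η B) (hBz : B ⊆ nondegSol k l col (fun i => z i) s)
    (hi : i ∈ s) (hj : j ∈ s) (hci : col i = true) (hcj : col j = false)
    (hW : ∀ E ∈ nondegSol k l col (fun i => z i) s, ∀ r : ℚ, r ≠ 0 → ∀ w : ι → ℤ, ∀ W' : ℤ,
      (∀ i ∈ s, r * (z i * powVal k l col E i) = w i ∧ |w i| ≤ W') → W ≤ W')
    (hη : (s.card - 1).factorial * Real.exp (5 * η) ^ (s.card - 1) < W) :
    HasCover k l col s B 1 := by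
  refine HasCover.of_forall fun E hE => ?_
  set X : ℤ := ⌊Real.exp (5 * η)⌋ with hX
  have hv := powVal_pos (col := col) hk hl E
  have hprop : ∀ F ∈ B, ∃ r : ℚ, 0 < r ∧ ∃ y : ι → ℤ, ∀ p ∈ s,
      r * powVal k l col (F - E) p = y p ∧ 0 < y p ∧ (y p : ℝ) ≤ Real.exp (5 * η) := fun F hF =>
    exists_int_proportional hk hl (hB E hE F hF).1 hi hj hci hcj
      (by exact_mod_cast (hB E hE F hF).2)
  have hYb : ∀ y ∈ {y : ι → ℤ | (∀ p ∈ s, |y p| ≤ X) ∧ ∃ F ∈ B, ∃ r : ℚ, 0 < r ∧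
      ∀ p ∈ s, r * powVal k l col (F - E) p = y p},
      ∑ p ∈ s, (z p * powVal k l col E p) * (y p : ℚ) = 0 := by
    rintro y ⟨-, F, hF, r, hr, hy⟩
    have h1 := (hBz hF).2.1
    rw [← mul_zero r, ← h1, Finset.mul_sum]
    refine Finset.sum_congr rfl fun p hp => ?_
    rw [← hy p hp, powVal_sub hk hl]
    have := (hv p).ne'
    field_simp
  rcases exists_hyperplane_or_proportional hi
    (mul_ne_zero (by exact_mod_cast hz i hi) (hv i).ne') (fun y hy => hy.1) hYb with
    ⟨d, hd0, ⟨q, hq, hdq⟩, hd⟩ | ⟨r, hr, w, hw⟩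
  · refine ⟨fun p => d p / powVal k l col E p, ⟨q, hq, div_ne_zero hdq (hv q).ne'⟩,
      ⟨i, hi, by simp [hd0]⟩, fun F hF => ?_⟩
    obtain ⟨r, hr, y, hy⟩ := hprop F hF
    have h1 := hd y ⟨fun p hp => by
      rw [abs_of_pos (hy p hp).2.1]; exact Int.le_floor.2 (hy p hp).2.2,
      F, hF, r, hr, fun p hp => (hy p hp).1⟩
    refine mul_left_cancel₀ hr.ne' ?_
    rw [mul_zero, ← h1, Finset.mul_sum]
    refine Finset.sum_congr rfl fun p hp => ?_
    rw [← (hy p hp).1, powVal_sub hk hl]; ring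
  · exfalso
    have h1 := hW E (hBz hE) r hr w _ hw
    refine absurd hη (not_lt.2 (h1.trans ?_))
    push_cast
    refine mul_le_mul_of_nonneg_left (pow_le_pow_left₀ ?_ (Int.floor_le _) _) (by positivity)
    exact_mod_cast Int.floor_nonneg.2 (Real.exp_pos _).le

theorem hasCover_spread_le (hk : 2 ≤ k) (hl : 2 ≤ l) {z : ι → ℤ}
    {D : ℝ} (hD : 0 < D) (hw : ∀ i ∈ s, |(z i : ℝ)| ≤ Real.exp D) (hN : Real.log s.card ≤ D)
    {i j : ι} (hi : i ∈ s) (hj : j ∈ s) (hci : col i = true) (hcj : col j = false)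
    (hs : 3 ≤ s.card)
    (h : ∀ B ⊆ nondegSol k l col (fun i => z i) s,
      IsClose k l col s j (D / (16 * s.card ^ 2)) B → HasCover k l col s B 1) :
    HasCover k l col s {E | E ∈ nondegSol k l col (fun i => z i) s ∧
      ∃ V, IsSpread k l col s E V ∧ V ≤ 2 ^ (10 * s.card + 1) * D} (2 ^ (16 * s.card ^ 2)) := by
  classical
  set N := s.card with hNdef
  have hij : i ≠ j := by rintro rfl; rw [hci] at hcj; cases hcj
  have hN0 : (0 : ℝ) < N := by exact_mod_cast (show 0 < N by omega)
  set δ : ℝ := D / (48 * N ^ 2) with hδ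
  have hδ0 : 0 < δ := by positivity
  set P : ℤ := 768 * 2 ^ (10 * N + 1) * N ^ 2 with hP
  have hPδ : (P : ℝ) * δ = 16 * (2 ^ (10 * N + 1) * D) := by
    rw [hP, hδ]; push_cast; field_simp; norm_num
  let X : (ι → ℤ) → ι → ℝ := fun E p =>
    if p = i then logVal k l col E i - logVal k l col E j else
      if p = j then sizeConst k l * E j else
        logVal k l col E p - logVal k l col E (if col p then i else j)
  let T : Finset ((p : ι) → p ∈ s → ℤ) := s.pi fun _ => Finset.Icc (-P) P
  let B : ((p : ι) → p ∈ s → ℤ) → Set (ι → ℤ) := fun b =>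
    {E | E ∈ nondegSol k l col (fun i => z i) s ∧ ∀ p (hp : p ∈ s), ⌊X E p / δ⌋ = b p hp}
  have hT : T.card ≤ 2 ^ (16 * N ^ 2) := by
    have hP0 : 0 ≤ P := by positivity
    have h1 : (Finset.Icc (-P) P).card ≤ 2 ^ (12 * N + 12) := by
      rw [Int.card_Icc, Int.toNat_le]
      have h2 : (N : ℤ) ≤ 2 ^ N := by exact_mod_cast Nat.lt_two_pow_self.le
      have h3 : (N : ℤ) ^ 2 ≤ (2 ^ N) ^ 2 := pow_le_pow_left₀ (by positivity) h2 2
      have h4 : P ≤ 768 * 2 ^ (10 * N + 1) * (2 ^ N) ^ 2 :=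
        mul_le_mul_of_nonneg_left h3 (by positivity)
      have h5 : (768 : ℤ) * 2 ^ (10 * N + 1) * (2 ^ N) ^ 2 = 1536 * 2 ^ (12 * N) := by
        rw [← pow_mul, show 12 * N = 10 * N + N * 2 by ring, pow_add, pow_add]; ring
      have h6 : (1 : ℤ) ≤ 2 ^ (12 * N) := one_le_pow₀ (by norm_num)
      push_cast
      rw [pow_add]
      linarith
    simp only [T, Finset.card_pi, Finset.prod_const]
    calc (Finset.Icc (-P) P).card ^ N ≤ (2 ^ (12 * N + 12)) ^ N := Nat.pow_le_pow_left h1 _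
      _ = 2 ^ ((12 * N + 12) * N) := by rw [pow_mul]
      _ ≤ _ := Nat.pow_le_pow_right (by norm_num) (by nlinarith)
  refine (HasCover.biUnion (B := B) (n := 1) T ?_ ?_).mono subset_rfl (by simpa using hT)
  · rintro E ⟨hE, V, hV, hVl⟩
    refine ⟨fun p _ => ⌊X E p / δ⌋, ?_, hE, fun p hp => rfl⟩
    simp only [T, Finset.mem_pi, Finset.mem_Icc]
    intro p hp
    have hdiff : ∀ p ∈ s, ∀ q ∈ s, |logVal k l col E p - logVal k l col E q| ≤ V :=
      fun p hp q hq => abs_le.2 ⟨by linarith [hV.1 q hq p hp], hV.1 p hp q hq⟩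
    have hone : (1 : ℝ) ≤ 2 ^ (10 * N + 1) := one_le_pow₀ (by norm_num)
    have hDle : D ≤ 2 ^ (10 * N + 1) * D := le_mul_of_one_le_left hD.le hone
    have hX : |X E p| ≤ P * δ := by
      rw [hPδ]
      simp only [X]
      split_ifs with h1 h2 h3
      · linarith [hdiff i hi j hj]
      · have h3 := size_le_of_mem_nondegSol hk hl hE hw hV.1 hi hj hci hcj
        rw [abs_mul, abs_of_nonneg (sizeConst_nonneg k l)]
        linarith
      · linarith [hdiff p hp i hi]
      · linarith [hdiff p hp j hj]
    have habs : |X E p / δ| ≤ P := by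
      rwa [abs_div, abs_of_pos hδ0, div_le_iff₀ hδ0]
    rw [abs_le] at habs
    refine ⟨Int.le_floor.2 (by push_cast; linarith), ?_⟩
    have := (Int.floor_le (X E p / δ)).trans habs.2
    exact_mod_cast this
  · intro b hb
    refine h _ (fun E hE => hE.1) fun E hE F hF => ?_
    have hη : D / (16 * N ^ 2) = 3 * δ := by rw [hδ]; field_simp; norm_num
    have hXX : ∀ p ∈ s, |X F p - X E p| ≤ δ := fun p hp => by
      have h1 := Int.abs_sub_lt_one_of_floor_eq_floor ((hF.2 p hp).trans (hE.2 p hp).symm)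
      rw [← sub_div, abs_div, abs_of_pos hδ0, div_lt_one hδ0] at h1
      exact h1.le
    set L := logVal k l col (F - E) with hL
    have hLsub : ∀ p, L p = logVal k l col F p - logVal k l col E p := logVal_sub F E
    have h1 : |L i - L j| ≤ δ := by
      have h2 := hXX i hi
      simp only [X, if_true] at h2
      rw [hLsub, hLsub, sub_sub_sub_comm]; exact h2
    have h2 : ∀ p ∈ s, |L p - L (if col p then i else j)| ≤ δ := fun p hp => by
      by_cases hpi : p = i
      · subst hpi; simpa [hci] using hδ0.le
      by_cases hpj : p = j
      · subst hpj; simpa [hcj] using hδ0.le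
      have h3 := hXX p hp
      simp only [X, if_neg hpi, if_neg hpj] at h3
      rw [hLsub, hLsub, sub_sub_sub_comm]; exact h3
    have h3 : sizeConst k l * |((F - E) j : ℝ)| ≤ δ := by
      have h4 := hXX j hj
      simp only [X, if_neg hij.symm, if_true] at h4
      rw [← mul_sub, abs_mul, abs_of_nonneg (sizeConst_nonneg k l)] at h4
      simpa using h4
    rw [hη]
    refine ⟨fun p hp q hq => ?_, by linarith⟩
    have hp' := abs_le.1 (h2 p hp)
    have hq' := abs_le.1 (h2 q hq)
    have h1' := abs_le.1 h1
    split_ifs at hp' hq' <;> linarith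

theorem factorial_mul_exp_pow_lt {N : ℕ} (hN : 3 ≤ N) {D : ℝ} (hD : 2 * (N : ℝ) ^ 2 ≤ D) :
    ((N - 1).factorial : ℝ) * Real.exp (5 * (D / (16 * N ^ 2))) ^ (N - 1) < Real.exp D := by
  have hN' : (3 : ℝ) ≤ N := by exact_mod_cast hN
  have hD0 : 0 < D := lt_of_lt_of_le (by positivity) hD
  have h1 : ((N - 1).factorial : ℝ) ≤ Real.exp (N ^ 2) := by
    have h2 : ((N - 1).factorial : ℝ) ≤ (N : ℝ) ^ N := by
      have h3 := Nat.factorial_le_pow N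
      have h4 := Nat.factorial_le (Nat.sub_le N 1)
      exact_mod_cast h4.trans h3
    have h3 : (N : ℝ) ≤ Real.exp N := by linarith [Real.add_one_le_exp (N : ℝ)]
    calc ((N - 1).factorial : ℝ) ≤ (N : ℝ) ^ N := h2
      _ ≤ Real.exp N ^ N := pow_le_pow_left₀ (by linarith) h3 _
      _ = Real.exp (N ^ 2) := by rw [← Real.exp_nat_mul, sq]
  have h2 : Real.exp (5 * (D / (16 * N ^ 2))) ^ (N - 1) ≤ Real.exp (5 * D / 48) := by
    rw [← Real.exp_nat_mul, Real.exp_le_exp]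
    have h3 : ((N - 1 : ℕ) : ℝ) ≤ N := by exact_mod_cast Nat.sub_le N 1
    calc ((N - 1 : ℕ) : ℝ) * (5 * (D / (16 * N ^ 2))) ≤ N * (5 * (D / (16 * N ^ 2))) :=
          mul_le_mul_of_nonneg_right h3 (by positivity)
      _ = 5 * D / (16 * N) := by field_simp
      _ ≤ 5 * D / 48 := by
          refine div_le_div_of_nonneg_left (by positivity) (by norm_num) (by linarith)
  calc ((N - 1).factorial : ℝ) * Real.exp (5 * (D / (16 * N ^ 2))) ^ (N - 1)
      ≤ Real.exp (N ^ 2) * Real.exp (5 * D / 48) :=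
        mul_le_mul h1 h2 (by positivity) (Real.exp_pos _).le
    _ < Real.exp D := by
        rw [← Real.exp_add, Real.exp_lt_exp]
        linarith

theorem hasCover_of_minimal (hk : 2 ≤ k) (hl : 2 ≤ l) {z : ι → ℤ} (hz : ∀ i ∈ s, z i ≠ 0)
    {i j : ι} (hi : i ∈ s) (hj : j ∈ s) (hci : col i = true) (hcj : col j = false)
    (hs : 3 ≤ s.card) {W : ℤ} (hzW : ∀ i ∈ s, |z i| ≤ W)
    (hW : ∀ E ∈ nondegSol k l col (fun i => z i) s, ∀ r : ℚ, r ≠ 0 → ∀ w : ι → ℤ, ∀ W' : ℤ,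
      (∀ i ∈ s, r * (z i * powVal k l col E i) = w i ∧ |w i| ≤ W') → W ≤ W') :
    HasCover k l col s (nondegSol k l col (fun i => z i) s) (2 ^ (16 * s.card ^ 2 + 1)) := by
  set N := s.card with hNdef
  have hN : (3 : ℝ) ≤ N := by exact_mod_cast hs
  have hW0 : 0 < W := lt_of_lt_of_le (abs_pos.2 (hz i hi)) (hzW i hi)
  have hW0' : (0 : ℝ) < W := by exact_mod_cast hW0
  set D := max (Real.log W) (2 * N ^ 2) with hD
  have hD2 : 2 * (N : ℝ) ^ 2 ≤ D := le_max_right _ _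
  have hD18 : 18 ≤ D := by nlinarith
  have hw : ∀ i ∈ s, |(z i : ℝ)| ≤ Real.exp D := fun i hi => by
    have h1 : |(z i : ℝ)| ≤ W := by exact_mod_cast hzW i hi
    exact h1.trans ((Real.log_le_iff_le_exp hW0').1 (le_max_left _ _))
  have hlogN : Real.log s.card ≤ D := by
    have := Real.log_le_self (show (0 : ℝ) ≤ N by linarith)
    nlinarith
  have hlarge := hasCover_spreadGe (col := col) hk hl hz (by linarith) hw hlogN hs
  have hsmall := hasCover_spread_le (col := col) hk hl (by linarith) hw hlogN hi hj hci hcj hs (by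
    intro B hB hclose
    rcases le_total (Real.log W) (2 * N ^ 2) with h | h
    · refine hclose.hasCover_of_lt_log_two hk hl hi hj hci hcj hs ?_
      rw [hD, max_eq_right h]
      have : 5 * (2 * (N : ℝ) ^ 2 / (16 * N ^ 2)) = 5 / 8 := by field_simp; norm_num
      rw [← hNdef, this]
      linarith [Real.log_two_gt_d9]
    · refine hclose.hasCover_of_minimal (W := W) hk hl hz hB hi hj hci hcj (fun E hE r hr w W' h =>
        by exact_mod_cast hW E hE r hr w W' h) ?_
      have h1 := factorial_mul_exp_pow_lt hs hD2
      have h2 : Real.exp D = W := by rw [hD, max_eq_left h, Real.exp_log hW0']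
      rwa [h2] at h1)
  refine (hlarge.union hsmall).mono (fun E hE => ?_) (by rw [pow_succ]; omega)
  obtain ⟨V, hV⟩ := exists_isSpread (k := k) (l := l) (col := col) ⟨i, hi⟩ E
  rcases le_total (2 ^ (10 * N + 1) * D) V with h | h
  · exact Or.inl ⟨hE, V, hV, h⟩
  · exact Or.inr ⟨hE, V, hV, h⟩

theorem nondegSol_sub (hk : 2 ≤ k) (hl : 2 ≤ l) {a : ι → ℚ} {z : ι → ℤ} {E₀ : ι → ℤ} {r : ℚ}
    (hr : r ≠ 0) (hz : ∀ i ∈ s, r * (a i * powVal k l col E₀ i) = z i) (hE₀ : ∀ i ∉ s, E₀ i = 0)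
    (E : ι → ℤ) : E ∈ nondegSol k l col a s ↔ E - E₀ ∈ nondegSol k l col (fun i => z i) s := by
  have hsum : ∀ t ⊆ s, ∑ i ∈ t, (z i : ℚ) * powVal k l col (E - E₀) i =
      r * ∑ i ∈ t, a i * powVal k l col E i := fun t ht => by
    rw [Finset.mul_sum]
    refine Finset.sum_congr rfl fun i hi => ?_
    have := (powVal_pos (col := col) hk hl E₀ i).ne'
    rw [← hz i (ht hi), powVal_sub hk hl]
    field_simp
  refine and_congr (forall₂_congr fun i hi => by simp [hE₀ i hi]) (and_congr ?_
    (forall₃_congr fun t ht _ => ?_))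
  · rw [hsum s subset_rfl]; simp [hr]
  · rw [hsum t ht.subset]; simp [hr]

theorem exists_int_eq_mul (s : Finset ι) (b : ι → ℚ) :
    ∃ r : ℚ, r ≠ 0 ∧ ∃ z : ι → ℤ, ∀ i ∈ s, r * b i = z i := by
  classical
  refine ⟨((∏ i ∈ s, (b i).den : ℕ) : ℚ), ?_, fun i => (b i).num * ∏ j ∈ s.erase i, (b j).den, ?_⟩
  · exact_mod_cast Finset.prod_ne_zero_iff.2 fun i _ => (b i).den_ne_zero
  · intro i hi
    rw [← Finset.mul_prod_erase s _ hi]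
    push_cast
    rw [← Rat.mul_den_eq_num (b i)]
    ring

/-- The nondegenerate solutions lie on few hyperplanes. -/
theorem hasCover_nondegSol (hk : 2 ≤ k) (hl : 2 ≤ l) {a : ι → ℚ} (ha : ∀ i ∈ s, a i ≠ 0)
    {i j : ι} (hi : i ∈ s) (hj : j ∈ s) (hci : col i = true) (hcj : col j = false)
    (hs : 3 ≤ s.card) :
    HasCover k l col s (nondegSol k l col a s) (2 ^ (16 * s.card ^ 2 + 1)) := by
  classical
  rcases (nondegSol k l col a s).eq_empty_or_nonempty with h | ⟨E₁, hE₁⟩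
  · rw [h]; exact hasCover_empty.mono subset_rfl (Nat.zero_le _)
  let Q : ℕ → Prop := fun W => ∃ E ∈ nondegSol k l col a s, ∃ r : ℚ, r ≠ 0 ∧ ∃ z : ι → ℤ,
    ∀ i ∈ s, r * (a i * powVal k l col E i) = z i ∧ |z i| ≤ W
  have hQ : ∃ W, Q W := by
    obtain ⟨r, hr, z, hz⟩ := exists_int_eq_mul s fun i => a i * powVal k l col E₁ i
    refine ⟨∑ i ∈ s, (z i).natAbs, E₁, hE₁, r, hr, z, fun i hi => ⟨hz i hi, ?_⟩⟩
    rw [Int.abs_eq_natAbs]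
    exact_mod_cast Finset.single_le_sum (f := fun i => (z i).natAbs) (fun _ _ => Nat.zero_le _) hi
  obtain ⟨E₀, hE₀, r, hr, z, hz⟩ := Nat.find_spec hQ
  have hv := powVal_pos (col := col) hk hl E₀
  have hz0 : ∀ i ∈ s, z i ≠ 0 := fun i hi h => by
    have h1 := (hz i hi).1
    rw [h, Int.cast_zero] at h1
    exact mul_ne_zero hr (mul_ne_zero (ha i hi) (hv i).ne') h1
  have hsub := nondegSol_sub (col := col) hk hl hr (fun i hi => (hz i hi).1) hE₀.1
  obtain ⟨H, hH, hH'⟩ := hasCover_of_minimal (col := col) hk hl hz0 hi hj hci hcj hs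
    (fun i hi => (hz i hi).2) (by
      intro E hE r' hr' w W' hw
      have hW' : 0 ≤ W' := (abs_nonneg _).trans (hw i hi).2
      have h1 : Q W'.toNat := by
        refine ⟨E + E₀, (hsub _).2 (by simpa using hE), r' * r, mul_ne_zero hr' hr, w,
          fun i hi => ⟨?_, ?_⟩⟩
        · rw [← (hw i hi).1, ← (hz i hi).1]
          have h2 := powVal_sub (col := col) hk hl (E + E₀) E₀ i
          rw [add_sub_cancel_right, eq_div_iff (hv i).ne'] at h2
          rw [← h2]; ring
        · rw [Int.toNat_of_nonneg hW']; exact (hw i hi).2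
      have h2 := Nat.find_min' hQ h1
      rw [← Int.toNat_of_nonneg hW']
      exact_mod_cast h2)
  refine ⟨H.image fun d i => d i / powVal k l col E₀ i, Finset.card_image_le.trans hH,
    fun E hE => ?_⟩
  obtain ⟨d, hd, ⟨p, hp, hdp⟩, ⟨q, hq, hdq⟩, hsum⟩ := hH' _ ((hsub E).1 hE)
  refine ⟨_, Finset.mem_image_of_mem _ hd, ⟨p, hp, div_ne_zero hdp (hv p).ne'⟩,
    ⟨q, hq, by simp [hdq]⟩, ?_⟩
  rw [← hsum]
  refine Finset.sum_congr rfl fun i _ => ?_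
  rw [powVal_sub hk hl]; ring

end

theorem Set.encard_le_of_forall_exists_mem {α β : Type*} {A : Set α} (t : Finset β) (F : β → Set α)
    {n q : ℕ} (ht : t.card ≤ n) (hA : ∀ x ∈ A, ∃ y ∈ t, x ∈ F y)
    (hF : ∀ y ∈ t, (F y).encard ≤ q) : A.encard ≤ (n * q : ℕ) := by
  classical
  have key : ∀ u : Finset β, u ⊆ t → (⋃ y ∈ u, F y).encard ≤ (u.card * q : ℕ) := by
    intro u
    induction u using Finset.induction_on with
    | empty => simp
    | insert y u hy ih =>
      intro hu
      rw [Finset.set_biUnion_insert, Finset.card_insert_of_notMem hy, add_mul, one_mul, add_comm]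
      refine (Set.encard_union_le _ _).trans ?_
      push_cast
      refine add_le_add (hF y (hu (Finset.mem_insert_self y u))) ?_
      exact_mod_cast ih ((Finset.subset_insert y u).trans hu)
  have hsub : A ⊆ ⋃ y ∈ t, F y := fun x hx => by
    obtain ⟨y, hy, h⟩ := hA x hx
    exact Set.mem_biUnion hy h
  refine (Set.encard_le_encard hsub).trans ((key t subset_rfl).trans ?_)
  exact_mod_cast Nat.mul_le_mul_right q ht

theorem Set.encard_le_mul_of_fiber_le {α β : Type*} {A : Set α} {B : Set β} (f : α → β) {p q : ℕ}
    (hf : ∀ x ∈ A, f x ∈ B) (hB : B.encard ≤ p)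
    (hq : ∀ y ∈ B, {x ∈ A | f x = y}.encard ≤ q) : A.encard ≤ (p * q : ℕ) := by
  have hfin : B.Finite := Set.finite_of_encard_le_coe hB
  refine Set.encard_le_of_forall_exists_mem hfin.toFinset (fun y => {x ∈ A | f x = y}) ?_
    (fun x hx => ⟨f x, hfin.mem_toFinset.2 (hf x hx), hx, rfl⟩)
    (fun y hy => hq y (hfin.mem_toFinset.1 hy))
  rw [hfin.encard_eq_coe_toFinset_card] at hB
  exact_mod_cast hB

theorem Finset.exists_minimal_sum_eq_zero {ι : Type*} {f : ι → ℚ} {s : Finset ι}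
    (hs : s.Nonempty) (h : ∑ i ∈ s, f i = 0) :
    ∃ I ⊆ s, I.Nonempty ∧ ∑ i ∈ I, f i = 0 ∧ ∀ t ⊂ I, t.Nonempty → ∑ i ∈ t, f i ≠ 0 := by
  induction s using Finset.strongInduction with
  | H s ih =>
    by_cases hc : ∃ t ⊂ s, t.Nonempty ∧ ∑ i ∈ t, f i = 0
    · obtain ⟨t, hts, ht, h0⟩ := hc
      obtain ⟨I, hI, h'⟩ := ih t hts ht h0
      exact ⟨I, hI.trans hts.subset, h'⟩
    · push Not at hc
      exact ⟨s, subset_rfl, hs, h, hc⟩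

theorem powVal_congr {ι : Type*} {k l : ℕ} {col : ι → Bool} {E F : ι → ℤ} {i : ι}
    (h : E i = F i) : powVal k l col E i = powVal k l col F i := by
  unfold powVal; rw [h]

section

variable {ι : Type*} [DecidableEq ι] {k l : ℕ} {col : ι → Bool} {s I : Finset ι} {a : ι → ℚ}

/-- Replacing the terms indexed by `I` by a single term preserves nondegeneracy. -/
theorem mem_nondegSol_of_collapse {E F : ι → ℤ} {a' : ι → ℚ} {i₀ : ι}
    (hE : E ∈ nondegSol k l col a s) (hI : I ⊆ s) (hi₀ : i₀ ∈ I)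
    (hF : ∀ i ∈ s \ I, F i = E i) (hF0 : ∀ i ∉ insert i₀ (s \ I), F i = 0)
    (ha' : ∀ i ∈ s \ I, a' i = a i)
    (h0 : a' i₀ * powVal k l col F i₀ = ∑ i ∈ I, a i * powVal k l col E i) :
    F ∈ nondegSol k l col a' (insert i₀ (s \ I)) := by
  have hterm : ∀ t ⊆ s \ I, ∑ i ∈ t, a' i * powVal k l col F i =
      ∑ i ∈ t, a i * powVal k l col E i := fun t ht =>
    Finset.sum_congr rfl fun i hi => by rw [ha' i (ht hi), powVal_congr (hF i (ht hi))]
  have hi₀' : i₀ ∉ s \ I := fun h => (Finset.mem_sdiff.1 h).2 hi₀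
  have hins : ∀ t ⊆ s \ I, ∑ i ∈ insert i₀ t, a' i * powVal k l col F i =
      ∑ i ∈ I ∪ t, a i * powVal k l col E i := fun t ht => by
    rw [Finset.sum_insert (fun h => hi₀' (ht h)), h0, hterm t ht, Finset.sum_union]
    exact Finset.disjoint_left.2 fun i hi hit => (Finset.mem_sdiff.1 (ht hit)).2 hi
  refine ⟨hF0, ?_, fun t ht htne => ?_⟩
  · rw [hins _ subset_rfl, Finset.union_sdiff_of_subset hI]
    exact hE.2.1
  · by_cases h : i₀ ∈ t
    · have hsub : t.erase i₀ ⊆ s \ I := by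
        exact fun i hi =>
          (Finset.mem_insert.1 (ht.subset (Finset.mem_of_mem_erase hi))).resolve_left
            (Finset.ne_of_mem_erase hi)
      rw [← Finset.insert_erase h, hins _ hsub]
      refine hE.2.2 _ ?_ ⟨i₀, Finset.mem_union_left _ hi₀⟩
      refine (Finset.ssubset_iff_of_subset
        (Finset.union_subset hI (hsub.trans Finset.sdiff_subset))).2 ?_
      obtain ⟨j, hj, hjt⟩ := Finset.exists_of_ssubset ht
      have hj0 : j ≠ i₀ := fun h' => hjt (h' ▸ h)
      have hj' := Finset.mem_sdiff.1 ((Finset.mem_insert.1 hj).resolve_left hj0)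
      refine ⟨j, hj'.1, fun h' => ?_⟩
      rcases Finset.mem_union.1 h' with h' | h'
      · exact hj'.2 h'
      · exact hjt (Finset.mem_of_mem_erase h')
    · have hsub : t ⊆ s \ I := fun i hi =>
        (Finset.mem_insert.1 (ht.subset hi)).resolve_left fun h' => h (h' ▸ hi)
      rw [hterm t hsub]
      refine hE.2.2 _ ((Finset.ssubset_iff_of_subset (hsub.trans Finset.sdiff_subset)).2
        ⟨i₀, hI hi₀, h⟩) htne

/-- Solutions are counted by first counting their restrictions to `I`, up to a common shift of the
exponents, and then counting the ways to complete such a restriction. -/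
theorem encard_le_mul_of_restrict {d : ι → ℚ} {A : Set (ι → ℤ)} {i₀ : ι} {p q : ℕ}
    (e : (ι → ℤ) → ℤ) (hA : A ⊆ nondegSol k l col a s) (hI : I ⊂ s) (hi₀ : i₀ ∈ I)
    (he : ∀ E ∈ A, ∀ i ∈ I, powVal k l col E i =
      powVal k l col (fun j => E j - e E) i * (powBase k l col i₀ : ℚ) ^ e E)
    (hd : ∀ E ∈ A, (fun i => if i ∈ I then E i - e E else 0) ∈ nondegSol k l col d I)
    (hp : {F ∈ nondegSol k l col d I | ∃ E ∈ A, F i₀ = E i₀ - e E}.encard ≤ p)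
    (hq : ∀ c : ℚ, c ≠ 0 → {F ∈ nondegSol k l col (Function.update a i₀ c) (insert i₀ (s \ I)) |
      ∃ E ∈ A, F i₀ = e E}.encard ≤ q) :
    A.encard ≤ (p * q : ℕ) := by
  have hi₀s : i₀ ∉ s \ I := fun h => (Finset.mem_sdiff.1 h).2 hi₀
  refine Set.encard_le_mul_of_fiber_le
    (B := {F ∈ nondegSol k l col d I | ∃ E ∈ A, F i₀ = E i₀ - e E})
    (fun E i => if i ∈ I then E i - e E else 0)
    (fun E hE => ⟨hd E hE, E, hE, by simp [hi₀]⟩) hp fun y _ => ?_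
  rcases Set.eq_empty_or_nonempty {E ∈ A | (fun i => if i ∈ I then E i - e E else 0) = y}
    with h | ⟨E₀, hE₀, hE₀y⟩
  · rw [h]; simp
  have hy : ∀ E ∈ A, (fun i => if i ∈ I then E i - e E else 0) = y → ∀ i ∈ I, E i = y i + e E := by
    intro E _ hE i hi
    have := congrFun hE i
    simp only [hi, if_true] at this
    omega
  set c := ∑ i ∈ I, a i * powVal k l col y i with hc
  have hsum : ∀ E ∈ A, (fun i => if i ∈ I then E i - e E else 0) = y →
      c * (powBase k l col i₀ : ℚ) ^ e E = ∑ i ∈ I, a i * powVal k l col E i := by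
    intro E hEA hE
    rw [hc, Finset.sum_mul]
    refine Finset.sum_congr rfl fun i hi => ?_
    rw [he E hEA i hi, mul_assoc,
      powVal_congr (F := fun j => E j - e E) (by have := hy E hEA hE i hi; simp [this])]
  have hc0 : c ≠ 0 := by
    intro h0
    refine (hA hE₀).2.2 I hI ⟨i₀, hi₀⟩ ?_
    rw [← hsum E₀ hE₀ hE₀y, h0, zero_mul]
  refine le_trans (Set.encard_le_encard_of_injOn
    (f := fun E i => if i ∈ s \ I then E i else if i = i₀ then e E else 0) ?_ ?_) (hq c hc0)
  · rintro E ⟨hEA, hE⟩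
    refine ⟨mem_nondegSol_of_collapse (hA hEA) hI.subset hi₀ (fun i hi => if_pos hi) ?_ ?_ ?_,
      E, hEA, by simp [hi₀s]⟩
    · intro i hi
      rw [Finset.mem_insert, not_or] at hi
      simp only [hi.1, hi.2, if_false]
    · intro i hi
      exact Function.update_of_ne (ne_of_mem_of_not_mem hi hi₀s) _ _
    · rw [Function.update_self, ← hsum E hEA hE]
      simp [powVal, hi₀s]
  · rintro E ⟨hEA, hE⟩ F ⟨hFA, hF⟩ hEF
    have heq : e E = e F := by simpa [hi₀s] using congrFun hEF i₀
    funext i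
    by_cases hi : i ∈ I
    · rw [hy E hEA hE i hi, hy F hFA hF i hi, heq]
    by_cases his : i ∈ s
    · have := congrFun hEF i
      simpa [his, hi] using this
    · rw [(hA hEA).1 i his, (hA hFA).1 i his]

/-- If `C` bounds the number of solutions for all mixed colourings of `s`, then `C` bounds the
number of solutions with one exponent equal to `0`, for all colourings. -/
theorem encard_pinned_le {C : ℕ} (hs : 2 ≤ s.card)
    (h : ∀ col : ι → Bool, (∃ i ∈ s, ∃ j ∈ s, col i ≠ col j) →
      (nondegSol k l col a s).encard ≤ C) (col : ι → Bool) {i₀ : ι} (hi₀ : i₀ ∈ s) :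
    {F ∈ nondegSol k l col a s | F i₀ = 0}.encard ≤ C := by
  by_cases hmix : ∃ j ∈ s, col i₀ ≠ col j
  · exact (Set.encard_le_encard (Set.sep_subset _ _)).trans (h col ⟨i₀, hi₀, hmix⟩)
  · push Not at hmix
    obtain ⟨j, hj, hj0⟩ := Finset.exists_mem_ne (show 1 < s.card by omega) i₀
    refine le_trans (Set.encard_le_encard fun F hF => ?_)
      (h (Function.update col i₀ (!col i₀)) ⟨i₀, hi₀, j, hj, ?_⟩)
    · have hval : ∀ i, powVal k l (Function.update col i₀ (!col i₀)) F i = powVal k l col F i := by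
        intro i
        by_cases hi : i = i₀
        · subst hi; simp [powVal, hF.2]
        · simp [powVal, powBase, Function.update_of_ne hi]
      simpa only [nondegSol, Set.mem_ofPred_eq, hval] using hF.1
    · rw [Function.update_self, Function.update_of_ne hj0, ← hmix j hj]
      simp

theorem encard_nondegSol_pair_le_one (hk : 2 ≤ k) (hl : 2 ≤ l) (hkl : MultIndep k l) {i j : ι}
    (hij : i ≠ j) (hi : a i ≠ 0) (hj : a j ≠ 0) (hci : col i = true) (hcj : col j = false) :
    (nondegSol k l col a {i, j}).encard ≤ 1 := by
  rw [Set.encard_le_one_iff]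
  intro E F hE hF
  have hE1 := hE.2.1
  have hF1 := hF.2.1
  rw [Finset.sum_pair hij] at hE1 hF1
  have hEi := powVal_pos (col := col) hk hl E i
  have hEj := powVal_pos (col := col) hk hl E j
  have hFi := powVal_pos (col := col) hk hl F i
  have hFj := powVal_pos (col := col) hk hl F j
  have h1 : powVal k l col (E - F) i = powVal k l col (E - F) j := by
    rw [powVal_sub hk hl, powVal_sub hk hl, div_eq_div_iff hFi.ne' hFj.ne']
    apply mul_left_cancel₀ (mul_ne_zero hi hj)
    linear_combination (a j * powVal k l col F j) * hE1 - (a j * powVal k l col E j) * hF1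
  unfold powVal at h1
  rw [powBase_of_true hci, powBase_of_false hcj] at h1
  have h2 := hkl _ _ h1
  simp only [Pi.sub_apply, sub_eq_zero] at h2
  funext x
  by_cases hxi : x = i
  · rw [hxi, h2.1]
  by_cases hxj : x = j
  · rw [hxj, h2.2]
  have hx : x ∉ ({i, j} : Finset ι) := by simp [hxi, hxj]
  rw [hE.1 x hx, hF.1 x hx]

end

section

variable {ι : Type*} {k l : ℕ} {col : ι → Bool}

theorem powVal_shift (hk : 2 ≤ k) (hl : 2 ≤ l) (E : ι → ℤ) (e : ℤ) {i i₀ : ι}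
    (h : col i = col i₀) : powVal k l col E i =
      powVal k l col (fun j => E j - e) i * (powBase k l col i₀ : ℚ) ^ e := by
  have hb := two_le_powBase (col := col) hk hl i
  have hb0 : (powBase k l col i : ℚ) ≠ 0 := by positivity
  have hbi : powBase k l col i₀ = powBase k l col i := by unfold powBase; rw [h]
  unfold powVal
  rw [hbi, ← zpow_add₀ hb0, sub_add_cancel]

end

section

variable {ι : Type*} [DecidableEq ι] {k l : ℕ} {col : ι → Bool} {s I : Finset ι} {a d : ι → ℚ}

theorem powVal_ite_mem (E : ι → ℤ) {i : ι} (hi : i ∈ I) :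
    powVal k l col (fun i => if i ∈ I then E i else 0) i = powVal k l col E i :=
  powVal_congr (if_pos hi)

theorem restrict_mem_nondegSol {E : ι → ℤ} (h0 : ∑ i ∈ I, d i * powVal k l col E i = 0)
    (hmin : ∀ t ⊂ I, t.Nonempty → ∑ i ∈ t, d i * powVal k l col E i ≠ 0) :
    (fun i => if i ∈ I then E i else 0) ∈ nondegSol k l col d I := by
  have hsum : ∀ t ⊆ I, ∑ i ∈ t, d i * powVal k l col (fun i => if i ∈ I then E i else 0) i =
      ∑ i ∈ t, d i * powVal k l col E i := fun t ht =>
    Finset.sum_congr rfl fun i hi => by rw [powVal_ite_mem E (ht hi)]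
  refine ⟨fun i hi => if_neg hi, by rw [hsum I subset_rfl, h0], fun t ht htne => ?_⟩
  rw [hsum t ht.subset]
  exact hmin t ht htne

theorem shift_mem_nondegSol (hk : 2 ≤ k) (hl : 2 ≤ l) {E : ι → ℤ} {i₀ : ι} (e : ℤ)
    (hcol : ∀ i ∈ I, col i = col i₀)
    (hE : (fun i => if i ∈ I then E i else 0) ∈ nondegSol k l col d I) :
    (fun i => if i ∈ I then E i - e else 0) ∈ nondegSol k l col d I := by
  have hb := two_le_powBase (col := col) hk hl i₀
  have hb0 : (powBase k l col i₀ : ℚ) ^ e ≠ 0 := by positivity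
  have hsum : ∀ t ⊆ I, ∑ i ∈ t, d i * powVal k l col (fun i => if i ∈ I then E i else 0) i =
      (∑ i ∈ t, d i * powVal k l col (fun i => if i ∈ I then E i - e else 0) i) *
        (powBase k l col i₀ : ℚ) ^ e := by
    intro t ht
    rw [Finset.sum_mul]
    refine Finset.sum_congr rfl fun i hi => ?_
    rw [powVal_ite_mem E (ht hi), powVal_ite_mem (fun j => E j - e) (ht hi),
      powVal_shift hk hl E e (hcol i (ht hi)), mul_assoc]
  refine ⟨fun i hi => if_neg hi, ?_, fun t ht htne h0 => ?_⟩
  · have h := hE.2.1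
    rw [hsum I subset_rfl] at h
    exact (mul_eq_zero.1 h).resolve_right hb0
  · refine hE.2.2 t ht htne ?_
    rw [hsum t ht.subset, h0, zero_mul]

theorem exists_hyperplane_restrict (hk : 2 ≤ k) (hl : 2 ≤ l) {E : ι → ℤ}
    (hd : ∃ i ∈ s, d i ≠ 0) (hd0 : ∃ i ∈ s, d i = 0)
    (h : ∑ i ∈ s, d i * powVal k l col E i = 0) :
    ∃ I ⊂ s, 2 ≤ I.card ∧ (∀ i ∈ I, d i ≠ 0) ∧
      (fun i => if i ∈ I then E i else 0) ∈ nondegSol k l col d I := by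
  obtain ⟨i, hi, hdi⟩ := hd
  obtain ⟨j, hj, hdj⟩ := hd0
  obtain ⟨I, hI, hIne, hI0, hImin⟩ := Finset.exists_minimal_sum_eq_zero
    (f := fun i => d i * powVal k l col E i) (s := {i ∈ s | d i ≠ 0})
    ⟨i, Finset.mem_filter.2 ⟨hi, hdi⟩⟩ (by
      rw [Finset.sum_filter_of_ne fun i _ h => left_ne_zero_of_mul h]
      exact h)
  have hId : ∀ i ∈ I, d i ≠ 0 := fun i hi => (Finset.mem_filter.1 (hI hi)).2
  refine ⟨I, (Finset.ssubset_iff_of_subset (hI.trans (Finset.filter_subset _ _))).2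
    ⟨j, hj, fun h => hId j h hdj⟩, ?_, hId, restrict_mem_nondegSol hI0 hImin⟩
  by_contra hcard
  have h1 : I.card = 1 := by have := hIne.card_pos; omega
  obtain ⟨x, rfl⟩ := Finset.card_eq_one.1 h1
  rw [Finset.sum_singleton] at hI0
  exact mul_ne_zero (hId x (Finset.mem_singleton_self x)) (powVal_pos hk hl E x).ne' hI0

theorem exponent_split_le {N r : ℕ} (hr : 2 ≤ r) (hrN : r < N) :
    16 * N ^ 2 + 1 + N + (18 * r ^ 3 + 18 * (N - r + 1) ^ 3) ≤ 18 * N ^ 3 := by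
  obtain ⟨u, rfl⟩ := Nat.exists_eq_add_of_le hr
  obtain ⟨v, rfl⟩ := Nat.exists_eq_add_of_lt hrN
  rw [show 2 + u + v + 1 - (2 + u) + 1 = v + 2 by omega]
  ring_nf
  nlinarith [Nat.zero_le (u ^ 2 * v), Nat.zero_le (u * v ^ 2), Nat.zero_le (u * v),
    Nat.zero_le (u ^ 2), Nat.zero_le (v ^ 2)]

/-- The number of nondegenerate solutions is bounded in terms of the number of variables only. -/
theorem encard_nondegSol_le (hk : 2 ≤ k) (hl : 2 ≤ l) (hkl : MultIndep k l)
    (ha : ∀ i ∈ s, a i ≠ 0) (hmix : ∃ i ∈ s, ∃ j ∈ s, col i ≠ col j) :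
    (nondegSol k l col a s).encard ≤ (2 ^ (18 * s.card ^ 3) : ℕ) := by
  induction hN : s.card using Nat.strong_induction_on generalizing s a col with
  | _ N ih =>
  have ih' : ∀ (col : ι → Bool) (I : Finset ι) (d : ι → ℚ), I.card < N → (∀ i ∈ I, d i ≠ 0) →
      (∃ i ∈ I, ∃ j ∈ I, col i ≠ col j) →
      (nondegSol k l col d I).encard ≤ (2 ^ (18 * I.card ^ 3) : ℕ) :=
    fun col I d hI hd hm => ih I.card hI hd hm rfl
  obtain ⟨i, hi, j, hj, hci, hcj⟩ : ∃ i ∈ s, ∃ j ∈ s, col i = true ∧ col j = false := by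
    obtain ⟨i, hi, j, hj, hij⟩ := hmix
    cases hci : col i <;> cases hcj : col j
    · exact absurd (hci.trans hcj.symm) hij
    · exact ⟨j, hj, i, hi, hcj, hci⟩
    · exact ⟨i, hi, j, hj, hci, hcj⟩
    · exact absurd (hci.trans hcj.symm) hij
  have hij : i ≠ j := by rintro rfl; simp [hci] at hcj
  have hpair : {i, j} ⊆ s := by
    intro x hx
    rcases Finset.mem_insert.1 hx with rfl | hx
    · exact hi
    · rwa [Finset.mem_singleton.1 hx]
  rcases Nat.lt_or_ge N 3 with hN3 | hN3
  · have hs : {i, j} = s := Finset.eq_of_subset_of_card_le hpair (by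
      rw [Finset.card_pair hij]; omega)
    rw [← hs]
    refine (encard_nondegSol_pair_le_one hk hl hkl hij (ha i hi) (ha j hj) hci hcj).trans ?_
    exact_mod_cast Nat.one_le_two_pow
  obtain ⟨H, hH, hcov⟩ := hasCover_nondegSol hk hl ha hi hj hci hcj (by omega)
  rw [hN] at hH
  have key : ∀ p ∈ H ×ˢ s.powerset, {E ∈ nondegSol k l col a s | p.2 ⊂ s ∧ 2 ≤ p.2.card ∧
      (∀ i ∈ p.2, p.1 i ≠ 0) ∧
      (fun i => if i ∈ p.2 then E i else 0) ∈ nondegSol k l col p.1 p.2}.encard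
      ≤ (2 ^ (18 * N ^ 3 - (16 * N ^ 2 + 1 + N)) : ℕ) := by
    rintro ⟨d, I⟩ -
    dsimp only
    by_cases hcond : I ⊂ s ∧ 2 ≤ I.card ∧ ∀ i ∈ I, d i ≠ 0
    swap
    · refine le_of_eq_of_le (Set.encard_eq_zero.2 ?_) zero_le
      refine Set.eq_empty_of_forall_notMem fun E hE => hcond ⟨hE.2.1, hE.2.2.1, hE.2.2.2.1⟩
    obtain ⟨hI, hI2, hd⟩ := hcond
    obtain ⟨i₀, hi₀⟩ : I.Nonempty := Finset.card_pos.1 (by omega)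
    have hIN : I.card < N := hN ▸ Finset.card_lt_card hI
    have hcard : (insert i₀ (s \ I)).card = N - I.card + 1 := by
      rw [Finset.card_insert_of_notMem fun h => (Finset.mem_sdiff.1 h).2 hi₀,
        Finset.card_sdiff_of_subset hI.subset, hN]
    have hupd : ∀ c : ℚ, c ≠ 0 → ∀ x ∈ insert i₀ (s \ I), Function.update a i₀ c x ≠ 0 := by
      intro c hc x hx
      by_cases hx0 : x = i₀
      · rw [hx0, Function.update_self]; exact hc
      · rw [Function.update_of_ne hx0]
        exact ha x (Finset.mem_sdiff.1 ((Finset.mem_insert.1 hx).resolve_left hx0)).1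
    have hIcount := fun col => ih' col I d hIN hd
    have hscount := fun c hc col => ih' col (insert i₀ (s \ I)) (Function.update a i₀ c)
      (by omega) (hupd c hc)
    rw [hcard] at hscount
    have hle : (2 ^ (18 * I.card ^ 3) * 2 ^ (18 * (N - I.card + 1) ^ 3) : ℕ) ≤
        2 ^ (18 * N ^ 3 - (16 * N ^ 2 + 1 + N)) := by
      rw [← pow_add]
      refine Nat.pow_le_pow_right (by norm_num) ?_
      have := exponent_split_le hI2 hIN
      omega
    refine le_trans ?_ (Nat.cast_le.2 hle)
    by_cases hImix : ∃ i ∈ I, ∃ j ∈ I, col i ≠ col j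
    · refine encard_le_mul_of_restrict (d := d) (i₀ := i₀) (fun _ => 0) (Set.sep_subset _ _) hI hi₀
        (by simp) (fun E hE => by simpa using hE.2.2.2.2)
        ((Set.encard_le_encard (Set.sep_subset _ _)).trans (hIcount col hImix)) fun c hc => ?_
      refine le_trans (Set.encard_le_encard ?_) (encard_pinned_le (a := Function.update a i₀ c)
        (by omega) (hscount c hc) col (Finset.mem_insert_self i₀ (s \ I)))
      rintro F ⟨hF, -, -, hF0⟩
      exact ⟨hF, hF0⟩
    · push Not at hImix
      have hcol : ∀ i ∈ I, col i = col i₀ := fun i hi => hImix i hi i₀ hi₀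
      refine encard_le_mul_of_restrict (d := d) (i₀ := i₀) (fun E => E i₀) (Set.sep_subset _ _) hI
        hi₀ (fun E _ i hi => powVal_shift hk hl E (E i₀) (hcol i hi))
        (fun E hE => shift_mem_nondegSol hk hl (E i₀) hcol hE.2.2.2.2) ?_ fun c hc => ?_
      · refine le_trans (Set.encard_le_encard ?_) (encard_pinned_le hI2 hIcount col hi₀)
        rintro F ⟨hF, E, -, hF0⟩
        exact ⟨hF, by rw [hF0, sub_self]⟩
      · refine (Set.encard_le_encard (Set.sep_subset _ _)).trans (hscount c hc col ?_)
        have hmem : ∀ x ∈ s, ∃ y ∈ insert i₀ (s \ I), col y = col x := by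
          intro x hx
          by_cases hxI : x ∈ I
          · exact ⟨i₀, Finset.mem_insert_self _ _, (hcol x hxI).symm⟩
          · exact ⟨x, Finset.mem_insert_of_mem (Finset.mem_sdiff.2 ⟨hx, hxI⟩), rfl⟩
        obtain ⟨x, hx, hxi⟩ := hmem i hi
        obtain ⟨y, hy, hyj⟩ := hmem j hj
        exact ⟨x, hx, y, hy, by rw [hxi, hyj, hci, hcj]; simp⟩
  refine (Set.encard_le_of_forall_exists_mem (H ×ˢ s.powerset) _
    (n := 2 ^ (16 * N ^ 2 + 1) * 2 ^ N) ?_ ?_ key).trans ?_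
  · rw [Finset.card_product, Finset.card_powerset, hN]
    exact Nat.mul_le_mul_right _ hH
  · intro E hE
    obtain ⟨d, hdH, hd, hd0, hdE⟩ := hcov E hE
    obtain ⟨I, hI, hI2, hId, hIE⟩ := exists_hyperplane_restrict hk hl hd hd0 hdE
    exact ⟨(d, I), Finset.mem_product.2 ⟨hdH, Finset.mem_powerset.2 hI.subset⟩,
      hE, hI, hI2, hId, hIE⟩
  · rw [← pow_add, ← pow_add]
    have h := exponent_split_le (N := N) le_rfl (by omega)
    rw [show 16 * N ^ 2 + 1 + N + (18 * N ^ 3 - (16 * N ^ 2 + 1 + N)) = 18 * N ^ 3 by omega]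

end

/-- Exponents supported on `s` which give a zero of the linear form `a` on `s` without vanishing
nonempty monochromatic subsums. -/
def splitSol {ι : Type*} (k l : ℕ) (col : ι → Bool) (a : ι → ℚ) (s : Finset ι) : Set (ι → ℤ) :=
  {E | (∀ i ∉ s, E i = 0) ∧ ∑ i ∈ s, a i * powVal k l col E i = 0 ∧
    ∀ t ⊆ s, t.Nonempty → (∀ i ∈ t, ∀ j ∈ t, col i = col j) →
      ∑ i ∈ t, a i * powVal k l col E i ≠ 0}

section

variable {ι : Type*} [DecidableEq ι] {k l : ℕ} {col : ι → Bool} {s : Finset ι} {a : ι → ℚ}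

theorem encard_splitSol_le (hk : 2 ≤ k) (hl : 2 ≤ l) (hkl : MultIndep k l)
    (ha : ∀ i ∈ s, a i ≠ 0) :
    (splitSol k l col a s).encard ≤ (2 ^ (20 * s.card ^ 3) : ℕ) := by
  induction s using Finset.strongInduction with
  | H s ih =>
  rcases s.eq_empty_or_nonempty with rfl | hs
  · have h1 : (splitSol k l col a ∅).encard ≤ 1 := by
      rw [Set.encard_le_one_iff]
      intro E F hE hF
      funext i
      rw [hE.1 i (Finset.notMem_empty i), hF.1 i (Finset.notMem_empty i)]
    simpa using h1
  have key : ∀ I ∈ s.powerset, {E ∈ splitSol k l col a s | I.Nonempty ∧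
      (fun i => if i ∈ I then E i else 0) ∈ nondegSol k l col a I}.encard
      ≤ (2 ^ (20 * s.card ^ 3 - s.card) : ℕ) := by
    intro I hI
    rw [Finset.mem_powerset] at hI
    rcases Set.eq_empty_or_nonempty {E ∈ splitSol k l col a s | I.Nonempty ∧
      (fun i => if i ∈ I then E i else 0) ∈ nondegSol k l col a I} with h | ⟨E₀, hE₀, hIne, hE₀I⟩
    · rw [h]; simp
    have hsum : ∀ E ∈ splitSol k l col a s,
        (fun i => if i ∈ I then E i else 0) ∈ nondegSol k l col a I →
        ∑ i ∈ I, a i * powVal k l col E i = 0 := by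
      intro E _ hE
      rw [← hE.2.1]
      exact Finset.sum_congr rfl fun i hi => by rw [powVal_ite_mem E hi]
    have hmix : ∃ i ∈ I, ∃ j ∈ I, col i ≠ col j := by
      by_contra! hpure
      exact hE₀.2.2 I hI hIne hpure (hsum E₀ hE₀ hE₀I)
    have hsI : s \ I ⊂ s := Finset.sdiff_ssubset hI hIne
    have hle : (2 ^ (18 * I.card ^ 3) * 2 ^ (20 * (s \ I).card ^ 3) : ℕ) ≤
        2 ^ (20 * s.card ^ 3 - s.card) := by
      rw [← pow_add]
      refine Nat.pow_le_pow_right (by norm_num) (Nat.le_sub_of_add_le ?_)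
      rw [← Finset.card_sdiff_add_card_eq_card hI]
      have h1 := hIne.card_pos
      generalize (s \ I).card = v
      obtain ⟨u, hu⟩ := Nat.exists_eq_add_of_le' h1
      rw [hu]
      nlinarith [Nat.zero_le (u ^ 2 * v), Nat.zero_le (u * v ^ 2), Nat.zero_le (u * v),
        Nat.zero_le (u ^ 2), Nat.zero_le (v ^ 2), Nat.zero_le (u ^ 3)]
    refine le_trans ?_ (Nat.cast_le.2 hle)
    refine Set.encard_le_mul_of_fiber_le (fun E i => if i ∈ I then E i else 0)
      (fun E hE => hE.2.2)
      (encard_nondegSol_le hk hl hkl (fun i hi => ha i (hI hi)) hmix) fun y _ => ?_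
    refine le_trans (Set.encard_le_encard_of_injOn
      (f := fun E i => if i ∈ s \ I then E i else 0) ?_ ?_)
      (ih (s \ I) hsI fun i hi => ha i (hsI.subset hi))
    · rintro E ⟨⟨hE, -, hEI⟩, -⟩
      have hsum' : ∀ t ⊆ s \ I,
          ∑ i ∈ t, a i * powVal k l col (fun i => if i ∈ s \ I then E i else 0) i =
            ∑ i ∈ t, a i * powVal k l col E i := fun t ht =>
        Finset.sum_congr rfl fun i hi => by rw [powVal_ite_mem E (ht hi)]
      refine ⟨fun i hi => if_neg hi, ?_, fun t ht htne htc => ?_⟩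
      · have h1 := Finset.sum_sdiff (f := fun i => a i * powVal k l col E i) hI
        rw [hsum E hE hEI, hE.2.1, add_zero] at h1
        rw [hsum' _ subset_rfl, h1]
      · rw [hsum' t ht]
        exact hE.2.2 t (ht.trans hsI.subset) htne htc
    · rintro E ⟨⟨hE, -⟩, hEy⟩ F ⟨⟨hF, -⟩, hFy⟩ hEF
      funext i
      by_cases hi : i ∈ I
      · simpa [hi] using congrFun (hEy.trans hFy.symm) i
      by_cases his : i ∈ s
      · simpa [hi, his] using congrFun hEF i
      · rw [hE.1 i his, hF.1 i his]
  refine (Set.encard_le_of_forall_exists_mem s.powerset _ (n := 2 ^ s.card)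
    (Finset.card_powerset s).le ?_ key).trans ?_
  · intro E hE
    obtain ⟨I, hI, hIne, hI0, hImin⟩ := Finset.exists_minimal_sum_eq_zero hs hE.2.1
    exact ⟨I, Finset.mem_powerset.2 hI, hE, hIne, restrict_mem_nondegSol hI0 hImin⟩
  · rw [← pow_add]
    have h : s.card ≤ 20 * s.card ^ 3 :=
      (Nat.le_self_pow (by norm_num) _).trans (Nat.le_mul_of_pos_left _ (by norm_num))
    rw [show s.card + (20 * s.card ^ 3 - s.card) = 20 * s.card ^ 3 by omega]

end

theorem two_pow_cube_le {N : ℕ} (hN : 2 ≤ N) :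
    (2 : ℝ) ^ (20 * N ^ 3) ≤
      (2 : ℝ) ^ (-(N : ℤ)) * (8 * ((N : ℝ) - 1)) ^ (10 * N ^ 5 - N) := by
  have hN' : (2 : ℝ) ≤ N := by exact_mod_cast hN
  have hexp : 20 * N ^ 3 + N ≤ 3 * (10 * N ^ 5 - N) := by
    have h1 : 4 * N ^ 3 ≤ N ^ 5 := by
      calc 4 * N ^ 3 = 2 ^ 2 * N ^ 3 := by norm_num
        _ ≤ N ^ 2 * N ^ 3 := Nat.mul_le_mul_right _ (Nat.pow_le_pow_left hN 2)
        _ = N ^ 5 := by ring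
    have h2 : N ≤ N ^ 3 := Nat.le_self_pow (by norm_num) _
    omega
  rw [zpow_neg, zpow_natCast, ← div_eq_inv_mul, le_div_iff₀ (by positivity), ← pow_add]
  calc (2 : ℝ) ^ (20 * N ^ 3 + N) ≤ 2 ^ (3 * (10 * N ^ 5 - N)) :=
        pow_le_pow_right₀ (by norm_num) hexp
    _ = 8 ^ (10 * N ^ 5 - N) := by rw [pow_mul]; norm_num
    _ ≤ (8 * ((N : ℝ) - 1)) ^ (10 * N ^ 5 - N) :=
        pow_le_pow_left₀ (by norm_num) (by linarith) _

/-- If `k` and `ℓ` are multiplicatively independent, `n, m ≥ 1`, and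
`a₁, …, aₙ, b₁, …, bₘ` are nonzero rationals, then there are at most
`2^{-(n+m)} (8(n+m-1))^{10(n+m)^5 - (n+m)}` tuples `(X₁, …, Xₙ, Y₁, …, Yₘ)`
with each `Xᵢ` an integer power of `k`, each `Yⱼ` an integer power of `ℓ`,
`a₁X₁ + ⋯ + aₙXₙ + b₁Y₁ + ⋯ + bₘYₘ = 0`, and such that no nonempty subsum of
`a₁X₁ + ⋯ + aₙXₙ` and no nonempty subsum of `b₁Y₁ + ⋯ + bₘYₘ` vanishes. -/
theorem sunit_count_split_nondegenerate
    (k l : ℕ) (hk : 2 ≤ k) (hl : 2 ≤ l) (hkl : MultIndep k l)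
    (n m : ℕ) (hn : 1 ≤ n) (hm : 1 ≤ m)
    (a : Fin n → ℚ) (b : Fin m → ℚ) (ha : ∀ i, a i ≠ 0) (hb : ∀ j, b j ≠ 0)
    (T : Set ((Fin n → ℚ) × (Fin m → ℚ)))
    (hT : T = { p | (∀ i, ∃ e : ℤ, p.1 i = (k : ℚ) ^ e) ∧
                    (∀ j, ∃ e : ℤ, p.2 j = (l : ℚ) ^ e) ∧
                    (∑ i, a i * p.1 i) + (∑ j, b j * p.2 j) = 0 ∧
                    (∀ I : Finset (Fin n), I.Nonempty → ∑ i ∈ I, a i * p.1 i ≠ 0) ∧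
                    (∀ J : Finset (Fin m), J.Nonempty → ∑ j ∈ J, b j * p.2 j ≠ 0) }) :
    T.Finite ∧
      (T.ncard : ℝ) ≤ (2 : ℝ) ^ (-((n : ℤ) + m)) *
        (8 * ((n : ℝ) + m - 1)) ^ (10 * (n + m) ^ 5 - (n + m)) := by
  have hcount := encard_splitSol_le (col := Sum.isLeft) (s := Finset.univ) (a := Sum.elim a b)
    hk hl hkl (by rintro (i | j) -; exacts [ha i, hb j])
  rw [Finset.card_univ, Fintype.card_sum, Fintype.card_fin, Fintype.card_fin] at hcount
  have hsub : T ⊆ (fun E => (fun i => powVal k l Sum.isLeft E (Sum.inl i),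
      fun j => powVal k l Sum.isLeft E (Sum.inr j))) ''
        splitSol k l Sum.isLeft (Sum.elim a b) Finset.univ := by
    rintro ⟨X, Y⟩ hp
    rw [hT] at hp
    obtain ⟨hX, hY, h0, hI, hJ⟩ := hp
    choose e he using hX
    choose f hf using hY
    dsimp only at he hf h0 hI hJ
    have hXval : ∀ i, powVal k l Sum.isLeft (Sum.elim e f) (Sum.inl i) = X i := fun i => by
      simp [powVal, powBase, he]
    have hYval : ∀ j, powVal k l Sum.isLeft (Sum.elim e f) (Sum.inr j) = Y j := fun j => by
      simp [powVal, powBase, hf]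
    refine ⟨Sum.elim e f, ⟨fun i hi => absurd (Finset.mem_univ i) hi, ?_, ?_⟩,
      Prod.ext (funext hXval) (funext hYval)⟩
    · simpa only [Fintype.sum_sum_type, Sum.elim_inl, Sum.elim_inr, hXval, hYval] using h0
    · rintro t - ⟨x, hx⟩ ht
      rw [← Finset.toLeft_disjSum_toRight (u := t), Finset.sum_disjSum]
      simp only [Sum.elim_inl, Sum.elim_inr, hXval, hYval]
      rcases x with i | j
      · have hR : t.toRight = ∅ := Finset.eq_empty_of_forall_notMem fun j hj => by
          simpa using ht _ hx _ (Finset.mem_toRight.1 hj)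
        rw [hR, Finset.sum_empty, add_zero]
        exact hI _ ⟨i, Finset.mem_toLeft.2 hx⟩
      · have hL : t.toLeft = ∅ := Finset.eq_empty_of_forall_notMem fun i hi => by
          simpa using ht _ hx _ (Finset.mem_toLeft.1 hi)
        rw [hL, Finset.sum_empty, zero_add]
        exact hJ _ ⟨j, Finset.mem_toRight.2 hx⟩
  have hT' : T.encard ≤ (2 ^ (20 * (n + m) ^ 3) : ℕ) :=
    (Set.encard_le_encard hsub).trans ((Set.encard_image_le _ _).trans hcount)
  have hfin : T.Finite := Set.finite_of_encard_le_coe hT'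
  refine ⟨hfin, ?_⟩
  rw [← hfin.cast_ncard_eq, Nat.cast_le] at hT'
  have h1 : (T.ncard : ℝ) ≤ 2 ^ (20 * (n + m) ^ 3) := by exact_mod_cast hT'
  have h2 := two_pow_cube_le (N := n + m) (by omega)
  push_cast at h2
  exact h1.trans h2
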